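/- Let H (mod 𝔮) be a primitive congruence class group of K, let 0 < ε < 1/2, let T ≥ 1, and let χ (mod 𝔮) be a Hecke character with χ(H)=1. Then for every x > 0, | Σ_𝔫 (χ(𝔫)/N𝔫)·Ψ(x/N𝔫) − δ(χ)·(φ(𝔮)/N𝔮)·κ_K | ≤ e^{O_ε(n_K)} · { n_K^{n_K/4} · D_K^{1/2} · Q^{1/2} · T^{n_K/2 + 1} }^{1+ε}, where the sum runs over the nonzero integral ideals 𝔫 of K and φ(𝔮)=#(O_K/𝔮)^×. -/

import Mathlib

open scoped BigOperators
open Complex NumberField Filter Topology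

noncomputable section

namespace RTZ

/-- The degree `n_K = [K : ℚ]` of a number field. -/
def nK (K : Type*) [Field K] [NumberField K] : ℕ := Module.finrank ℚ K

/-- The absolute value `D_K` of the discriminant of `K`. -/
def DK (K : Type*) [Field K] [NumberField K] : ℕ := (NumberField.discr K).natAbs

/-- An algebraic integer is totally positive if it is positive under every real embedding. -/
def TotPos (K : Type*) [Field K] [NumberField K] (α : 𝓞 K) : Prop :=
  ∀ φ : K →+* ℝ, 0 < φ (algebraMap (𝓞 K) K α)

/-- A Hecke (narrow ray class) character modulo `𝔮`, regarded as a function on integral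
ideals extended by zero: it is completely multiplicative, vanishes on ideals not coprime
to `𝔮`, has modulus one on ideals coprime to `𝔮`, and is trivial on principal ideals
generated by totally positive elements `α ≡ 1 (mod 𝔮)`. -/
structure HeckeChar (K : Type*) [Field K] [NumberField K] (𝔮 : Ideal (𝓞 K)) where
  toFun : Ideal (𝓞 K) → ℂ
  map_mul' : ∀ 𝔞 𝔟 : Ideal (𝓞 K), toFun (𝔞 * 𝔟) = toFun 𝔞 * toFun 𝔟
  eq_zero' : ∀ 𝔞 : Ideal (𝓞 K), ¬ IsCoprime 𝔞 𝔮 → toFun 𝔞 = 0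
  norm_one' : ∀ 𝔞 : Ideal (𝓞 K), IsCoprime 𝔞 𝔮 → ‖toFun 𝔞‖ = 1
  ray_one' : ∀ α : 𝓞 K, TotPos K α → α - 1 ∈ 𝔮 → toFun (Ideal.span {α}) = 1

variable {K : Type*} [Field K] [NumberField K]

/-- The trivial (principal) Hecke character condition. -/
def IsTrivialChar {𝔮 : Ideal (𝓞 K)} (χ : HeckeChar K 𝔮) : Prop :=
  ∀ 𝔞, IsCoprime 𝔞 𝔮 → χ.toFun 𝔞 = 1

open scoped Classical in
/-- `δ(χ)`: the indicator of the trivial character. -/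
def delta {𝔮 : Ideal (𝓞 K)} (χ : HeckeChar K 𝔮) : ℝ :=
  if IsTrivialChar χ then 1 else 0

/-- `χ' (mod 𝔣)` induces `χ (mod 𝔮)`: `𝔣 ∣ 𝔮` and the two characters agree on ideals
coprime to `𝔮`. -/
def Induces {𝔣 𝔮 : Ideal (𝓞 K)} (χ' : HeckeChar K 𝔣) (χ : HeckeChar K 𝔮) : Prop :=
  𝔮 ≤ 𝔣 ∧ ∀ 𝔞, IsCoprime 𝔞 𝔮 → χ.toFun 𝔞 = χ'.toFun 𝔞

/-- `𝔣` is the conductor `𝔣_χ` of `χ`: `χ` is induced from a character mod `𝔣`, and `𝔣`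
divides every modulus from which `χ` is induced. -/
def IsConductor {𝔮 : Ideal (𝓞 K)} (χ : HeckeChar K 𝔮) (𝔣 : Ideal (𝓞 K)) : Prop :=
  (∃ χ' : HeckeChar K 𝔣, Induces χ' χ) ∧
    ∀ 𝔣' : Ideal (𝓞 K), (∃ χ' : HeckeChar K 𝔣', Induces χ' χ) → 𝔣' ≤ 𝔣

/-- A Hecke character is primitive if its conductor equals its modulus. -/
def IsPrimitiveChar {𝔮 : Ideal (𝓞 K)} (χ : HeckeChar K 𝔮) : Prop := IsConductor χ 𝔮

/-- Two integral ideals lie in the same narrow ray class mod `𝔮`: `(α)𝔞 = (β)𝔟` for some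
totally positive `α, β ≡ 1 (mod 𝔮)`. -/
def rayEquiv (𝔮 𝔞 𝔟 : Ideal (𝓞 K)) : Prop :=
  ∃ α β : 𝓞 K, TotPos K α ∧ TotPos K β ∧ α - 1 ∈ 𝔮 ∧ β - 1 ∈ 𝔮 ∧
    Ideal.span {α} * 𝔞 = Ideal.span {β} * 𝔟

/-- A congruence class group `H (mod 𝔮)`: a subgroup of `I(𝔮)` containing `P_𝔮`, described
by the set of integral ideals whose narrow ray class lies in the subgroup. -/
structure CongClassGroup (K : Type*) [Field K] [NumberField K] (𝔮 : Ideal (𝓞 K)) where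
  mem : Ideal (𝓞 K) → Prop
  coprime' : ∀ 𝔞, mem 𝔞 → IsCoprime 𝔞 𝔮
  princ_mem' : ∀ α : 𝓞 K, TotPos K α → α - 1 ∈ 𝔮 → mem (Ideal.span {α})
  mul_mem' : ∀ 𝔞 𝔟, mem 𝔞 → mem 𝔟 → mem (𝔞 * 𝔟)
  class_mem' : ∀ 𝔞 𝔟, IsCoprime 𝔟 𝔮 → rayEquiv 𝔮 𝔞 𝔟 → mem 𝔞 → mem 𝔟

/-- `χ(H) = 1`: the character is trivial on the congruence class group `H`. -/
def CharTrivOn {𝔮 : Ideal (𝓞 K)} (χ : HeckeChar K 𝔮) (H : CongClassGroup K 𝔮) : Prop :=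
  ∀ 𝔞, H.mem 𝔞 → χ.toFun 𝔞 = 1

/-- The coset of `H` in `I(𝔮)` determined by an integral ideal `𝔞₀`. -/
def coset {𝔮 : Ideal (𝓞 K)} (H : CongClassGroup K 𝔮) (𝔞₀ : Ideal (𝓞 K)) :
    Set (Ideal (𝓞 K)) :=
  {𝔞 | ∃ 𝔥, H.mem 𝔥 ∧ rayEquiv 𝔮 (𝔞₀ * 𝔥) 𝔞}

/-- `h_H = [I(𝔮) : H]`, the number of cosets of `H`. -/
def hH {𝔮 : Ideal (𝓞 K)} (H : CongClassGroup K 𝔮) : ℕ :=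
  Nat.card {C : Set (Ideal (𝓞 K)) // ∃ 𝔞₀, IsCoprime 𝔞₀ 𝔮 ∧ C = coset H 𝔞₀}

/-- `Q = Q_H = max { N𝔣_χ : χ (mod 𝔮), χ(H) = 1 }`. -/
def QH {𝔮 : Ideal (𝓞 K)} (H : CongClassGroup K 𝔮) : ℕ :=
  sSup {n | ∃ (χ : HeckeChar K 𝔮) (𝔣 : Ideal (𝓞 K)),
    CharTrivOn χ H ∧ IsConductor χ 𝔣 ∧ n = Ideal.absNorm 𝔣}

/-- `𝔣_H = lcm { 𝔣_χ : χ(H) = 1 }` (the lcm of ideals is their infimum). -/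
def fH {𝔮 : Ideal (𝓞 K)} (H : CongClassGroup K 𝔮) : Ideal (𝓞 K) :=
  sInf {𝔣 | ∃ χ : HeckeChar K 𝔮, CharTrivOn χ H ∧ IsConductor χ 𝔣}

/-- A congruence class group `H (mod 𝔮)` is primitive if `𝔮 = 𝔣_H`. -/
def IsPrimitiveCCG {𝔮 : Ideal (𝓞 K)} (H : CongClassGroup K 𝔮) : Prop := 𝔮 = fH H

/-- The Dirichlet series `Σ_𝔫 χ(𝔫) N𝔫^{-s}` of a Hecke character. -/
def LSer {𝔮 : Ideal (𝓞 K)} (χ : HeckeChar K 𝔮) (s : ℂ) : ℂ :=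
  ∑' 𝔞 : {I : Ideal (𝓞 K) // I ≠ ⊥}, χ.toFun 𝔞.1 * (Ideal.absNorm 𝔞.1 : ℂ) ^ (-s)

/-- `L` is "the" Hecke `L`-function of `χ`: analytic away from `s = 1` and given by the
Dirichlet series on `Re s > 1` (this determines `L` away from `s = 1`). -/
def IsLFun {𝔮 : Ideal (𝓞 K)} (χ : HeckeChar K 𝔮) (L : ℂ → ℂ) : Prop :=
  (∀ s : ℂ, s ≠ 1 → DifferentiableAt ℂ L s) ∧ ∀ s : ℂ, 1 < s.re → L s = LSer χ s

/-- The Dedekind zeta series of `K`. -/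
def zetaSer (K : Type*) [Field K] [NumberField K] (s : ℂ) : ℂ :=
  ∑' 𝔞 : {I : Ideal (𝓞 K) // I ≠ ⊥}, (Ideal.absNorm 𝔞.1 : ℂ) ^ (-s)

/-- `Z` is "the" Dedekind zeta function of `K`. -/
def IsZetaFun (K : Type*) [Field K] [NumberField K] (Z : ℂ → ℂ) : Prop :=
  (∀ s : ℂ, s ≠ 1 → DifferentiableAt ℂ Z s) ∧ ∀ s : ℂ, 1 < s.re → Z s = zetaSer K s

/-- `L` vanishes at `ρ` to order at least `m`. -/
def ZeroOrderAtLeast (L : ℂ → ℂ) (ρ : ℂ) (m : ℕ) : Prop :=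
  ∃ g : ℂ → ℂ, AnalyticAt ℂ g ρ ∧ ∀ᶠ z in nhds ρ, L z = (z - ρ) ^ m * g z

/-- `L` vanishes at `ρ` to order exactly `m`. -/
def ZeroOrderExact (L : ℂ → ℂ) (ρ : ℂ) (m : ℕ) : Prop :=
  ∃ g : ℂ → ℂ, AnalyticAt ℂ g ρ ∧ g ρ ≠ 0 ∧ ∀ᶠ z in nhds ρ, L z = (z - ρ) ^ m * g z

open scoped Classical in
/-- The von Mangoldt function `Λ_K` of the field `K`. -/
def ΛK (K : Type*) [Field K] [NumberField K] (𝔫 : Ideal (𝓞 K)) : ℝ :=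
  if h : ∃ (𝔭 : Ideal (𝓞 K)) (k : ℕ), 𝔭.IsPrime ∧ 𝔭 ≠ ⊥ ∧ 1 ≤ k ∧ 𝔫 = 𝔭 ^ k
  then Real.log (Ideal.absNorm h.choose) else 0

/-- The residue `κ_K` of `ζ_K` at `s = 1`, characterized as a limit of the real Dirichlet
series. -/
def IsResidue (K : Type*) [Field K] [NumberField K] (κ : ℝ) : Prop :=
  Filter.Tendsto (fun σ : ℝ => (σ - 1) *
      ∑' 𝔞 : {I : Ideal (𝓞 K) // I ≠ ⊥}, (Ideal.absNorm 𝔞.1 : ℝ) ^ (-σ))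
    (nhdsWithin 1 (Set.Ioi 1)) (nhds κ)

/-- `γ_K`, the Euler–Kronecker constant: `ζ_K(s) - κ_K/(s-1) → κ_K γ_K` as `s → 1⁺`. -/
def IsEulerKronecker (K : Type*) [Field K] [NumberField K] (κ γK : ℝ) : Prop :=
  Filter.Tendsto (fun σ : ℝ =>
      (∑' 𝔞 : {I : Ideal (𝓞 K) // I ≠ ⊥}, (Ideal.absNorm 𝔞.1 : ℝ) ^ (-σ)) - κ / (σ - 1))
    (nhdsWithin 1 (Set.Ioi 1)) (nhds (κ * γK))

/-- Weiss's weight function `Ψ` with parameter `A = T√(2 n_K)`: compactly supported in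
`[e^{-2n_K/A}, e^{2n_K/A}]`, `0 ≤ Ψ ≤ A/2`, with Mellin transform
`Ψ̂(s) = [sinh(s/A)/(s/A)]^{2 n_K}`. -/
def IsWeissWeight (n : ℕ) (A : ℝ) (Ψ : ℝ → ℝ) : Prop :=
  Continuous Ψ ∧ (∀ u : ℝ, 0 ≤ Ψ u ∧ Ψ u ≤ A / 2) ∧
  (∀ u : ℝ, u ∉ Set.Icc (Real.exp (-(2 * (n : ℝ)) / A)) (Real.exp ((2 * (n : ℝ)) / A)) →
    Ψ u = 0) ∧
  (∀ s : ℂ, s ≠ 0 →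
    (∫ u in Set.Ioi (0 : ℝ), (Ψ u : ℂ) * (u : ℂ) ^ (s - 1)) =
      (Complex.sinh (s / (A : ℂ)) / (s / (A : ℂ))) ^ (2 * n))


set_option linter.unusedSectionVars false

/-! ### Conductors -/

lemma TotPos.mul {α β : 𝓞 K} (hα : TotPos K α) (hβ : TotPos K β) : TotPos K (α * β) := by
  intro φ
  rw [map_mul, map_mul]
  exact mul_pos (hα φ) (hβ φ)

lemma TotPos.of_mul_left {α β : 𝓞 K} (hα : TotPos K α) (h : TotPos K (α * β)) : TotPos K β := by
  intro φ
  have h1 := h φ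
  rw [map_mul, map_mul] at h1
  exact (mul_pos_iff_of_pos_left (hα φ)).mp h1

/-- Every class modulo a nonzero ideal has a totally positive representative. -/
lemma exists_totPos_add (I : Ideal (𝓞 K)) (hI : I ≠ ⊥) (α : 𝓞 K) :
    ∃ m ∈ I, TotPos K (α + m) := by
  have hN : 0 < Ideal.absNorm I := by
    rw [Nat.pos_iff_ne_zero, ne_eq, Ideal.absNorm_eq_zero_iff]; exact hI
  obtain ⟨k, hk⟩ : ∃ k : ℕ, ∀ φ : K →+* ℝ, -φ (algebraMap (𝓞 K) K α) < k := by
    obtain ⟨M, hM⟩ := (Set.finite_range fun φ : K →+* ℝ => -φ (algebraMap (𝓞 K) K α)).bddAbove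
    obtain ⟨k, hk⟩ := exists_nat_gt M
    exact ⟨k, fun φ => (hM ⟨φ, rfl⟩).trans_lt hk⟩
  refine ⟨(k : 𝓞 K) * (Ideal.absNorm I : 𝓞 K), I.mul_mem_left _ (Ideal.absNorm_mem I), ?_⟩
  intro φ
  have h1 := hk φ
  simp only [map_add, map_mul, map_natCast]
  have h2 : (1 : ℝ) ≤ Ideal.absNorm I := by exact_mod_cast hN
  have h3 : (k : ℝ) * 1 ≤ k * Ideal.absNorm I := by gcongr
  linarith

lemma isCoprime_iff_forall_isMaximal {R : Type*} [CommRing R] {I J : Ideal R} :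
    IsCoprime I J ↔ ∀ P : Ideal R, P.IsMaximal → I ≤ P → ¬ J ≤ P := by
  rw [Ideal.isCoprime_iff_sup_eq]
  constructor
  · intro h P hP hI hJ
    exact hP.ne_top (top_le_iff.mp (h ▸ sup_le hI hJ))
  · intro h
    by_contra h1
    obtain ⟨P, hP, hle⟩ := Ideal.exists_le_maximal _ h1
    exact h P hP (le_sup_left.trans hle) (le_sup_right.trans hle)

lemma isCoprime_mul_iff {I J L : Ideal (𝓞 K)} :
    IsCoprime (I * J) L ↔ IsCoprime I L ∧ IsCoprime J L := IsCoprime.mul_left_iff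

lemma isCoprime_span_of_sub_one_mem {I : Ideal (𝓞 K)} {α : 𝓞 K} (h : α - 1 ∈ I) :
    IsCoprime (Ideal.span {α}) I := by
  rw [Ideal.isCoprime_iff_exists]
  exact ⟨α, Ideal.mem_span_singleton_self α, -(α - 1), I.neg_mem h, by ring⟩

lemma isCoprime_of_le_right {I J L : Ideal (𝓞 K)} (h : IsCoprime I J) (hJ : J ≤ L) :
    IsCoprime I L := by
  rw [Ideal.isCoprime_iff_sup_eq] at h ⊢
  exact top_le_iff.mp (h ▸ sup_le_sup_left hJ I)

/-- The part of `𝔮` away from `𝔤`, up to powers. -/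
lemma exists_coprime_part (𝔤 𝔮 : Ideal (𝓞 K)) (hq : 𝔮 ≠ ⊥) :
    ∃ 𝔮' : Ideal (𝓞 K), IsCoprime 𝔤 𝔮' ∧ 𝔮' ≠ ⊥ ∧
      ∀ P : Ideal (𝓞 K), P.IsMaximal → 𝔮 ≤ P → 𝔤 ≤ P ∨ 𝔮' ≤ P := by
  classical
  let S := (UniqueFactorizationMonoid.normalizedFactors 𝔮).toFinset.filter fun P => ¬ 𝔤 ≤ P
  have hS : ∀ P ∈ S, Prime P := fun P hP => by
    simp only [S, Finset.mem_filter, Multiset.mem_toFinset] at hP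
    exact UniqueFactorizationMonoid.prime_of_normalized_factor _ hP.1
  refine ⟨∏ P ∈ S, P, IsCoprime.prod_right fun P hP => ?_, ?_, fun P hP hqP => ?_⟩
  · rw [isCoprime_iff_forall_isMaximal]
    intro M hM hg hPM
    have hPp := Ideal.isPrime_of_prime (hS P hP)
    have : P.IsMaximal := hPp.isMaximal (hS P hP).ne_zero
    have h1 := this.eq_of_le hM.ne_top hPM
    simp only [S, Finset.mem_filter] at hP
    exact hP.2 (h1 ▸ hg)
  · rw [← Ideal.zero_eq_bot, Finset.prod_ne_zero_iff]
    exact fun P hP => (hS P hP).ne_zero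
  · by_cases hg : 𝔤 ≤ P
    · exact Or.inl hg
    · right
      have hP0 : P ≠ ⊥ := fun h => hq (le_bot_iff.mp (h ▸ hqP))
      have hPp : Prime P := Ideal.prime_of_isPrime hP0 hP.isPrime
      obtain ⟨Q, hQ, hQP⟩ := UniqueFactorizationMonoid.exists_mem_normalizedFactors_of_dvd
        (a := 𝔮) hq hPp.irreducible (Ideal.dvd_iff_le.mpr hqP)
      have : P = Q := associated_iff_eq.mp hQP
      subst this
      have hPS : P ∈ S := by
        simp only [S, Finset.mem_filter, Multiset.mem_toFinset]
        exact ⟨hQ, hg⟩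
      exact Ideal.dvd_iff_le.mp (Finset.dvd_prod_of_mem _ hPS)

/-- Simultaneous congruences modulo coprime ideals. -/
lemma exists_congr_congr {I J : Ideal (𝓞 K)} (h : IsCoprime I J) (a b : 𝓞 K) :
    ∃ c : 𝓞 K, c - a ∈ I ∧ c - b ∈ J := by
  obtain ⟨i, hi, j, hj, hij⟩ := Ideal.isCoprime_iff_exists.mp h
  refine ⟨j * a + i * b, ?_, ?_⟩
  · have : j * a + i * b - a = i * (b - a) := by linear_combination a * hij
    rw [this]; exact I.mul_mem_right _ hi
  · have : j * a + i * b - b = j * (a - b) := by linear_combination b * hij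
    rw [this]; exact J.mul_mem_right _ hj

/-- An ideal prime to `𝔤` divides a principal ideal `(α)` with `α ≡ 1 (mod 𝔤)` totally positive
and complement prime to `𝔮`. -/
lemma exists_mul_eq_span {𝔤 𝔮 𝔞 : Ideal (𝓞 K)} (hg : 𝔤 ≠ ⊥) (hq : 𝔮 ≠ ⊥) (ha : 𝔞 ≠ ⊥)
    (hag : IsCoprime 𝔞 𝔤) :
    ∃ (α : 𝓞 K) (𝔠 : Ideal (𝓞 K)), TotPos K α ∧ α - 1 ∈ 𝔤 ∧ 𝔞 * 𝔠 = Ideal.span {α} ∧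
      IsCoprime 𝔠 𝔮 := by
  obtain ⟨𝔮', hcop, hq'0, hq'⟩ := exists_coprime_part 𝔤 𝔮 hq
  have haq : 𝔞 * 𝔮' ≠ ⊥ := mul_ne_zero ha hq'0
  obtain ⟨α₀, hα₀⟩ := IsDedekindDomain.exists_sup_span_eq
    (Ideal.mul_le_left : 𝔞 * 𝔮' ≤ 𝔞) haq
  have hα₀a : α₀ ∈ 𝔞 := by
    rw [← hα₀]; exact Ideal.mem_sup_right (Ideal.mem_span_singleton_self _)
  obtain ⟨α₁, h1, h2⟩ := exists_congr_congr (IsCoprime.mul_right hag.symm hcop) 1 α₀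
  obtain ⟨m, hm, hpos⟩ := exists_totPos_add (𝔤 * (𝔞 * 𝔮')) (mul_ne_zero hg haq) α₁
  set α := α₁ + m with hα
  have hαg : α - 1 ∈ 𝔤 := by
    have : α - 1 = (α₁ - 1) + m := by rw [hα]; ring
    rw [this]; exact 𝔤.add_mem h1 (Ideal.mul_le_left hm)
  have hαa : α - α₀ ∈ 𝔞 * 𝔮' := by
    have : α - α₀ = (α₁ - α₀) + m := by rw [hα]; ring
    rw [this]; exact Ideal.add_mem _ h2 (Ideal.mul_le_right hm)
  have hαmem : α ∈ 𝔞 := by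
    have : α = (α - α₀) + α₀ := by ring
    rw [this]; exact 𝔞.add_mem (Ideal.mul_le_left hαa) hα₀a
  obtain ⟨𝔠, hc⟩ : 𝔞 ∣ Ideal.span {α} := by
    rw [Ideal.dvd_iff_le, Ideal.span_singleton_le_iff_mem]; exact hαmem
  refine ⟨α, 𝔠, hpos, hαg, hc.symm, ?_⟩
  have hsup : 𝔞 * 𝔠 ⊔ 𝔞 * 𝔮' = 𝔞 := by
    rw [← hc]
    apply le_antisymm
    · rw [sup_le_iff, Ideal.span_singleton_le_iff_mem]; exact ⟨hαmem, Ideal.mul_le_left⟩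
    · conv_lhs => rw [← hα₀]
      rw [sup_le_iff, Ideal.span_singleton_le_iff_mem]
      refine ⟨le_sup_right, ?_⟩
      have : α₀ = α - (α - α₀) := by ring
      rw [this]
      exact Ideal.sub_mem _ (Ideal.mem_sup_left (Ideal.mem_span_singleton_self _))
        (Ideal.mem_sup_right hαa)
  rw [isCoprime_iff_forall_isMaximal]
  intro P hP hcP hqP
  rcases hq' P hP hqP with h | h
  · have hαP : α ∈ P := hcP (by
      have : α ∈ 𝔞 * 𝔠 := by rw [← hc]; exact Ideal.mem_span_singleton_self _
      exact Ideal.mul_le_right this)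
    refine hP.ne_top ((Ideal.eq_top_iff_one _).mpr ?_)
    have : (1 : 𝓞 K) = α - (α - 1) := by ring
    rw [this]; exact P.sub_mem hαP (h hαg)
  · rw [← Ideal.mul_sup] at hsup
    have h3 : 𝔠 ⊔ 𝔮' = ⊤ := by
      have : 𝔞 * (𝔠 ⊔ 𝔮') = 𝔞 * ⊤ := by rw [hsup, Ideal.mul_top]
      exact mul_left_cancel₀ ha this
    exact hP.ne_top (top_le_iff.mp (h3 ▸ sup_le hcP h))

lemma HeckeChar.ne_zero {𝔮 : Ideal (𝓞 K)} (χ : HeckeChar K 𝔮) {𝔞 : Ideal (𝓞 K)}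
    (h : IsCoprime 𝔞 𝔮) : χ.toFun 𝔞 ≠ 0 := by
  intro h0
  have := χ.norm_one' 𝔞 h
  simp [h0] at this

lemma exists_totPos_inv {𝔮 : Ideal (𝓞 K)} (hq : 𝔮 ≠ ⊥) {β : 𝓞 K}
    (hβ : IsCoprime (Ideal.span {β}) 𝔮) :
    ∃ γ : 𝓞 K, TotPos K γ ∧ γ * β - 1 ∈ 𝔮 ∧ IsCoprime (Ideal.span {γ}) 𝔮 := by
  obtain ⟨i, hi, j, hj, hij⟩ := Ideal.isCoprime_iff_exists.mp hβ
  obtain ⟨c, rfl⟩ := Ideal.mem_span_singleton'.mp hi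
  obtain ⟨m, hm, hpos⟩ := exists_totPos_add 𝔮 hq c
  have h1 : (c + m) * β - 1 ∈ 𝔮 := by
    have : (c + m) * β - 1 = m * β - j := by linear_combination hij
    rw [this]; exact 𝔮.sub_mem (𝔮.mul_mem_right _ hm) hj
  refine ⟨c + m, hpos, h1, ?_⟩
  have := isCoprime_span_of_sub_one_mem h1
  rw [← Ideal.span_singleton_mul_span_singleton] at this
  exact (isCoprime_mul_iff.mp this).1

/-- A character induced from two moduli is trivial on the ray modulo their greatest common
divisor. -/
lemma ray_sup_of_induces {𝔮 𝔣₁ 𝔣₂ : Ideal (𝓞 K)} (hq : 𝔮 ≠ ⊥) {χ : HeckeChar K 𝔮}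
    {χ₁ : HeckeChar K 𝔣₁} {χ₂ : HeckeChar K 𝔣₂} (h₁ : Induces χ₁ χ) (h₂ : Induces χ₂ χ)
    {α : 𝓞 K} (hpos : TotPos K α) (hα : α - 1 ∈ 𝔣₁ ⊔ 𝔣₂) (hcop : IsCoprime (Ideal.span {α}) 𝔮) :
    χ.toFun (Ideal.span {α}) = 1 := by
  obtain ⟨a, ha, b, hb, hab⟩ := Submodule.mem_sup.mp hα
  obtain ⟨𝔮', hc, hq'0, hq'⟩ := exists_coprime_part (𝔣₁ ⊓ 𝔣₂) 𝔮 hq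
  obtain ⟨β₀, hβ1, hβ2⟩ := exists_congr_congr hc (1 + a) 1
  have hf : 𝔣₁ ⊓ 𝔣₂ ≠ ⊥ := fun h => hq (le_bot_iff.mp (h ▸ le_inf h₁.1 h₂.1))
  obtain ⟨m, hm, hβpos⟩ := exists_totPos_add ((𝔣₁ ⊓ 𝔣₂) * 𝔮') (mul_ne_zero hf hq'0) β₀
  set β := β₀ + m with hβ
  have hm1 : m ∈ 𝔣₁ ⊓ 𝔣₂ := Ideal.mul_le_left hm
  have hβf1 : β - 1 ∈ 𝔣₁ := by
    have : β - 1 = (β₀ - (1 + a)) + m + a := by rw [hβ]; ring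
    rw [this]; exact 𝔣₁.add_mem (𝔣₁.add_mem hβ1.1 hm1.1) ha
  have hβf2 : β - α ∈ 𝔣₂ := by
    have : β - α = (β₀ - (1 + a)) + m - b := by rw [hβ]; linear_combination hab
    rw [this]; exact 𝔣₂.sub_mem (𝔣₂.add_mem hβ1.2 hm1.2) hb
  have hβq' : β - 1 ∈ 𝔮' := by
    have : β - 1 = (β₀ - 1) + m := by rw [hβ]; ring
    rw [this]; exact 𝔮'.add_mem hβ2 (Ideal.mul_le_right hm)
  have hone : ∀ P : Ideal (𝓞 K), P.IsMaximal → β ∈ P → ¬ (β - 1 ∈ P) := fun P hP h h' =>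
    hP.ne_top ((Ideal.eq_top_iff_one _).mpr (by
      have : (1 : 𝓞 K) = β - (β - 1) := by ring
      rw [this]; exact P.sub_mem h h'))
  have hβq : IsCoprime (Ideal.span {β}) 𝔮 := by
    rw [isCoprime_iff_forall_isMaximal]
    intro P hP hβP hqP
    rw [Ideal.span_singleton_le_iff_mem] at hβP
    rcases hq' P hP hqP with h | h
    · rcases (hP.isPrime.inf_le).mp h with h | h
      · exact hone P hP hβP (h hβf1)
      · refine isCoprime_iff_forall_isMaximal.mp hcop P hP ?_ hqP
        rw [Ideal.span_singleton_le_iff_mem]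
        have : α = β - (β - α) := by ring
        rw [this]; exact P.sub_mem hβP (h hβf2)
    · exact hone P hP hβP (h hβq')
  have hχβ : χ.toFun (Ideal.span {β}) = 1 := by
    rw [h₁.2 _ hβq]; exact χ₁.ray_one' β hβpos hβf1
  obtain ⟨γ, hγpos, hγβ, hγ⟩ := exists_totPos_inv hq hβq
  have e1 : χ.toFun (Ideal.span {γ}) * χ.toFun (Ideal.span {β}) = 1 := by
    rw [← χ.map_mul', Ideal.span_singleton_mul_span_singleton]
    exact χ.ray_one' _ (hγpos.mul hβpos) hγβ
  have e2 : χ.toFun (Ideal.span {γ}) * χ.toFun (Ideal.span {α}) = 1 := by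
    rw [← χ.map_mul', h₂.2 _ (isCoprime_mul_iff.mpr ⟨hγ, hcop⟩),
      Ideal.span_singleton_mul_span_singleton]
    refine χ₂.ray_one' _ (hγpos.mul hpos) ?_
    have : γ * α - 1 = (γ * β - 1) - γ * (β - α) := by ring
    rw [this]; exact 𝔣₂.sub_mem (h₂.1 hγβ) (𝔣₂.mul_mem_left _ hβf2)
  rw [hχβ, mul_one] at e1
  rwa [e1, one_mul] at e2

lemma eq_of_mul_eq_span {𝔮 𝔤 : Ideal (𝓞 K)} (hq : 𝔮 ≠ ⊥) (hqg : 𝔮 ≤ 𝔤) {χ : HeckeChar K 𝔮}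
    (hray : ∀ α : 𝓞 K, TotPos K α → α - 1 ∈ 𝔤 → IsCoprime (Ideal.span {α}) 𝔮 →
      χ.toFun (Ideal.span {α}) = 1)
    {𝔞 𝔠 𝔠' : Ideal (𝓞 K)} {α α' : 𝓞 K} (hpos : TotPos K α) (hpos' : TotPos K α')
    (hα : α - 1 ∈ 𝔤) (hα' : α' - 1 ∈ 𝔤) (h : 𝔞 * 𝔠 = Ideal.span {α})
    (h' : 𝔞 * 𝔠' = Ideal.span {α'})
    (hc : IsCoprime 𝔠 𝔮) (hc' : IsCoprime 𝔠' 𝔮) (hα0 : α ≠ 0) :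
    χ.toFun 𝔠 = χ.toFun 𝔠' := by
  have hg : 𝔤 ≠ ⊥ := fun h => hq (le_bot_iff.mp (h ▸ hqg))
  have hc0 : 𝔠 ≠ ⊥ := by
    rintro rfl
    rw [Ideal.mul_bot, eq_comm, Ideal.span_singleton_eq_bot] at h
    exact hα0 h
  obtain ⟨γ, 𝔢, hγpos, hγ, he, hecop⟩ :=
    exists_mul_eq_span hg hq hc0 (isCoprime_of_le_right hc hqg)
  have hγcop : IsCoprime (Ideal.span {γ}) 𝔮 := by
    rw [← he]; exact isCoprime_mul_iff.mpr ⟨hc, hecop⟩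
  have key : Ideal.span {α} * (𝔠' * 𝔢) = Ideal.span {α' * γ} := by
    rw [← Ideal.span_singleton_mul_span_singleton, ← he, ← h, ← h']
    ring
  obtain ⟨δ, hδ⟩ : α ∣ α' * γ := by
    exact Ideal.span_singleton_le_span_singleton.mp (key ▸ Ideal.mul_le_left)
  have hδspan : 𝔠' * 𝔢 = Ideal.span {δ} := by
    rw [hδ, ← Ideal.span_singleton_mul_span_singleton] at key
    exact mul_left_cancel₀ (by rw [Ideal.zero_eq_bot, ne_eq, Ideal.span_singleton_eq_bot]
                               exact hα0) key
  have hδpos : TotPos K δ := hpos.of_mul_left (by rw [← hδ]; exact hpos'.mul hγpos)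
  have hδ1 : δ - 1 ∈ 𝔤 := by
    have : δ - 1 = (α' - 1) * γ + (γ - 1) - (α - 1) * δ := by linear_combination -hδ
    rw [this]
    exact 𝔤.sub_mem (𝔤.add_mem (𝔤.mul_mem_right _ hα') hγ) (𝔤.mul_mem_right _ hα)
  have e1 : χ.toFun 𝔠' * χ.toFun 𝔢 = 1 := by
    rw [← χ.map_mul', hδspan]
    exact hray δ hδpos hδ1 (by rw [← hδspan]; exact isCoprime_mul_iff.mpr ⟨hc', hecop⟩)
  have e2 : χ.toFun 𝔠 * χ.toFun 𝔢 = 1 := by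
    rw [← χ.map_mul', he]
    exact hray γ hγpos hγ hγcop
  exact mul_right_cancel₀ (χ.ne_zero hecop) (e2.trans e1.symm)

lemma ne_bot_of_isCoprime {𝔞 𝔤 : Ideal (𝓞 K)} (hg : 𝔤 ≠ ⊤) (h : IsCoprime 𝔞 𝔤) : 𝔞 ≠ ⊥ := by
  rintro rfl
  rw [Ideal.isCoprime_iff_sup_eq, bot_sup_eq] at h
  exact hg h

lemma ne_zero_of_sub_one_mem {α : 𝓞 K} {𝔤 : Ideal (𝓞 K)} (hg : 𝔤 ≠ ⊤) (h : α - 1 ∈ 𝔤) :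
    α ≠ 0 := by
  rintro rfl
  rw [zero_sub, neg_mem_iff] at h
  exact hg ((Ideal.eq_top_iff_one _).mpr h)

/-- A character trivial on the ray modulo a proper divisor `𝔤` of `𝔮` is induced from `𝔤`. -/
lemma exists_induces {𝔮 𝔤 : Ideal (𝓞 K)} (hq : 𝔮 ≠ ⊥) (hqg : 𝔮 ≤ 𝔤) (hgt : 𝔤 ≠ ⊤)
    {χ : HeckeChar K 𝔮}
    (hray : ∀ α : 𝓞 K, TotPos K α → α - 1 ∈ 𝔤 → IsCoprime (Ideal.span {α}) 𝔮 →
      χ.toFun (Ideal.span {α}) = 1) :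
    ∃ χ' : HeckeChar K 𝔤, Induces χ' χ := by
  classical
  have hg : 𝔤 ≠ ⊥ := fun h => hq (le_bot_iff.mp (h ▸ hqg))
  have ex : ∀ 𝔞 : Ideal (𝓞 K), IsCoprime 𝔞 𝔤 → ∃ (α : 𝓞 K) (𝔠 : Ideal (𝓞 K)), TotPos K α ∧
      α - 1 ∈ 𝔤 ∧ 𝔞 * 𝔠 = Ideal.span {α} ∧ IsCoprime 𝔠 𝔮 := fun 𝔞 h =>
    exists_mul_eq_span hg hq (ne_bot_of_isCoprime hgt h) h
  choose! A C hApos hA hAC hC using ex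
  let F : Ideal (𝓞 K) → ℂ := fun 𝔞 => if IsCoprime 𝔞 𝔤 then (χ.toFun (C 𝔞))⁻¹ else 0
  have hF : ∀ {𝔞 𝔠 : Ideal (𝓞 K)} {α : 𝓞 K}, IsCoprime 𝔞 𝔤 → TotPos K α → α - 1 ∈ 𝔤 →
      𝔞 * 𝔠 = Ideal.span {α} → IsCoprime 𝔠 𝔮 → F 𝔞 = (χ.toFun 𝔠)⁻¹ := by
    intro 𝔞 𝔠 α h h1 h2 h3 h4
    simp only [F, if_pos h]
    rw [eq_of_mul_eq_span hq hqg hray (hApos 𝔞 h) h1 (hA 𝔞 h) h2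
      (hAC 𝔞 h) h3 (hC 𝔞 h) h4 (ne_zero_of_sub_one_mem hgt (hA 𝔞 h))]
  refine ⟨⟨F, fun 𝔞 𝔟 => ?_, fun 𝔞 h => if_neg h, fun 𝔞 h => ?_, fun α hpos hα => ?_⟩,
    hqg, fun 𝔞 h => ?_⟩
  · by_cases ha : IsCoprime 𝔞 𝔤
    · by_cases hb : IsCoprime 𝔟 𝔤
      · rw [hF (isCoprime_mul_iff.mpr ⟨ha, hb⟩) ((hApos 𝔞 ha).mul (hApos 𝔟 hb)) (𝔠 := C 𝔞 * C 𝔟) ?_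
          ?_ (isCoprime_mul_iff.mpr ⟨hC 𝔞 ha, hC 𝔟 hb⟩)]
        · simp only [F, if_pos ha, if_pos hb, χ.map_mul', mul_inv]
        · have : A 𝔞 * A 𝔟 - 1 = (A 𝔞 - 1) * A 𝔟 + (A 𝔟 - 1) := by ring
          rw [this]; exact 𝔤.add_mem (𝔤.mul_mem_right _ (hA 𝔞 ha)) (hA 𝔟 hb)
        · rw [← Ideal.span_singleton_mul_span_singleton, ← hAC 𝔞 ha, ← hAC 𝔟 hb]; ring
      · have : ¬ IsCoprime (𝔞 * 𝔟) 𝔤 := fun h => hb (isCoprime_mul_iff.mp h).2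
        simp only [F, if_neg this, if_neg hb, mul_zero]
    · have : ¬ IsCoprime (𝔞 * 𝔟) 𝔤 := fun h => ha (isCoprime_mul_iff.mp h).1
      simp only [F, if_neg this, if_neg ha, zero_mul]
  · simp only [F, if_pos h, norm_inv, χ.norm_one' _ (hC 𝔞 h), inv_one]
  · have hcop := isCoprime_span_of_sub_one_mem hα
    have hmul := hAC _ hcop
    obtain ⟨δ, hδ⟩ : α ∣ A (Ideal.span {α}) := by
      exact Ideal.span_singleton_le_span_singleton.mp (hmul ▸ Ideal.mul_le_left)
    have hα0 := ne_zero_of_sub_one_mem hgt hα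
    have hδspan : C (Ideal.span {α}) = Ideal.span {δ} := by
      rw [hδ, ← Ideal.span_singleton_mul_span_singleton] at hmul
      exact mul_left_cancel₀ (by rw [Ideal.zero_eq_bot, ne_eq, Ideal.span_singleton_eq_bot]
                                 exact hα0) hmul
    have h1 : χ.toFun (Ideal.span {δ}) = 1 := by
      refine hray δ (hpos.of_mul_left (hδ ▸ hApos _ hcop)) ?_ (hδspan ▸ hC _ hcop)
      have : δ - 1 = (A (Ideal.span {α}) - 1) - (α - 1) * δ := by linear_combination -hδ
      rw [this]; exact 𝔤.sub_mem (hA _ hcop) (𝔤.mul_mem_right _ hα)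
    simp only [F, if_pos hcop, hδspan, h1, inv_one]
  · have hg' := isCoprime_of_le_right h hqg
    have h1 : χ.toFun 𝔞 * χ.toFun (C 𝔞) = 1 := by
      rw [← χ.map_mul', hAC 𝔞 hg']
      exact hray _ (hApos 𝔞 hg') (hA 𝔞 hg')
        (by rw [← hAC 𝔞 hg']; exact isCoprime_mul_iff.mpr ⟨h, hC 𝔞 hg'⟩)
    simp only [F, if_pos hg']
    exact eq_inv_of_mul_eq_one_left h1

lemma exists_induces_sup {𝔮 𝔣₁ 𝔣₂ : Ideal (𝓞 K)} (hq : 𝔮 ≠ ⊥) {χ : HeckeChar K 𝔮}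
    (h₁ : ∃ χ₁ : HeckeChar K 𝔣₁, Induces χ₁ χ) (h₂ : ∃ χ₂ : HeckeChar K 𝔣₂, Induces χ₂ χ)
    (hne : 𝔣₁ ⊔ 𝔣₂ ≠ ⊤) : ∃ χ' : HeckeChar K (𝔣₁ ⊔ 𝔣₂), Induces χ' χ := by
  obtain ⟨χ₁, h₁⟩ := h₁
  obtain ⟨χ₂, h₂⟩ := h₂
  exact exists_induces hq (h₁.1.trans le_sup_left) hne
    fun α hpos hα hcop => ray_sup_of_induces hq h₁ h₂ hpos hα hcop

/-- If all moduli inducing `χ` lie in a proper ideal, then `χ` has a conductor. -/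
lemma exists_isConductor {𝔮 𝔪 : Ideal (𝓞 K)} (hq : 𝔮 ≠ ⊥) (χ : HeckeChar K 𝔮) (hm : 𝔪 ≠ ⊤)
    (h : ∀ 𝔣 : Ideal (𝓞 K), (∃ χ' : HeckeChar K 𝔣, Induces χ' χ) → 𝔣 ≤ 𝔪) :
    ∃ 𝔣, IsConductor χ 𝔣 := by
  obtain ⟨𝔣, hf, hmax⟩ := wellFounded_gt.has_min
    {𝔣 : Ideal (𝓞 K) | ∃ χ' : HeckeChar K 𝔣, Induces χ' χ} ⟨𝔮, χ, le_rfl, fun _ _ => rfl⟩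
  refine ⟨𝔣, hf, fun 𝔣' hf' => ?_⟩
  have h1 := exists_induces_sup hq hf hf' (fun h2 => hm (top_le_iff.mp
    (h2 ▸ sup_le (h 𝔣 hf) (h 𝔣' hf'))))
  by_contra h3
  exact hmax _ h1 (lt_of_le_of_ne le_sup_left (fun h4 => h3 (h4 ▸ le_sup_right)))

/-! ### The norm of a primitive modulus is at most `Q ^ 2` -/

lemma HeckeChar.map_top {𝔮 : Ideal (𝓞 K)} (χ : HeckeChar K 𝔮) : χ.toFun ⊤ = 1 := by
  have h : IsCoprime (⊤ : Ideal (𝓞 K)) 𝔮 := by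
    rw [Ideal.isCoprime_iff_sup_eq, top_sup_eq]
  have h1 := χ.map_mul' ⊤ ⊤
  rw [Ideal.top_mul] at h1
  exact (mul_right_cancel₀ (χ.ne_zero h) (by rw [one_mul]; exact h1)).symm

open scoped Classical in
/-- The principal character modulo `𝔮`. -/
def principalChar (𝔮 : Ideal (𝓞 K)) : HeckeChar K 𝔮 where
  toFun 𝔞 := if IsCoprime 𝔞 𝔮 then 1 else 0
  map_mul' 𝔞 𝔟 := by
    by_cases ha : IsCoprime 𝔞 𝔮 <;> by_cases hb : IsCoprime 𝔟 𝔮 <;> simp [isCoprime_mul_iff, ha, hb]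
  eq_zero' 𝔞 h := if_neg h
  norm_one' 𝔞 h := by simp [h]
  ray_one' α _ h := if_pos (isCoprime_span_of_sub_one_mem h)

lemma principalChar_apply {𝔮 𝔞 : Ideal (𝓞 K)} (h : IsCoprime 𝔞 𝔮) :
    (principalChar 𝔮).toFun 𝔞 = 1 := if_pos h

/-- A finite product of Hecke characters. -/
def HeckeChar.prod {𝔮 : Ideal (𝓞 K)} {ι : Type*} (χ : ι → HeckeChar K 𝔮) (E : Finset ι) :
    HeckeChar K 𝔮 where
  toFun 𝔞 := (principalChar 𝔮).toFun 𝔞 * ∏ i ∈ E, (χ i).toFun 𝔞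
  map_mul' 𝔞 𝔟 := by
    simp only [HeckeChar.map_mul', Finset.prod_mul_distrib]; ring
  eq_zero' 𝔞 h := by rw [(principalChar 𝔮).eq_zero' 𝔞 h, zero_mul]
  norm_one' 𝔞 h := by
    rw [norm_mul, (principalChar 𝔮).norm_one' 𝔞 h, norm_prod, one_mul]
    exact Finset.prod_eq_one fun i _ => (χ i).norm_one' 𝔞 h
  ray_one' α hα h := by
    rw [(principalChar 𝔮).ray_one' α hα h, one_mul]
    exact Finset.prod_eq_one fun i _ => (χ i).ray_one' α hα h

lemma HeckeChar.prod_apply {𝔮 : Ideal (𝓞 K)} {ι : Type*} (χ : ι → HeckeChar K 𝔮) (E : Finset ι)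
    {𝔞 : Ideal (𝓞 K)} (h : IsCoprime 𝔞 𝔮) :
    (HeckeChar.prod χ E).toFun 𝔞 = ∏ i ∈ E, (χ i).toFun 𝔞 := by
  change (principalChar 𝔮).toFun 𝔞 * _ = _
  rw [principalChar_apply h, one_mul]

/-- A quotient of Hecke characters, modulo the intersection of the moduli. -/
def HeckeChar.div {𝔣 𝔤 : Ideal (𝓞 K)} (χ : HeckeChar K 𝔣) (ψ : HeckeChar K 𝔤) :
    HeckeChar K (𝔣 ⊓ 𝔤) where
  toFun 𝔞 := (principalChar (𝔣 ⊓ 𝔤)).toFun 𝔞 * (χ.toFun 𝔞 * (ψ.toFun 𝔞)⁻¹)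
  map_mul' 𝔞 𝔟 := by
    simp only [HeckeChar.map_mul', mul_inv]; ring
  eq_zero' 𝔞 h := by rw [(principalChar _).eq_zero' 𝔞 h, zero_mul]
  norm_one' 𝔞 h := by
    rw [norm_mul, (principalChar _).norm_one' 𝔞 h, norm_mul, norm_inv,
      χ.norm_one' 𝔞 (isCoprime_of_le_right h inf_le_left),
      ψ.norm_one' 𝔞 (isCoprime_of_le_right h inf_le_right)]
    simp
  ray_one' α hα h := by
    rw [(principalChar _).ray_one' α hα h, χ.ray_one' α hα h.1, ψ.ray_one' α hα h.2]
    simp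

lemma HeckeChar.div_apply {𝔣 𝔤 𝔞 : Ideal (𝓞 K)} (χ : HeckeChar K 𝔣) (ψ : HeckeChar K 𝔤)
    (h : IsCoprime 𝔞 (𝔣 ⊓ 𝔤)) : (χ.div ψ).toFun 𝔞 = χ.toFun 𝔞 * (ψ.toFun 𝔞)⁻¹ := by
  change (principalChar _).toFun 𝔞 * _ = _
  rw [principalChar_apply h, one_mul]

lemma isConductor_principalChar (𝔮 : Ideal (𝓞 K)) : IsConductor (principalChar 𝔮) ⊤ :=
  ⟨⟨principalChar ⊤, le_top, fun 𝔞 h => by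
    rw [principalChar_apply h, principalChar_apply (isCoprime_of_le_right h le_top)]⟩,
    fun _ _ => le_top⟩

lemma charTrivOn_principalChar {𝔮 : Ideal (𝓞 K)} (H : CongClassGroup K 𝔮) :
    CharTrivOn (principalChar 𝔮) H := fun 𝔞 h => principalChar_apply (H.coprime' 𝔞 h)

lemma IsPrimitiveCCG.ne_bot {𝔮 : Ideal (𝓞 K)} {H : CongClassGroup K 𝔮} (hH : IsPrimitiveCCG H) :
    𝔮 ≠ ⊥ := by
  rintro rfl
  have h1 : (⊤ : Ideal (𝓞 K)) ≤ fH H := by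
    refine le_sInf ?_
    rintro 𝔣 ⟨χ, -, -, h⟩
    refine h ⊤ ⟨principalChar ⊤, le_top, fun 𝔞 ha => ?_⟩
    have : 𝔞 = ⊤ := by rwa [Ideal.isCoprime_iff_sup_eq, sup_bot_eq] at ha
    rw [this, HeckeChar.map_top, HeckeChar.map_top]
  rw [← hH] at h1
  exact bot_ne_top (top_le_iff.mp h1)

lemma absNorm_le_QH {𝔮 𝔣 : Ideal (𝓞 K)} (hq : 𝔮 ≠ ⊥) {H : CongClassGroup K 𝔮} {χ : HeckeChar K 𝔮}
    (hχ : CharTrivOn χ H) (hf : IsConductor χ 𝔣) : Ideal.absNorm 𝔣 ≤ QH H := by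
  refine le_csSup ⟨Ideal.absNorm 𝔮, ?_⟩ ⟨χ, 𝔣, hχ, hf, rfl⟩
  rintro n ⟨χ', 𝔣', -, ⟨⟨_, h, -⟩, -⟩, rfl⟩
  refine Nat.le_of_dvd (Nat.pos_of_ne_zero ?_) (Ideal.absNorm_dvd_absNorm_of_le h)
  rwa [ne_eq, Ideal.absNorm_eq_zero_iff]

lemma one_le_QH {𝔮 : Ideal (𝓞 K)} (hq : 𝔮 ≠ ⊥) (H : CongClassGroup K 𝔮) : 1 ≤ QH H := by
  have := absNorm_le_QH hq (charTrivOn_principalChar H) (isConductor_principalChar 𝔮)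
  rwa [Ideal.absNorm_top] at this

/-- If a finite family of events is such that toggling `i` makes the event `i` occur at least half
of the time, then some configuration captures half of the total weight. -/
lemma exists_half_le_sum {ι : Type*} [Fintype ι] [DecidableEq ι] (w : ι → ℝ) (hw : ∀ i, 0 ≤ w i)
    (R : Finset ι → ι → Prop) [∀ E, DecidablePred (R E)]
    (h : ∀ E i, i ∉ E → R E i ∨ R (insert i E) i) :
    ∃ E, ∑ i, w i ≤ 2 * ∑ i with R E i, w i := by
  by_contra! hlt
  have h1 : ∑ E : Finset ι, 2 * ∑ i with R E i, w i < ∑ E : Finset ι, ∑ i, w i :=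
    Finset.sum_lt_sum_of_nonempty Finset.univ_nonempty fun E _ => hlt E
  refine absurd h1 (not_lt.mpr ?_)
  simp only [Finset.sum_filter]
  rw [← Finset.mul_sum, Finset.sum_comm, Finset.sum_comm (γ := Finset ι), Finset.mul_sum]
  refine Finset.sum_le_sum fun i _ => ?_
  let e : Finset ι ≃ Finset ι := Function.Involutive.toPerm (fun E => symmDiff E {i})
    (fun E => by simp)
  have h2 : ∑ E : Finset ι, (if R E i then w i else 0)
      = ∑ E : Finset ι, (if R (e E) i then w i else 0) :=
    (Equiv.sum_comp e fun E => if R E i then w i else 0).symm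
  rw [two_mul]
  nth_rewrite 2 [h2]
  rw [← Finset.sum_add_distrib]
  refine Finset.sum_le_sum fun E _ => ?_
  have h3 : R E i ∨ R (e E) i := by
    by_cases hi : i ∈ E
    · have he : e E = E.erase i := by
        change symmDiff E {i} = _
        ext j; simp only [Finset.mem_symmDiff, Finset.mem_singleton, Finset.mem_erase]
        by_cases hj : j = i <;> simp [hj, hi]
      rw [he]
      have := h (E.erase i) i (by simp)
      rw [Finset.insert_erase hi] at this
      exact this.symm
    · have he : e E = insert i E := by
        change symmDiff E {i} = _
        ext j; simp only [Finset.mem_symmDiff, Finset.mem_singleton, Finset.mem_insert]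
        by_cases hj : j = i <;> simp [hj, hi]
      rw [he]
      exact h E i hi
  have := hw i
  rcases h3 with h3 | h3
  · rw [if_pos h3]; split_ifs <;> linarith
  · rw [if_pos h3]; split_ifs <;> linarith

/-- A divisor of `p * q'` not divisible by the full power of `p` divides `q'`. -/
lemma dvd_of_not_pow_dvd {M : Type*} [CommMonoidWithZero M] [IsCancelMulZero M] {p q' f : M} {k : ℕ}
    (hp : Prime p) (hk : p ^ k ∣ p * q') (hf : f ∣ p * q') (hn : ¬ p ^ k ∣ f) : f ∣ q' := by
  obtain ⟨g, hg⟩ := hf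
  by_cases h : p ∣ g
  · obtain ⟨g', rfl⟩ := h
    refine ⟨g', mul_left_cancel₀ hp.ne_zero ?_⟩
    rw [hg]; exact mul_left_comm _ _ _
  · exact absurd (hp.pow_dvd_of_dvd_mul_right k h (hg ▸ hk)) hn

theorem absNorm_le_QH_sq {𝔮 : Ideal (𝓞 K)} {H : CongClassGroup K 𝔮} (hH : IsPrimitiveCCG H) :
    Ideal.absNorm 𝔮 ≤ QH H ^ 2 := by
  classical
  have hq := hH.ne_bot
  let ι := {P : Ideal (𝓞 K) // P ∈ (UniqueFactorizationMonoid.normalizedFactors 𝔮).toFinset}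
  have hprime : ∀ i : ι, Prime i.1 := fun i =>
    UniqueFactorizationMonoid.prime_of_normalized_factor _ (Multiset.mem_toFinset.mp i.2)
  let k : ι → ℕ := fun i => (UniqueFactorizationMonoid.normalizedFactors 𝔮).count i.1
  have hprod : ∏ i : ι, i.1 ^ k i = 𝔮 := by
    have h1 := Ideal.prod_normalizedFactors_eq_self hq
    rw [Finset.prod_multiset_count] at h1
    rw [← Finset.prod_coe_sort] at h1
    exact h1
  have hdvd : ∀ i : ι, i.1 ^ k i ∣ 𝔮 := fun i =>
    (Finset.dvd_prod_of_mem (fun i : ι => i.1 ^ k i) (Finset.mem_univ i)).trans (dvd_of_eq hprod)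
  have hndvd : ∀ i : ι, ¬ i.1 ^ (k i + 1) ∣ 𝔮 := by
    intro i h
    rw [UniqueFactorizationMonoid.dvd_iff_normalizedFactors_le_normalizedFactors
      (pow_ne_zero _ (hprime i).ne_zero) hq,
      UniqueFactorizationMonoid.normalizedFactors_pow,
      UniqueFactorizationMonoid.normalizedFactors_irreducible (hprime i).irreducible] at h
    have := Multiset.count_le_of_le i.1 h
    simp [k] at this
  have hq' : ∀ i : ι, ∃ 𝔮', 𝔮 = i.1 * 𝔮' := fun i =>
    (UniqueFactorizationMonoid.dvd_of_mem_normalizedFactors (Multiset.mem_toFinset.mp i.2))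
  choose q' hq' using hq'
  have hq'n : ∀ i, ¬ i.1 ^ k i ∣ q' i := fun i h => hndvd i <| by
    have h1 : i.1 ^ (k i + 1) ∣ i.1 * q' i := by
      rw [pow_succ']; exact mul_dvd_mul_left _ h
    exact h1.trans (dvd_of_eq (hq' i).symm)
  have hle : ∀ (i : ι) (𝔣 : Ideal (𝓞 K)), 𝔮 ≤ 𝔣 → ¬ 𝔣 ≤ i.1 ^ k i → q' i ≤ 𝔣 := by
    intro i 𝔣 h h1
    rw [← Ideal.dvd_iff_le] at h h1 ⊢
    exact dvd_of_not_pow_dvd (hprime i) ((hdvd i).trans (dvd_of_eq (hq' i)))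
      (h.trans (dvd_of_eq (hq' i))) h1
  have hchar : ∀ i : ι, ∃ (χ : HeckeChar K 𝔮) (𝔣 : Ideal (𝓞 K)), CharTrivOn χ H ∧
      IsConductor χ 𝔣 ∧ 𝔣 ≤ i.1 ^ k i := by
    intro i
    by_contra! hcon
    have h1 : q' i ≤ 𝔮 := by
      rw [show 𝔮 = fH H from hH]
      refine le_sInf ?_
      rintro 𝔣 ⟨χ, hχ, hf⟩
      exact hle i 𝔣 hf.1.choose_spec.1 (hcon χ 𝔣 hχ hf)
    rw [← Ideal.dvd_iff_le] at h1
    exact hq'n i ((hdvd i).trans h1)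
  choose χ 𝔣 hχ hf hfle using hchar
  let ψ : Finset ι → HeckeChar K 𝔮 := fun E => HeckeChar.prod χ E
  have hψ : ∀ E, CharTrivOn (ψ E) H := fun E 𝔞 ha => by
    rw [HeckeChar.prod_apply _ _ (H.coprime' 𝔞 ha)]
    exact Finset.prod_eq_one fun i _ => hχ i 𝔞 ha
  let R : Finset ι → ι → Prop := fun E i =>
    ∀ 𝔤 : Ideal (𝓞 K), (∃ χ' : HeckeChar K 𝔤, Induces χ' (ψ E)) → 𝔤 ≤ i.1 ^ k i
  have htoggle : ∀ E i, i ∉ E → R E i ∨ R (insert i E) i := by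
    intro E i hi
    by_contra! hcon
    simp only [R, not_forall] at hcon
    obtain ⟨⟨𝔤, ⟨χ₁, h₁⟩, hg⟩, ⟨𝔤', ⟨χ₂, h₂⟩, hg'⟩⟩ := hcon
    have hind : Induces (χ₂.div χ₁) (χ i) := by
      refine ⟨le_inf h₂.1 h₁.1, fun 𝔞 ha => ?_⟩
      rw [HeckeChar.div_apply _ _ (isCoprime_of_le_right ha (le_inf h₂.1 h₁.1)), ← h₁.2 𝔞 ha,
        ← h₂.2 𝔞 ha, HeckeChar.prod_apply _ _ ha, HeckeChar.prod_apply _ _ ha,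
        Finset.prod_insert hi, mul_assoc, mul_inv_cancel₀, mul_one]
      exact Finset.prod_ne_zero_iff.mpr fun j _ => (χ j).ne_zero ha
    have h3 := ((hf i).2 _ ⟨_, hind⟩).trans (hfle i)
    have h4 := (le_inf (hle i 𝔤' h₂.1 hg') (hle i 𝔤 h₁.1 hg)).trans h3
    exact hq'n i (Ideal.dvd_iff_le.mpr h4)
  have hN0 : ∀ i : ι, 0 < Ideal.absNorm (i.1 ^ k i) := fun i => Nat.pos_of_ne_zero (by
    rw [ne_eq, Ideal.absNorm_eq_zero_iff]; exact pow_ne_zero _ (hprime i).ne_zero)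
  obtain ⟨E, hE⟩ := exists_half_le_sum (fun i : ι => Real.log (Ideal.absNorm (i.1 ^ k i)))
    (fun i => Real.log_natCast_nonneg _) R htoggle
  have hlog : ∀ s : Finset ι, ∑ i ∈ s, Real.log (Ideal.absNorm (i.1 ^ k i)) =
      Real.log (Ideal.absNorm (∏ i ∈ s, i.1 ^ k i)) := fun s => by
    rw [map_prod, Nat.cast_prod, Real.log_prod]
    exact fun i _ => by exact_mod_cast (hN0 i).ne'
  rw [hlog, hlog, hprod] at hE
  have hbound : Ideal.absNorm (∏ i with R E i, i.1 ^ k i) ≤ QH H := by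
    by_cases hne : ∃ i, R E i
    · obtain ⟨i, hi⟩ := hne
      have htop : i.1 ^ k i ≠ ⊤ := by
        intro h
        refine (hq'n i) ?_
        rw [h]
        exact Ideal.dvd_iff_le.mpr le_top
      obtain ⟨𝔤, hg⟩ := exists_isConductor hq (ψ E) htop hi
      refine le_trans (Nat.le_of_dvd (Nat.pos_of_ne_zero ?_) (map_dvd Ideal.absNorm ?_))
        (absNorm_le_QH hq (hψ E) hg)
      · rw [ne_eq, Ideal.absNorm_eq_zero_iff]
        obtain ⟨_, h, -⟩ := hg.1
        exact fun h1 => hq (le_bot_iff.mp (h1 ▸ h))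
      · refine Finset.prod_dvd_of_coprime ?_ ?_
        · intro a _ b _ hab
          refine IsCoprime.pow ?_
          have hap := Ideal.isPrime_of_prime (hprime a)
          have hbp := Ideal.isPrime_of_prime (hprime b)
          have := hap.isMaximal (hprime a).ne_zero
          have := hbp.isMaximal (hprime b).ne_zero
          exact Ideal.isCoprime_of_isMaximal fun h => hab (Subtype.ext h)
        · intro j hj
          rw [Ideal.dvd_iff_le]
          exact (Finset.mem_filter.mp hj).2 𝔤 hg.1
    · push Not at hne
      rw [Finset.filter_false_of_mem fun i _ => hne i, Finset.prod_empty, Ideal.one_eq_top,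
        Ideal.absNorm_top]
      exact one_le_QH hq H
  have hpos : 0 < Ideal.absNorm (∏ i with R E i, i.1 ^ k i) := Nat.pos_of_ne_zero (by
    rw [ne_eq, Ideal.absNorm_eq_zero_iff]
    exact Finset.prod_ne_zero_iff.mpr fun i _ => pow_ne_zero _ (hprime i).ne_zero)
  have hqpos : 0 < Ideal.absNorm 𝔮 := Nat.pos_of_ne_zero (by
    rwa [ne_eq, Ideal.absNorm_eq_zero_iff])
  have h5 : Ideal.absNorm 𝔮 ≤ Ideal.absNorm (∏ i with R E i, i.1 ^ k i) ^ 2 := by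
    have : Real.log (Ideal.absNorm 𝔮) ≤
        Real.log ((Ideal.absNorm (∏ i with R E i, i.1 ^ k i) : ℝ) ^ 2) := by
      rw [Real.log_pow]; exact_mod_cast hE
    have := (Real.log_le_log_iff (by exact_mod_cast hqpos) (by positivity)).mp this
    exact_mod_cast this
  exact h5.trans (Nat.pow_le_pow_left hbound 2)

/-! ### Averaging operators and B-splines -/

section Averaging

open MeasureTheory Set

variable {E : Type*} [NormedAddCommGroup E] [NormedSpace ℝ E]

/-- The average of `g` over the interval of radius `a` around `v`. -/
def avg (a : ℝ) (g : ℝ → E) (v : ℝ) : E := (2 * a)⁻¹ • ∫ s in (-a)..a, g (v + s)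

/-- The symmetric difference quotient. -/
def dq (a : ℝ) (g : ℝ → E) (v : ℝ) : E := (2 * a)⁻¹ • (g (v + a) - g (v - a))

lemma avg_eq (a : ℝ) (g : ℝ → E) (v : ℝ) :
    avg a g v = (2 * a)⁻¹ • ∫ s in (v - a)..(v + a), g s := by
  rw [avg, intervalIntegral.integral_comp_add_left, ← sub_eq_add_neg]

lemma continuous_avg {a : ℝ} {g : ℝ → E} (hg : ∀ x y, IntervalIntegrable g volume x y) :
    Continuous (avg a g) := by
  have h1 := intervalIntegral.continuous_primitive hg 0
  have h2 : avg a g = fun v => (2 * a)⁻¹ • ((∫ s in (0 : ℝ)..(v + a), g s) -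
      ∫ s in (0 : ℝ)..(v - a), g s) := by
    funext v
    rw [avg_eq, intervalIntegral.integral_interval_sub_left (hg _ _) (hg _ _)]
  rw [h2]
  exact ((h1.comp (continuous_add_const a)).sub (h1.comp (continuous_sub_right a))).const_smul _

lemma continuous_avg_of_continuous {a : ℝ} {g : ℝ → E} (hg : Continuous g) :
    Continuous (avg a g) :=
  continuous_avg fun _ _ => hg.intervalIntegrable _ _

lemma avg_add {a : ℝ} {g h : ℝ → E} (hg : Continuous g) (hh : Continuous h) :
    avg a (fun v => g v + h v) = fun v => avg a g v + avg a h v := by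
  funext v
  rw [avg, avg, avg, intervalIntegral.integral_add, smul_add]
  · exact (hg.comp (continuous_const_add v)).intervalIntegrable _ _
  · exact (hh.comp (continuous_const_add v)).intervalIntegrable _ _

lemma avg_sub {a : ℝ} {g h : ℝ → E} (hg : Continuous g) (hh : Continuous h) :
    avg a (fun v => g v - h v) = fun v => avg a g v - avg a h v := by
  funext v
  rw [avg, avg, avg, intervalIntegral.integral_sub, smul_sub]
  · exact (hg.comp (continuous_const_add v)).intervalIntegrable _ _
  · exact (hh.comp (continuous_const_add v)).intervalIntegrable _ _

lemma avg_smul {𝕜 : Type*} [NormedField 𝕜] [NormedSpace 𝕜 E] [SMulCommClass ℝ 𝕜 E] (a : ℝ)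
    (c : 𝕜) (g : ℝ → E) : avg a (fun v => c • g v) = fun v => c • avg a g v := by
  funext v
  rw [avg, avg, intervalIntegral.integral_smul, smul_comm]

lemma avg_shift (a b : ℝ) (g : ℝ → E) (v : ℝ) :
    avg a (fun w => g (w + b)) v = avg a g (v + b) := by
  simp only [avg, add_right_comm]

lemma avg_dq {a : ℝ} {g : ℝ → E} (hg : Continuous g) : avg a (dq a g) = dq a (avg a g) := by
  have h1 : Continuous fun v => g (v + a) := hg.comp (continuous_add_const a)
  have h2 : Continuous fun v => g (v + -a) := hg.comp (continuous_add_const (-a))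
  have : dq a g = fun v => (2 * a)⁻¹ • (g (v + a) - g (v + -a)) := by
    funext v; rw [dq, sub_eq_add_neg v a]
  rw [this, avg_smul, avg_sub h1 h2]
  funext v
  simp only
  rw [avg_shift, avg_shift, dq, sub_eq_add_neg v a]

lemma avg_deriv [CompleteSpace E] {a : ℝ} {g g' : ℝ → E} (h : ∀ v, HasDerivAt g (g' v) v)
    (hg' : Continuous g') : avg a g' = dq a g := by
  funext v
  rw [avg_eq, dq, intervalIntegral.integral_eq_sub_of_hasDerivAt (fun x _ => h x)
    (hg'.intervalIntegrable _ _)]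

lemma hasDerivAt_avg [CompleteSpace E] {a : ℝ} {g g' : ℝ → E} (h : ∀ v, HasDerivAt g (g' v) v)
    (hg' : Continuous g') (v : ℝ) : HasDerivAt (avg a g) (avg a g' v) v := by
  have hg : Continuous g := continuous_iff_continuousAt.mpr fun v => (h v).continuousAt
  have hii : ∀ x y, IntervalIntegrable g volume x y := fun _ _ => hg.intervalIntegrable _ _
  have h2 : avg a g = fun v => (2 * a)⁻¹ • ((∫ s in (0 : ℝ)..(v + a), g s) -
      ∫ s in (0 : ℝ)..(v - a), g s) := by
    funext v
    rw [avg_eq, intervalIntegral.integral_interval_sub_left (hii _ _) (hii _ _)]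
  have hd : ∀ x, HasDerivAt (fun u => ∫ s in (0 : ℝ)..u, g s) (g x) x := fun x =>
    intervalIntegral.integral_hasDerivAt_right (hii _ _)
      hg.aestronglyMeasurable.stronglyMeasurableAtFilter hg.continuousAt
  rw [avg_deriv h hg', h2, dq]
  exact (((hd _).comp_add_const v a).sub ((hd _).comp_sub_const v a)).const_smul _

lemma norm_avg_le {a r B : ℝ} (ha : 0 < a) {g : ℝ → E} (hB : ∀ v, |v| ≤ r + a → ‖g v‖ ≤ B)
    {v : ℝ} (hv : |v| ≤ r) : ‖avg a g v‖ ≤ B := by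
  have h1 : ‖∫ s in (-a)..a, g (v + s)‖ ≤ B * |a - -a| := by
    refine intervalIntegral.norm_integral_le_of_norm_le_const fun s hs => hB _ ?_
    rw [uIoc_of_le (by linarith)] at hs
    have : |s| ≤ a := abs_le.mpr ⟨hs.1.le, hs.2⟩
    exact (abs_add_le _ _).trans (by linarith)
  rw [avg, norm_smul, norm_inv, Real.norm_eq_abs, abs_of_pos (by linarith : (0 : ℝ) < 2 * a)]
  rw [show a - -a = 2 * a by ring, abs_of_pos (by linarith : (0 : ℝ) < 2 * a)] at h1
  rw [inv_mul_le_iff₀ (by linarith)]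
  linarith

lemma norm_dq_le {a r B : ℝ} (ha : 0 < a) {g : ℝ → E} (hB : ∀ v, |v| ≤ r + a → ‖g v‖ ≤ B)
    {v : ℝ} (hv : |v| ≤ r) : ‖dq a g v‖ ≤ a⁻¹ * B := by
  have h1 : ‖g (v + a)‖ ≤ B := hB _ ((abs_add_le _ _).trans (by rw [abs_of_pos ha]; linarith))
  have h2 : ‖g (v - a)‖ ≤ B := hB _ ((abs_sub _ _).trans (by rw [abs_of_pos ha]; linarith))
  rw [dq, norm_smul, norm_inv, Real.norm_eq_abs, abs_of_pos (by linarith : (0 : ℝ) < 2 * a),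
    mul_inv, mul_comm (2 : ℝ)⁻¹, mul_assoc]
  gcongr
  have := norm_sub_le (g (v + a)) (g (v - a))
  linarith

/-- A double average of `(∂ + c)(∂ + d) W` is controlled by `W`. -/
lemma norm_avg_avg_le {a r B c d : ℝ} (ha : 0 < a) (hc : 0 ≤ c) (hd : 0 ≤ d)
    {W W' W'' : ℝ → ℂ} (h : ∀ v, HasDerivAt W (W' v) v) (h' : ∀ v, HasDerivAt W' (W'' v) v)
    (h'' : Continuous W'') (hB : ∀ v, |v| ≤ r + a + a → ‖W v‖ ≤ B) {v : ℝ} (hv : |v| ≤ r) :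
    ‖avg a (avg a fun v => W'' v + (c + d : ℝ) • W' v + (c * d : ℝ) • W v) v‖
      ≤ (a⁻¹ + c) * ((a⁻¹ + d) * B) := by
  have hWc : Continuous W := continuous_iff_continuousAt.mpr fun v => (h v).continuousAt
  have hWc' : Continuous W' := continuous_iff_continuousAt.mpr fun v => (h' v).continuousAt
  have hUc : Continuous fun v => W' v + d • W v := hWc'.add (hWc.const_smul d)
  have hUd : ∀ v, HasDerivAt (fun v => W' v + d • W v) (W'' v + d • W' v) v := fun v =>
    (h' v).add ((h v).const_smul d)
  have hUc' : Continuous fun v => W'' v + d • W' v := h''.add (hWc'.const_smul d)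
  have e1 : avg a (fun v => W'' v + (c + d : ℝ) • W' v + (c * d : ℝ) • W v) =
      fun v => dq a (fun v => W' v + d • W v) v + c • avg a (fun v => W' v + d • W v) v := by
    have : (fun v => W'' v + (c + d : ℝ) • W' v + (c * d : ℝ) • W v) =
        fun v => (W'' v + d • W' v) + c • (W' v + d • W v) := by
      funext v; simp only [add_smul, smul_add, mul_smul]; abel
    rw [this, avg_add (h := fun v => c • (W' v + d • W v)) hUc' (hUc.const_smul c),
      avg_deriv hUd hUc', avg_smul]
  have e2 : avg a (fun v => W' v + d • W v) = fun v => dq a W v + d • avg a W v := by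
    rw [avg_add (h := fun v => d • W v) hWc' (hWc.const_smul d), avg_deriv h hWc', avg_smul]
  have hbd : ∀ v, |v| ≤ r + a → ‖avg a (fun v => W' v + d • W v) v‖ ≤ (a⁻¹ + d) * B := by
    intro v hv
    rw [e2, add_mul]
    refine (norm_add_le _ _).trans (add_le_add (norm_dq_le ha hB hv) ?_)
    rw [norm_smul, Real.norm_eq_abs, abs_of_nonneg hd]
    exact mul_le_mul_of_nonneg_left (norm_avg_le ha hB hv) hd
  have hdqc : Continuous (dq a fun v => W' v + d • W v) := by
    rw [← avg_deriv hUd hUc']; exact continuous_avg_of_continuous hUc'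
  rw [e1, avg_add (h := fun v => c • avg a (fun v => W' v + d • W v) v) hdqc
    ((continuous_avg_of_continuous hUc).const_smul c), avg_dq hUc, avg_smul, add_mul]
  refine (norm_add_le _ _).trans (add_le_add (norm_dq_le ha hbd hv) ?_)
  rw [norm_smul, Real.norm_eq_abs, abs_of_nonneg hc]
  exact mul_le_mul_of_nonneg_left (norm_avg_le ha hbd hv) hc

lemma avg_exp {a : ℝ} (ha : a ≠ 0) {c : ℂ} (hc : c ≠ 0) :
    avg a (fun v : ℝ => cexp (c * v)) =
      fun v : ℝ => (Complex.sinh (c * a) / (c * a)) * cexp (c * v) := by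
  funext v
  have h : (fun s : ℝ => cexp (c * ((v + s : ℝ) : ℂ))) = fun s : ℝ => cexp (c * v) * cexp (c * s) := by
    funext s; rw [← Complex.exp_add]; push_cast; ring_nf
  rw [avg, h, intervalIntegral.integral_const_mul, integral_exp_mul_complex hc, Complex.sinh,
    Complex.real_smul]
  have : (a : ℂ) ≠ 0 := by exact_mod_cast ha
  push_cast
  rw [mul_neg, ← neg_mul]
  field_simp

/-- The B-spline of order `k + 1`: the density of a sum of `k + 1` independent uniform variables
on `[-a, a]`. -/
def bspline (a : ℝ) : ℕ → ℝ → ℝ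
  | 0 => (Icc (-a) a).indicator fun _ => (2 * a)⁻¹
  | k + 1 => avg a (bspline a k)

lemma bspline_bounds {a : ℝ} (ha : 0 < a) (k : ℕ) :
    Measurable (bspline a k) ∧ (∀ v, 0 ≤ bspline a k v) ∧ (∀ v, bspline a k v ≤ (2 * a)⁻¹) ∧
      ∀ v, (k + 1) * a < |v| → bspline a k v = 0 := by
  induction k with
  | zero =>
    refine ⟨measurable_const.indicator measurableSet_Icc, fun v => ?_, fun v => ?_, fun v hv => ?_⟩
    · exact indicator_nonneg (fun _ _ => by positivity) _
    · exact indicator_le_self' (fun _ _ => by positivity) _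
    · refine indicator_of_notMem (fun h => ?_) _
      have := abs_le.mpr ⟨h.1, h.2⟩
      simp at hv; linarith
  | succ k ih =>
    obtain ⟨hm, h0, hle, hs⟩ := ih
    have hii : ∀ x y, IntervalIntegrable (bspline a k) volume x y := fun x y => by
      rw [intervalIntegrable_iff]
      refine Measure.integrableOn_of_bounded (M := (2 * a)⁻¹) (by simp) hm.aestronglyMeasurable
        (Filter.Eventually.of_forall fun v => ?_)
      rw [Real.norm_eq_abs, abs_of_nonneg (h0 v)]; exact hle v
    refine ⟨(continuous_avg hii).measurable, fun v => ?_, fun v => ?_, fun v hv => ?_⟩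
    · refine mul_nonneg (by positivity) (intervalIntegral.integral_nonneg (by linarith) fun _ _ => h0 _)
    · refine (Real.le_norm_self _).trans (norm_avg_le (r := |v|) ha (fun w _ => ?_) le_rfl)
      rw [Real.norm_eq_abs, abs_of_nonneg (h0 w)]; exact hle w
    · have : ‖avg a (fun w => bspline a k (w + v)) 0‖ ≤ 0 := by
        refine norm_avg_le (r := 0) ha (fun w hw => ?_) (by simp)
        rw [hs, norm_zero]
        have h2 : |v| ≤ |w + v| + |w| := by
          have := abs_sub (w + v) w
          simpa using this
        push_cast at hv; linarith
      rw [avg_shift, zero_add] at this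
      exact norm_le_zero_iff.mp this

lemma bspline_nonneg {a : ℝ} (ha : 0 < a) (k : ℕ) (v : ℝ) : 0 ≤ bspline a k v :=
  (bspline_bounds ha k).2.1 v

lemma bspline_le {a : ℝ} (ha : 0 < a) (k : ℕ) (v : ℝ) : bspline a k v ≤ (2 * a)⁻¹ :=
  (bspline_bounds ha k).2.2.1 v

lemma bspline_eq_zero {a : ℝ} (ha : 0 < a) {k : ℕ} {v : ℝ} (hv : (k + 1) * a < |v|) :
    bspline a k v = 0 := (bspline_bounds ha k).2.2.2 v hv

lemma bspline_intervalIntegrable {a : ℝ} (ha : 0 < a) (k : ℕ) (x y : ℝ) :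
    IntervalIntegrable (bspline a k) volume x y := by
  obtain ⟨hm, h0, hle, -⟩ := bspline_bounds ha k
  rw [intervalIntegrable_iff]
  refine Measure.integrableOn_of_bounded (M := (2 * a)⁻¹) (by simp) hm.aestronglyMeasurable
    (Filter.Eventually.of_forall fun v => ?_)
  rw [Real.norm_eq_abs, abs_of_nonneg (h0 v)]; exact hle v

lemma continuous_bspline_succ {a : ℝ} (ha : 0 < a) (k : ℕ) : Continuous (bspline a (k + 1)) :=
  continuous_avg (bspline_intervalIntegrable ha k)

lemma integrable_bspline_smul {a : ℝ} (ha : 0 < a) (k : ℕ) (p q : ℝ → ℝ → ℝ)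
    (hp : Measurable fun z : ℝ × ℝ => p z.1 z.2) (hq : Continuous fun z : ℝ × ℝ => q z.1 z.2)
    (hpv : ∀ s v, |v| ≤ |p s v| + |s|) {F : ℝ → ℂ} (hF : Continuous F) :
    Integrable (Function.uncurry fun s v : ℝ => bspline a k (p s v) • F (q s v))
      ((volume.restrict (uIoc (-a) a)).prod volume) := by
  set R := (k + 2) * a
  have hsupp : ∀ s v : ℝ, s ∈ uIoc (-a) a → v ∉ Icc (-R) R →
      bspline a k (p s v) • F (q s v) = 0 := by
    intro s v hs hv
    rw [uIoc_of_le (by linarith)] at hs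
    rw [bspline_eq_zero ha, zero_smul]
    have h1 : R < |v| := by
      by_contra! h; exact hv (abs_le.mp h)
    have h2 : |s| ≤ a := abs_le.mpr ⟨hs.1.le, hs.2⟩
    have h3 := hpv s v
    simp only [R] at h1; linarith
  obtain ⟨M, hM⟩ := ((isCompact_Icc (a := -a) (b := a)).prod
    (isCompact_Icc (a := -R) (b := R))).exists_bound_of_continuousOn (hF.comp hq).continuousOn
  have h1 : IntegrableOn (Function.uncurry fun s v : ℝ => bspline a k (p s v) • F (q s v))
      (uIoc (-a) a ×ˢ Icc (-R) R) (volume.prod volume) := by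
    refine Measure.integrableOn_of_bounded (M := (2 * a)⁻¹ * M) ?_ ?_ ?_
    · rw [Measure.prod_prod]; simp [ENNReal.mul_eq_top]
    · have m1 : AEStronglyMeasurable (fun z : ℝ × ℝ => bspline a k (p z.1 z.2))
          (volume.prod volume) := ((bspline_bounds ha k).1.comp hp).aestronglyMeasurable
      exact m1.smul (hF.comp hq).aestronglyMeasurable
    · refine (ae_restrict_iff' ((measurableSet_uIoc).prod measurableSet_Icc)).mpr
        (Filter.Eventually.of_forall ?_)
      rintro ⟨s, v⟩ ⟨hs, hv⟩
      rw [Function.uncurry_apply_pair, norm_smul, Real.norm_eq_abs,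
        abs_of_nonneg (bspline_nonneg ha k _)]
      rw [uIoc_of_le (by linarith)] at hs
      exact mul_le_mul (bspline_le ha k _) (hM (s, v) ⟨Ioc_subset_Icc_self hs, hv⟩)
        (norm_nonneg _) (by positivity)
  rw [← Measure.restrict_univ (μ := (volume : Measure ℝ)), Measure.restrict_restrict
    measurableSet_uIoc, inter_univ, Measure.prod_restrict]
  refine IntegrableOn.of_forall_sdiff_eq_zero h1 (measurableSet_uIoc.prod MeasurableSet.univ) ?_
  rintro ⟨s, v⟩ ⟨⟨hs, -⟩, h⟩
  exact hsupp s v hs fun hv => h ⟨hs, hv⟩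

/-- Integration against a B-spline is iterated averaging. -/
lemma integral_bspline {a : ℝ} (ha : 0 < a) (k : ℕ) {F : ℝ → ℂ} (hF : Continuous F) :
    ∫ v, bspline a k v • F v = (avg a)^[k + 1] F 0 := by
  induction k generalizing F with
  | zero =>
    have : (fun v => bspline a 0 v • F v) = (Icc (-a) a).indicator fun v => (2 * a)⁻¹ • F v := by
      funext v
      by_cases hv : v ∈ Icc (-a) a <;> simp [bspline, hv]
    rw [this, integral_indicator measurableSet_Icc, integral_smul, integral_Icc_eq_integral_Ioc,
      ← intervalIntegral.integral_of_le (by linarith)]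
    simp [avg]
  | succ k ih =>
    rw [Function.iterate_succ_apply, ← ih (continuous_avg_of_continuous hF)]
    have hm := (bspline_bounds ha k).1
    have hint := integrable_bspline_smul ha k (fun s v : ℝ => v + s) (fun _ v => v)
      (by fun_prop) (by fun_prop) (fun s v => by simpa using abs_sub (v + s) s) hF
    have e1 : ∀ v, bspline a (k + 1) v • F v =
        (2 * a)⁻¹ • ∫ s in (-a)..a, bspline a k (v + s) • F v := by
      intro v
      rw [intervalIntegral.integral_smul_const, smul_smul]; rfl
    simp_rw [e1]
    rw [integral_smul, ← intervalIntegral_integral_swap hint]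
    have e2 : ∀ s : ℝ, ∫ v, bspline a k (v + s) • F v = ∫ v, bspline a k v • F (v - s) := by
      intro s
      have := integral_add_right_eq_self (μ := volume) (fun v => bspline a k v • F (v - s)) s
      rw [← this]; simp
    have hint2 := integrable_bspline_smul ha k (fun _ v : ℝ => v) (fun s v => v - s)
      (by fun_prop) (by fun_prop) (fun s v => by linarith [abs_nonneg s]) hF
    simp_rw [e2]
    rw [intervalIntegral_integral_swap hint2, ← integral_smul]
    refine integral_congr_ae (Filter.Eventually.of_forall fun v => ?_)
    simp only
    rw [intervalIntegral.integral_smul, smul_comm, avg]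
    congr 2
    have := intervalIntegral.integral_comp_neg (a := -a) (b := a) fun s => F (v + s)
    rw [neg_neg] at this
    rw [← this]; simp [sub_eq_add_neg]

end Averaging

/-! ### Local oscillatory bounds -/

section Local

open MeasureTheory Set

lemma hasDerivAt_intervalIntegral_param {G G' : ℝ → ℝ → ℂ} {p q : ℝ}
    (hG : Continuous (Function.uncurry G)) (hG' : Continuous (Function.uncurry G'))
    (h : ∀ w θ, HasDerivAt (fun w => G w θ) (G' w θ) w) (w : ℝ) :
    HasDerivAt (fun w => ∫ θ in p..q, G w θ) (∫ θ in p..q, G' w θ) w := by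
  obtain ⟨M, hM⟩ := ((isCompact_Icc (a := w - 1) (b := w + 1)).prod
    (isCompact_uIcc (a := p) (b := q))).exists_bound_of_continuousOn hG'.continuousOn
  refine (intervalIntegral.hasDerivAt_integral_of_dominated_loc_of_deriv_le (F := G) (F' := G')
    (s := Metric.ball w 1) (bound := fun _ => M) (Metric.ball_mem_nhds w one_pos) ?_ ?_ ?_ ?_ ?_ ?_).2
  · refine Filter.Eventually.of_forall fun w => Continuous.aestronglyMeasurable ?_
    exact hG.comp (Continuous.prodMk_right w)
  · exact (hG.comp (Continuous.prodMk_right w)).intervalIntegrable _ _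
  · exact (hG'.comp (Continuous.prodMk_right w)).aestronglyMeasurable
  · refine Filter.Eventually.of_forall fun θ hθ x hx => hM (x, θ) ⟨?_, uIoc_subset_uIcc hθ⟩
    rw [Real.ball_eq_Ioo] at hx
    exact Ioo_subset_Icc_self hx
  · exact intervalIntegrable_const
  · exact Filter.Eventually.of_forall fun θ _ x _ => h x θ

/-- The radial part of a character of `ℂ`, averaged over angles. -/
def angAvg (k α w : ℝ) : ℂ :=
  ∫ θ in (-Real.pi)..Real.pi, cexp (I * (k * Real.exp (w / 2) * Real.cos (θ + α) : ℝ))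

lemma norm_angAvg_le (k α w : ℝ) : ‖angAvg k α w‖ ≤ 2 * Real.pi := by
  have := intervalIntegral.norm_integral_le_of_norm_le_const (C := 1) (a := -Real.pi)
    (b := Real.pi) (f := fun θ : ℝ => cexp (I * (k * Real.exp (w / 2) * Real.cos (θ + α) : ℝ)))
    (fun θ _ => by rw [mul_comm, Complex.norm_exp_ofReal_mul_I])
  rw [angAvg]
  refine this.trans (le_of_eq ?_)
  rw [sub_neg_eq_add, abs_of_pos (by linarith [Real.pi_pos])]; ring

lemma angAvg_ode (k α : ℝ) : ∃ J' : ℝ → ℂ, (∀ w, HasDerivAt (angAvg k α) (J' w) w) ∧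
    ∀ w, HasDerivAt J' ((-(k ^ 2 / 4) * Real.exp w : ℝ) * angAvg k α w) w := by
  set E : ℝ → ℝ → ℂ := fun w θ => cexp (I * (k * Real.exp (w / 2) * Real.cos (θ + α) : ℝ)) with hE
  set ρ : ℝ → ℝ := fun w => k * Real.exp (w / 2) with hρ
  have hρd : ∀ w, HasDerivAt ρ (ρ w / 2) w := fun w => by
    have := (((hasDerivAt_id w).div_const 2).exp).const_mul k
    refine this.congr_deriv ?_
    simp only [hρ, id]; ring
  have hEd : ∀ w θ, HasDerivAt (fun w => E w θ) ((I * (ρ w / 2 * Real.cos (θ + α) : ℝ)) * E w θ) w := by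
    intro w θ
    have h1 := (((hρd w).mul_const (Real.cos (θ + α))).ofReal_comp.const_mul I).cexp
    refine h1.congr_deriv ?_
    simp only [hE, hρ]; push_cast; ring
  set E1 : ℝ → ℝ → ℂ := fun w θ => (I * (ρ w / 2 * Real.cos (θ + α) : ℝ)) * E w θ with hE1
  set E2 : ℝ → ℝ → ℂ := fun w θ => (I * (ρ w / 4 * Real.cos (θ + α) : ℝ)) * E w θ +
    (I * (ρ w / 2 * Real.cos (θ + α) : ℝ)) * E1 w θ with hE2
  have hEd1 : ∀ w θ, HasDerivAt (fun w => E1 w θ) (E2 w θ) w := by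
    intro w θ
    have h1 := ((((hρd w).div_const 2).mul_const (Real.cos (θ + α))).ofReal_comp.const_mul I).mul (hEd w θ)
    refine h1.congr_deriv ?_
    simp only [hE2, hE1]; push_cast; ring
  have hρc : Continuous ρ := by simp only [hρ]; fun_prop
  have hEc : Continuous (Function.uncurry E) := by
    simp only [hE, Function.uncurry_def]; fun_prop
  have hE1c : Continuous (Function.uncurry E1) := by
    have : Function.uncurry E1 = fun z => (I * (ρ z.1 / 2 * Real.cos (z.2 + α) : ℝ)) *
      Function.uncurry E z := rfl
    rw [this]; fun_prop
  have hE2c : Continuous (Function.uncurry E2) := by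
    have : Function.uncurry E2 = fun z => (I * (ρ z.1 / 4 * Real.cos (z.2 + α) : ℝ)) *
      Function.uncurry E z + (I * (ρ z.1 / 2 * Real.cos (z.2 + α) : ℝ)) *
      Function.uncurry E1 z := rfl
    rw [this]; fun_prop
  refine ⟨fun w => ∫ θ in (-Real.pi)..Real.pi, E1 w θ, fun w =>
    hasDerivAt_intervalIntegral_param hEc hE1c hEd w, fun w => ?_⟩
  have h2 := hasDerivAt_intervalIntegral_param (p := -Real.pi) (q := Real.pi) hE1c hE2c hEd1 w
  convert h2 using 1
  have hEθ : ∀ θ, HasDerivAt (fun θ => (Real.sin (θ + α) : ℂ) * E w θ)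
      ((Real.cos (θ + α) : ℂ) * E w θ - I * ρ w * (Real.sin (θ + α) : ℂ) ^ 2 * E w θ) θ := by
    intro θ
    have hs := ((Real.hasDerivAt_sin (θ + α)).comp_add_const θ α).ofReal_comp
    have hc := (((Real.hasDerivAt_cos (θ + α)).comp_add_const θ α).const_mul (ρ w)).ofReal_comp
    have h3 := hs.mul ((hc.const_mul I).cexp)
    refine h3.congr_deriv ?_
    simp only [hE, hρ]; push_cast; ring
  have hcE : Continuous (E w) := hEc.comp (Continuous.prodMk_right w)
  have hcd : Continuous fun θ => (Real.cos (θ + α) : ℂ) * E w θ -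
      I * ρ w * (Real.sin (θ + α) : ℂ) ^ 2 * E w θ := by fun_prop
  have h0 : ∫ θ in (-Real.pi)..Real.pi, ((Real.cos (θ + α) : ℂ) * E w θ -
      I * ρ w * (Real.sin (θ + α) : ℂ) ^ 2 * E w θ) = 0 := by
    rw [intervalIntegral.integral_eq_sub_of_hasDerivAt (fun θ _ => hEθ θ)
      (hcd.intervalIntegrable _ _)]
    have e1 : Real.sin (Real.pi + α) = Real.sin (-Real.pi + α) := by
      rw [show Real.pi + α = -Real.pi + α + 2 * Real.pi by ring, Real.sin_add_two_pi]
    have e2 : Real.cos (Real.pi + α) = Real.cos (-Real.pi + α) := by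
      rw [show Real.pi + α = -Real.pi + α + 2 * Real.pi by ring, Real.cos_add_two_pi]
    simp only [hE, e1, e2, sub_self]
  have h4 : ∫ θ in (-Real.pi)..Real.pi, E2 w θ = ∫ θ in (-Real.pi)..Real.pi,
      ((I * ρ w / 4) * ((Real.cos (θ + α) : ℂ) * E w θ -
      I * ρ w * (Real.sin (θ + α) : ℂ) ^ 2 * E w θ) + (-(ρ w ^ 2 / 4) : ℂ) * E w θ) := by
    congr 1; funext θ
    have hsc : (Real.cos (θ + α) : ℂ) ^ 2 = 1 - (Real.sin (θ + α) : ℂ) ^ 2 := by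
      rw [eq_sub_iff_add_eq]; exact_mod_cast Real.cos_sq_add_sin_sq (θ + α)
    simp only [hE2, hE1]
    push_cast
    push_cast at hsc
    linear_combination (I ^ 2 * (ρ w : ℂ) ^ 2 / 4 * E w θ) * hsc +
      ((ρ w : ℂ) ^ 2 / 4 * E w θ ) * Complex.I_sq
  rw [h4, intervalIntegral.integral_add ((hcd.const_mul _).intervalIntegrable _ _)
    ((hcE.const_mul _).intervalIntegrable _ _), intervalIntegral.integral_const_mul, h0,
    intervalIntegral.integral_const_mul, mul_zero, zero_add]
  congr 1
  simp only [hρ]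
  have : Real.exp w = Real.exp (w / 2) ^ 2 := by rw [← Real.exp_nat_mul]; congr 1; push_cast; ring
  rw [this]; push_cast; ring

end Local

/-! ### Local test functions and their Fourier transforms -/

section LocalTest

open MeasureTheory Set

lemma continuous_angAvg (k α : ℝ) : Continuous (angAvg k α) := by
  obtain ⟨J', h, -⟩ := angAvg_ode k α
  exact continuous_iff_continuousAt.mpr fun w => (h w).continuousAt

lemma hasDerivAt_ofReal_exp_neg_mul (c w : ℝ) :
    HasDerivAt (fun w : ℝ => ((Real.exp (-(c * w)) : ℝ) : ℂ))
      (-(c : ℂ) * (Real.exp (-(c * w)) : ℝ)) w := by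
  have h1 : HasDerivAt (fun w : ℝ => -(c * w)) (-(c * 1)) w :=
    ((hasDerivAt_id w).const_mul c).neg
  refine h1.exp.ofReal_comp.congr_deriv ?_
  push_cast; ring

/-- Four-fold averages of the angular average decay like `k⁻⁴`. -/
lemma norm_avg_four_le {a k α : ℝ} (ha : 0 < a) (ha1 : a ≤ 1) (hk : k ≠ 0) :
    ‖(avg a)^[4] (angAvg k α) 0‖ ≤ 10 ^ 8 * a⁻¹ ^ 4 * k⁻¹ ^ 4 := by
  obtain ⟨J', hJ, hJ'⟩ := angAvg_ode k α
  set J := angAvg k α with hJdef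
  have hJc : Continuous J := continuous_angAvg k α
  have hJ'c : Continuous J' := continuous_iff_continuousAt.mpr fun w => (hJ' w).continuousAt
  have hκ : (k : ℂ) ≠ 0 := by exact_mod_cast hk
  set κ : ℂ := -4 / (k : ℂ) ^ 2 with hκdef
  have hexpc : ∀ c : ℝ, Continuous fun w : ℝ => ((Real.exp (-(c * w)) : ℝ) : ℂ) := fun c => by
    fun_prop
  -- the derivatives of `e^{-cw} J`
  set X : ℝ → ℝ → ℂ := fun c w => ((Real.exp (-(c * w)) : ℝ) : ℂ) * J w with hX
  set X1 : ℝ → ℝ → ℂ := fun c w => -(c : ℂ) * X c w + ((Real.exp (-(c * w)) : ℝ) : ℂ) * J' w with hX1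
  set X2 : ℝ → ℝ → ℂ := fun c w => -(c : ℂ) * X1 c w + (-(c : ℂ) *
    (((Real.exp (-(c * w)) : ℝ) : ℂ) * J' w) + ((Real.exp (-(c * w)) : ℝ) : ℂ) *
      ((-(k ^ 2 / 4) * Real.exp w : ℝ) * J w)) with hX2
  have hXd : ∀ c w, HasDerivAt (X c) (X1 c w) w := fun c w => by
    refine ((hasDerivAt_ofReal_exp_neg_mul c w).mul (hJ w)).congr_deriv ?_
    simp only [hX1, hX]; ring
  have hX1d : ∀ c w, HasDerivAt (X1 c) (X2 c w) w := fun c w => by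
    refine (((hXd c w).const_mul (-(c : ℂ))).add
      ((hasDerivAt_ofReal_exp_neg_mul c w).mul (hJ' w))).congr_deriv ?_
    simp only [hX2]; ring
  have hXc : ∀ c, Continuous (X c) := fun c => (hexpc c).mul hJc
  have hX1c : ∀ c, Continuous (X1 c) := fun c => (continuous_const.mul (hXc c)).add ((hexpc c).mul hJ'c)
  have hX2c : ∀ c, Continuous (X2 c) := fun c => by
    refine (continuous_const.mul (hX1c c)).add ((continuous_const.mul ((hexpc c).mul hJ'c)).add
      ((hexpc c).mul (Continuous.mul ?_ hJc)))
    fun_prop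
  have key : ∀ c w, X (c - 1) w = κ * (X2 c w + (c + c : ℝ) • X1 c w + (c * c : ℝ) • X c w) := by
    intro c w
    have : Real.exp (-((c - 1) * w)) = Real.exp (-(c * w)) * Real.exp w := by
      rw [← Real.exp_add]; ring_nf
    simp only [hX2, hX1, hX, this, hκdef, Complex.real_smul]
    push_cast
    field_simp
    ring
  have hJ0 : J = fun w => κ * (X2 1 w + (1 + 1 : ℝ) • X1 1 w + (1 * 1 : ℝ) • X 1 w) := by
    funext w; rw [← key 1 w]; simp [hX]
  have hX0 : X 1 = fun w => κ * (X2 2 w + (2 + 2 : ℝ) • X1 2 w + (2 * 2 : ℝ) • X 2 w) := by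
    funext w; rw [← key 2 w]; norm_num
  have hav : ∀ g : ℝ → ℂ, avg a (avg a fun w => κ * g w) = fun w => κ * avg a (avg a g) w := by
    intro g
    have h1 := avg_smul a κ g
    simp only [smul_eq_mul] at h1
    rw [h1]
    have h2 := avg_smul a κ (avg a g)
    simpa only [smul_eq_mul] using h2
  have hκn : ‖κ‖ = 4 * k⁻¹ ^ 2 := by
    rw [hκdef, norm_div, norm_pow, Complex.norm_real, Real.norm_eq_abs, sq_abs]
    simp [div_eq_mul_inv]
  -- the inner bound
  have hb0 : ∀ v, |v| ≤ 2 * a + a + a → ‖X 2 v‖ ≤ Real.exp 8 * (2 * Real.pi) := by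
    intro v hv
    rw [hX, norm_mul, Complex.norm_real, Real.norm_eq_abs, Real.abs_exp]
    refine mul_le_mul (Real.exp_le_exp.mpr ?_) (norm_angAvg_le k α v) (norm_nonneg _)
      (Real.exp_pos _).le
    have := neg_abs_le v
    linarith
  have hb1 : ∀ v, |v| ≤ 2 * a → ‖avg a (avg a (X 1)) v‖ ≤
      4 * k⁻¹ ^ 2 * ((a⁻¹ + 2) * ((a⁻¹ + 2) * (Real.exp 8 * (2 * Real.pi)))) := by
    intro v hv
    rw [hX0, hav, norm_mul, hκn]
    gcongr
    exact norm_avg_avg_le ha (by norm_num) (by norm_num) (hXd 2) (hX1d 2) (hX2c 2) hb0 hv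
  set Y := avg a (avg a (X 1)) with hY
  have hAc : ∀ {g : ℝ → ℂ}, Continuous g → Continuous (avg a g) := fun h =>
    continuous_avg_of_continuous h
  have hYd : ∀ v, HasDerivAt Y (avg a (avg a (X1 1)) v) v :=
    hasDerivAt_avg (hasDerivAt_avg (hXd 1) (hX1c 1)) (hAc (hX1c 1))
  have hYd1 : ∀ v, HasDerivAt (avg a (avg a (X1 1))) (avg a (avg a (X2 1)) v) v :=
    hasDerivAt_avg (hasDerivAt_avg (hX1d 1) (hX2c 1)) (hAc (hX2c 1))
  have hadd : ∀ c d : ℝ, avg a (fun w => X2 1 w + c • X1 1 w + d • X 1 w) =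
      fun w => avg a (X2 1) w + c • avg a (X1 1) w + d • avg a (X 1) w := by
    intro c d
    rw [avg_add (g := fun w => X2 1 w + c • X1 1 w) (h := fun w => d • X 1 w)
      ((hX2c 1).add ((hX1c 1).const_smul c)) ((hXc 1).const_smul d),
      avg_add (g := X2 1) (h := fun w => c • X1 1 w) (hX2c 1) ((hX1c 1).const_smul c),
      avg_smul, avg_smul]
  have hadd2 : ∀ c d : ℝ, avg a (fun w => avg a (X2 1) w + c • avg a (X1 1) w + d • avg a (X 1) w) =
      fun w => avg a (avg a (X2 1)) w + c • avg a (avg a (X1 1)) w + d • avg a (avg a (X 1)) w := by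
    intro c d
    rw [avg_add (g := fun w => avg a (X2 1) w + c • avg a (X1 1) w) (h := fun w => d • avg a (X 1) w)
      ((hAc (hX2c 1)).add ((hAc (hX1c 1)).const_smul c)) ((hAc (hXc 1)).const_smul d),
      avg_add (g := avg a (X2 1)) (h := fun w => c • avg a (X1 1) w) (hAc (hX2c 1))
        ((hAc (hX1c 1)).const_smul c), avg_smul, avg_smul]
  have e : (avg a)^[4] J 0 = κ * avg a (avg a fun w => avg a (avg a (X2 1)) w +
      (1 + 1 : ℝ) • avg a (avg a (X1 1)) w + (1 * 1 : ℝ) • Y w) 0 := by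
    have : (avg a)^[4] J = avg a (avg a (avg a (avg a J))) := rfl
    rw [this]
    nth_rewrite 1 [hJ0]
    rw [hav, hadd, hadd2, hav]
  rw [e, norm_mul, hκn]
  have h3 := norm_avg_avg_le (r := 0) (v := 0) ha (zero_le_one) (zero_le_one) hYd hYd1
    (hAc (hAc (hX2c 1))) (fun v hv => hb1 v (by linarith)) (by simp)
  have hai : 1 ≤ a⁻¹ := (one_le_inv₀ ha).mpr ha1
  have hk2 : 0 ≤ k⁻¹ ^ 2 := sq_nonneg _
  have he : Real.exp 8 ≤ 6561 := by
    have := Real.exp_one_lt_d9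
    calc Real.exp 8 = Real.exp 1 ^ 8 := by rw [← Real.exp_nat_mul]; norm_num
      _ ≤ 3 ^ 8 := by gcongr; linarith
      _ = _ := by norm_num
  have hpi : 2 * Real.pi ≤ 7 := by linarith [Real.pi_lt_d2]
  calc _ ≤ 4 * k⁻¹ ^ 2 * ((a⁻¹ + 1) * ((a⁻¹ + 1) * (4 * k⁻¹ ^ 2 * ((a⁻¹ + 2) * ((a⁻¹ + 2) *
        (Real.exp 8 * (2 * Real.pi))))))) := by gcongr
    _ ≤ 4 * k⁻¹ ^ 2 * ((a⁻¹ + a⁻¹) * ((a⁻¹ + a⁻¹) * (4 * k⁻¹ ^ 2 * ((a⁻¹ + 2 * a⁻¹) *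
        ((a⁻¹ + 2 * a⁻¹) * (6561 * 7)))))) := by gcongr <;> linarith
    _ = 26453952 * a⁻¹ ^ 4 * k⁻¹ ^ 4 := by ring
    _ ≤ 10 ^ 8 * a⁻¹ ^ 4 * k⁻¹ ^ 4 := by
        have : 0 ≤ k⁻¹ ^ 4 := by positivity
        gcongr; norm_num

/-- The real analogue of `norm_avg_four_le`. -/
lemma norm_avg_two_le {a k : ℝ} (ha : 0 < a) (ha1 : a ≤ 1) (hk : k ≠ 0) :
    ‖(avg a)^[2] (fun w => cexp (I * (k * Real.exp w : ℝ))) 0‖ ≤ 10 ^ 8 * a⁻¹ ^ 2 * k⁻¹ ^ 2 := by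
  set F : ℝ → ℂ := fun w => cexp (I * (k * Real.exp w : ℝ)) with hF
  have hκ : (k : ℂ) ≠ 0 := by exact_mod_cast hk
  have hFd : ∀ w, HasDerivAt F ((I * (k * Real.exp w : ℝ)) * F w) w := fun w => by
    refine ((((Real.hasDerivAt_exp w).const_mul k).ofReal_comp.const_mul I).cexp).congr_deriv ?_
    simp only [hF]; ring
  have hFc : Continuous F := by simp only [hF]; fun_prop
  set W : ℝ → ℂ := fun w => ((Real.exp (-(2 * w)) : ℝ) : ℂ) * F w with hW
  set W1 : ℝ → ℂ := fun w => -2 * W w + I * k * ((Real.exp (-(1 * w)) : ℝ) : ℂ) * F w with hW1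
  set W2 : ℝ → ℂ := fun w => -2 * W1 w + (-1 * (I * k * ((Real.exp (-(1 * w)) : ℝ) : ℂ) * F w) +
    I * k * (I * k) * F w) with hW2
  have hee : ∀ w : ℝ, ((Real.exp (-(2 * w)) : ℝ) : ℂ) * (Real.exp w : ℝ) = (Real.exp (-(1 * w)) : ℝ) := by
    intro w; rw [← Complex.ofReal_mul, ← Real.exp_add]; ring_nf
  have hee1 : ∀ w : ℝ, ((Real.exp (-(1 * w)) : ℝ) : ℂ) * (Real.exp w : ℝ) = 1 := by
    intro w; rw [← Complex.ofReal_mul, ← Real.exp_add]; simp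
  have hWd : ∀ w, HasDerivAt W (W1 w) w := fun w => by
    refine ((hasDerivAt_ofReal_exp_neg_mul 2 w).mul (hFd w)).congr_deriv ?_
    simp only [hW1, hW]
    push_cast [← hee w]; ring
  have hW1d : ∀ w, HasDerivAt W1 (W2 w) w := fun w => by
    refine (((hWd w).const_mul (-2)).add
      (((hasDerivAt_ofReal_exp_neg_mul 1 w).const_mul (I * k)).mul (hFd w))).congr_deriv ?_
    simp only [hW2]
    have := hee1 w
    push_cast at this ⊢
    linear_combination (I * k * I * k * F w) * this
  have hWc : Continuous W := by simp only [hW]; fun_prop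
  have hW1c : Continuous W1 := by simp only [hW1]; fun_prop
  have hW2c : Continuous W2 := by simp only [hW2]; fun_prop
  set κ : ℂ := -1 / (k : ℂ) ^ 2 with hκdef
  have key : F = fun w => κ • (W2 w + (1 + 2 : ℝ) • W1 w + (1 * 2 : ℝ) • W w) := by
    funext w
    simp only [hW2, hW1, hW, hκdef, Complex.real_smul, smul_eq_mul]
    push_cast
    field_simp
    ring_nf
    rw [Complex.I_sq]; ring
  have hκn : ‖κ‖ = k⁻¹ ^ 2 := by
    rw [hκdef, norm_div, norm_pow, Complex.norm_real, Real.norm_eq_abs, sq_abs]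
    simp
  have hb0 : ∀ v, |v| ≤ 0 + a + a → ‖W v‖ ≤ Real.exp 4 := by
    intro v hv
    have hFn : ‖F v‖ = 1 := by rw [hF]; simp only; rw [mul_comm I, Complex.norm_exp_ofReal_mul_I]
    rw [hW, norm_mul, Complex.norm_real, Real.norm_eq_abs, Real.abs_exp, hFn, mul_one]
    refine Real.exp_le_exp.mpr ?_
    have := neg_abs_le v
    linarith
  have e : (avg a)^[2] F 0 = κ * avg a (avg a fun w => W2 w +
      (1 + 2 : ℝ) • W1 w + (1 * 2 : ℝ) • W w) 0 := by
    have : (avg a)^[2] F = avg a (avg a F) := rfl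
    rw [this]
    nth_rewrite 1 [key]
    rw [avg_smul, avg_smul]; rfl
  rw [e, norm_mul, hκn]
  have h3 := norm_avg_avg_le (r := 0) (v := 0) ha zero_le_one zero_le_two hWd hW1d hW2c hb0 (by simp)
  have hai : 1 ≤ a⁻¹ := (one_le_inv₀ ha).mpr ha1
  have hk2 : 0 ≤ k⁻¹ ^ 2 := sq_nonneg _
  have he : Real.exp 4 ≤ 81 := by
    have := Real.exp_one_lt_d9
    calc Real.exp 4 = Real.exp 1 ^ 4 := by rw [← Real.exp_nat_mul]; norm_num
      _ ≤ 3 ^ 4 := by gcongr; linarith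
      _ = _ := by norm_num
  calc _ ≤ k⁻¹ ^ 2 * ((a⁻¹ + 1) * ((a⁻¹ + 2) * Real.exp 4)) := by gcongr
    _ ≤ k⁻¹ ^ 2 * ((a⁻¹ + a⁻¹) * ((a⁻¹ + 2 * a⁻¹) * 81)) := by gcongr <;> linarith
    _ = 486 * a⁻¹ ^ 2 * k⁻¹ ^ 2 := by ring
    _ ≤ 10 ^ 8 * a⁻¹ ^ 2 * k⁻¹ ^ 2 := by gcongr; norm_num

end LocalTest

section LocalFourier

open MeasureTheory Set

lemma norm_iterate_avg_le {a B : ℝ} (ha : 0 < a) {F : ℝ → ℂ} (hB : ∀ v, ‖F v‖ ≤ B) (k : ℕ) (v : ℝ) :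
    ‖(avg a)^[k] F v‖ ≤ B := by
  induction k generalizing v with
  | zero => exact hB v
  | succ k ih =>
    rw [Function.iterate_succ_apply']
    exact norm_avg_le (r := |v|) ha (fun w _ => ih w) le_rfl

/-- The test function at a real place (supported on the positive axis). -/
def locR (a z : ℝ) : ℝ := if 0 < z then bspline a 1 (Real.log z) / z else 0

/-- The test function at a complex place. -/
def locC (a : ℝ) (z : ℂ) : ℝ := bspline a 3 (2 * Real.log ‖z‖) / ‖z‖ ^ 2

lemma bspline_eq_zero_of_log_lt {a : ℝ} (ha : 0 < a) {k : ℕ} {r : ℝ} {c : ℝ} (hr : 0 < r)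
    (hc : 0 < c) (h : Real.exp (((k + 1) * a) / c) < r ∨ r < Real.exp (-(((k + 1) * a) / c))) :
    bspline a k (c * Real.log r) = 0 := by
  refine bspline_eq_zero ha ?_
  rw [abs_mul, abs_of_pos hc, mul_comm c, ← div_lt_iff₀ hc]
  rcases h with h | h
  · exact lt_of_lt_of_le ((Real.lt_log_iff_exp_lt hr).mpr h) (le_abs_self _)
  · have := (Real.log_lt_iff_lt_exp hr).mpr h
    exact lt_of_lt_of_le (by linarith) (neg_le_abs _)

lemma continuous_locR {a : ℝ} (ha : 0 < a) : Continuous (locR a) := by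
  have hpos : ∀ z : ℝ, 0 < max z (Real.exp (-(3 * a))) := fun z =>
    lt_of_lt_of_le (Real.exp_pos _) (le_max_right _ _)
  have h : locR a = fun z => bspline a 1 (Real.log (max z (Real.exp (-(3 * a))))) /
      max z (Real.exp (-(3 * a))) := by
    funext z
    rcases le_or_gt (Real.exp (-(3 * a))) z with hz | hz
    · rw [max_eq_left hz, locR, if_pos (lt_of_lt_of_le (Real.exp_pos _) hz)]
    · rw [max_eq_right hz.le, Real.log_exp, bspline_eq_zero ha, zero_div, locR]
      · split_ifs with h0
        · have := bspline_eq_zero_of_log_lt (k := 1) (c := 1) ha h0 one_pos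
            (Or.inr (hz.trans_le (Real.exp_le_exp.mpr (by push_cast; linarith))))
          rw [one_mul] at this
          rw [this, zero_div]
        · rfl
      · rw [abs_neg, abs_of_pos (by linarith)]; push_cast; linarith
  rw [h]
  refine Continuous.div ((continuous_bspline_succ ha 0).comp (Continuous.log (by fun_prop)
    fun z => (hpos z).ne')) (by fun_prop) fun z => (hpos z).ne'

lemma continuous_locC {a : ℝ} (ha : 0 < a) : Continuous (locC a) := by
  have hpos : ∀ z : ℂ, 0 < max ‖z‖ (Real.exp (-(3 * a))) := fun z =>
    lt_of_lt_of_le (Real.exp_pos _) (le_max_right _ _)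
  have h : locC a = fun z => bspline a 3 (2 * Real.log (max ‖z‖ (Real.exp (-(3 * a))))) /
      (max ‖z‖ (Real.exp (-(3 * a)))) ^ 2 := by
    funext z
    rcases le_or_gt (Real.exp (-(3 * a))) ‖z‖ with hz | hz
    · rw [max_eq_left hz, locC]
    · rw [max_eq_right hz.le, Real.log_exp, bspline_eq_zero ha, zero_div, locC]
      · rcases eq_or_lt_of_le (norm_nonneg z) with h0 | h0
        · rw [← h0]; simp
        · rw [bspline_eq_zero_of_log_lt (k := 3) (c := 2) ha h0 two_pos
            (Or.inr (hz.trans_le (Real.exp_le_exp.mpr (by push_cast; linarith)))), zero_div]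
      · rw [abs_mul, abs_neg, abs_of_pos (by linarith : 0 < 3 * a), abs_two]; push_cast; linarith
  rw [h]
  refine Continuous.div ((continuous_bspline_succ ha 2).comp (continuous_const.mul
    (Continuous.log (by fun_prop) fun z => (hpos z).ne'))) (by fun_prop)
      fun z => (pow_pos (hpos z) 2).ne'

lemma locR_eq_zero {a : ℝ} (ha : 0 < a) {z : ℝ} (hz : Real.exp (2 * a) < ‖z‖) : locR a z = 0 := by
  rw [locR]; split_ifs with h0
  · rw [Real.norm_eq_abs, abs_of_pos h0] at hz
    have := bspline_eq_zero_of_log_lt (k := 1) (c := 1) ha h0 one_pos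
      (Or.inl (lt_of_le_of_lt (Real.exp_le_exp.mpr (by push_cast; linarith)) hz))
    rw [one_mul] at this
    rw [this, zero_div]
  · rfl

lemma locC_eq_zero {a : ℝ} (ha : 0 < a) {z : ℂ} (hz : Real.exp (2 * a) < ‖z‖) : locC a z = 0 := by
  rw [locC, bspline_eq_zero_of_log_lt (k := 3) (c := 2) ha ((Real.exp_pos _).trans hz) two_pos
    (Or.inl (lt_of_le_of_lt (Real.exp_le_exp.mpr (by push_cast; linarith)) hz)), zero_div]

lemma integral_locR (a : ℝ) (G : ℝ → ℂ) :
    ∫ z, locR a z • G z = ∫ w, bspline a 1 w • G (Real.exp w) := by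
  have h1 : ∫ z, locR a z • G z = ∫ z in Ioi 0, (bspline a 1 (Real.log z) / z) • G z := by
    rw [← integral_indicator measurableSet_Ioi]
    congr 1; funext z
    by_cases hz : 0 < z
    · rw [indicator_of_mem (mem_Ioi.mpr hz), locR, if_pos hz]
    · rw [indicator_of_notMem (by simpa using hz), locR, if_neg hz, zero_smul]
  have h2 : Ioi (0 : ℝ) = Real.exp '' univ := by rw [image_univ, Real.range_exp]
  rw [h1, h2, integral_image_eq_integral_abs_deriv_smul MeasurableSet.univ
    (fun x _ => (Real.hasDerivAt_exp x).hasDerivWithinAt) Real.exp_injective.injOn,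
    Measure.restrict_univ]
  congr 1; funext w
  rw [Real.log_exp, Real.abs_exp, smul_smul, mul_div_cancel₀ _ (Real.exp_pos w).ne']

lemma integral_locC {a : ℝ} (ha : 0 < a) {G : ℂ → ℂ} (hG : Continuous G) :
    ∫ z, locC a z • G z = ∫ w : ℝ, bspline a 3 w • ((1 / 2 : ℂ) * ∫ θ in (-Real.pi)..Real.pi,
      G (Real.exp (w / 2) * (Real.cos θ + Real.sin θ * I))) := by
  set P : ℝ × ℝ → ℂ := fun p => p.1 * (Real.cos p.2 + Real.sin p.2 * I)
  have hPc : Continuous P := by fun_prop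
  have hPn : ∀ p, ‖P p‖ = |p.1| := fun p => by
    rw [← Complex.norm_polarCoord_symm, Complex.polarCoord_symm_apply]
  set h : ℝ × ℝ → ℂ := fun p => p.1 • (locC a (P p) • G (P p)) with hh
  have hhc : Continuous h := continuous_fst.smul (((continuous_locC ha).comp hPc).smul
    (hG.comp hPc))
  have hint : IntegrableOn h (Ioi (0 : ℝ) ×ˢ Ioo (-Real.pi) Real.pi) (volume.prod volume) := by
    refine IntegrableOn.of_forall_sdiff_eq_zero (s := Icc 0 (Real.exp (2 * a)) ×ˢ
      Icc (-Real.pi) Real.pi) ?_ (measurableSet_Ioi.prod measurableSet_Ioo) ?_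
    · exact hhc.continuousOn.integrableOn_compact (isCompact_Icc.prod isCompact_Icc)
    · rintro ⟨r, θ⟩ ⟨⟨hr, hθ⟩, hn⟩
      have : Real.exp (2 * a) < r := by
        by_contra! hle
        exact hn ⟨⟨le_of_lt hr, hle⟩, Ioo_subset_Icc_self hθ⟩
      simp only [hh]
      rw [locC_eq_zero ha, zero_smul, smul_zero]
      rw [hPn]; exact this.trans_le (le_abs_self _)
  rw [← Complex.integral_comp_polarCoord_symm]
  have e0 : ∀ p : ℝ × ℝ, p.1 • (locC a (Complex.polarCoord.symm p) •
      G (Complex.polarCoord.symm p)) = h p := fun p => by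
    rw [Complex.polarCoord_symm_apply]
  simp_rw [e0]
  rw [polarCoord_target, Measure.volume_eq_prod, setIntegral_prod _ hint]
  have h2 : Ioi (0 : ℝ) = (fun w => Real.exp (w / 2)) '' univ := by
    rw [image_univ]
    have : (fun w : ℝ => Real.exp (w / 2)) = Real.exp ∘ fun w => w / 2 := rfl
    rw [this, Function.Surjective.range_comp, Real.range_exp]
    exact fun y => ⟨y * 2, by simp⟩
  have hd : ∀ w : ℝ, HasDerivAt (fun w => Real.exp (w / 2)) (Real.exp (w / 2) * (1 / 2)) w :=
    fun w => ((hasDerivAt_id w).div_const 2).exp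
  rw [h2, integral_image_eq_integral_abs_deriv_smul MeasurableSet.univ
    (fun x _ => (hd x).hasDerivWithinAt), Measure.restrict_univ]
  · congr 1; funext w
    rw [intervalIntegral.integral_of_le (by linarith [Real.pi_pos]), integral_Ioc_eq_integral_Ioo]
    have e1 : ∀ θ : ℝ, h (Real.exp (w / 2), θ) = (bspline a 3 w / Real.exp (w / 2)) •
        G (Real.exp (w / 2) * (Real.cos θ + Real.sin θ * I)) := by
      intro θ
      simp only [hh, locC]
      rw [hPn, Real.abs_exp, Real.log_exp, mul_div_cancel₀ _ (two_ne_zero), smul_smul]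
      congr 1
      have := (Real.exp_pos (w / 2)).ne'
      field_simp
    simp_rw [e1]
    rw [integral_smul, smul_smul, abs_of_pos (by positivity)]
    have : (Real.exp (w / 2) : ℂ) ≠ 0 := by exact_mod_cast (Real.exp_pos (w / 2)).ne'
    simp only [Complex.real_smul]
    generalize (∫ θ in Ioo (-Real.pi) Real.pi,
      G (Real.exp (w / 2) * (Real.cos θ + Real.sin θ * I))) = J
    push_cast at this ⊢
    field_simp
  · intro x _ y _ hxy
    have := Real.exp_injective hxy
    simpa using this

/-- The Fourier transform of the test function at a real place. -/
def ftR (a ξ : ℝ) : ℂ := ∫ z, locR a z • cexp (I * (-(2 * Real.pi) * (ξ * z) : ℝ))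

/-- The Fourier transform (for the trace form) of the test function at a complex place. -/
def ftC (a : ℝ) (ξ : ℂ) : ℂ :=
  ∫ z, locC a z • cexp (I * (-(2 * Real.pi) * (2 * (ξ * z).re) : ℝ))

lemma ftR_eq {a : ℝ} (ha : 0 < a) (ξ : ℝ) :
    ftR a ξ = (avg a)^[2] (fun w => cexp (I * ((-(2 * Real.pi) * ξ) * Real.exp w : ℝ))) 0 := by
  rw [ftR, integral_locR, integral_bspline ha 1 (by fun_prop)]
  simp only [mul_assoc]

lemma ftC_eq {a : ℝ} (ha : 0 < a) (ξ : ℂ) :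
    ftC a ξ = (1 / 2 : ℂ) * (avg a)^[4] (angAvg (-(4 * Real.pi) * ‖ξ‖) ξ.arg) 0 := by
  rw [ftC, integral_locC ha (by fun_prop), ← integral_bspline ha 3 (continuous_angAvg _ _),
    ← integral_const_mul]
  congr 1; funext w
  rw [mul_smul_comm]
  congr 2
  rw [angAvg]
  congr 1; funext θ
  congr 3
  have h1 := Complex.norm_mul_cos_add_sin_mul_I ξ
  rw [Real.cos_add]
  have hre : ξ.re = ‖ξ‖ * Real.cos ξ.arg := (Complex.norm_mul_cos_arg ξ).symm
  have him : ξ.im = ‖ξ‖ * Real.sin ξ.arg := (Complex.norm_mul_sin_arg ξ).symm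
  have : (ξ * (Real.exp (w / 2) * (Real.cos θ + Real.sin θ * I))).re =
      Real.exp (w / 2) * (ξ.re * Real.cos θ - ξ.im * Real.sin θ) := by
    have e : ξ * (Real.exp (w / 2) * (Real.cos θ + Real.sin θ * I)) =
      (Real.exp (w / 2) : ℂ) * (ξ * (⟨Real.cos θ, Real.sin θ⟩ : ℂ)) := by
        rw [Complex.mk_eq_add_mul_I]; ring
    rw [e, Complex.re_ofReal_mul, Complex.mul_re]
  rw [this, hre, him]
  ring

/-- The decay profile of the local Fourier transforms. -/
def decay (τ : ℝ) : ℝ := τ ^ (-(3 / 2) : ℝ) * Real.exp (-(|Real.log τ| / 2))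

lemma le_decay {τ B : ℝ} (hτ : 0 < τ) (h1 : B ≤ 1) (h2 : B ≤ τ⁻¹ ^ 2) : B ≤ decay τ := by
  have e : decay τ = Real.exp (-(3 / 2) * Real.log τ - |Real.log τ| / 2) := by
    rw [decay, Real.rpow_def_of_pos hτ, ← Real.exp_add]; congr 1; ring
  rw [e]
  rcases le_total 0 (Real.log τ) with h | h
  · rw [abs_of_nonneg h]
    refine h2.trans (le_of_eq ?_)
    rw [show -(3 / 2) * Real.log τ - Real.log τ / 2 = (2 : ℕ) * -Real.log τ by push_cast; ring,
      Real.exp_nat_mul, Real.exp_neg, Real.exp_log hτ]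
  · rw [abs_of_nonpos h]
    refine h1.trans (Real.one_le_exp ?_)
    linarith

lemma norm_ftR_le {a : ℝ} (ha : 0 < a) (ha1 : a ≤ 1) {ξ : ℝ} (hξ : ξ ≠ 0) :
    ‖ftR a ξ‖ ≤ 10 ^ 8 * a⁻¹ ^ 2 * decay ‖ξ‖ := by
  have hai : 1 ≤ a⁻¹ := (one_le_inv₀ ha).mpr ha1
  have hC : (1 : ℝ) ≤ 10 ^ 8 * a⁻¹ ^ 2 := by nlinarith
  rw [mul_comm, ← div_le_iff₀ (by linarith)]
  refine le_decay (norm_pos_iff.mpr hξ) ?_ ?_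
  · rw [div_le_one (by linarith), ftR_eq ha]
    refine (norm_iterate_avg_le ha (B := 1) (fun v => ?_) 2 0).trans hC
    rw [mul_comm I, Complex.norm_exp_ofReal_mul_I]
  · have hpi : (1 : ℝ) ≤ (2 * Real.pi) ^ 2 := by nlinarith [Real.pi_gt_three]
    have hC0 : (0 : ℝ) < 10 ^ 8 * a⁻¹ ^ 2 := by linarith
    have hpi0 : -(2 * Real.pi) ≠ 0 := by linarith [Real.pi_pos]
    rw [div_le_iff₀ hC0, ftR_eq ha, mul_comm (((‖ξ‖)⁻¹) ^ 2)]
    refine (norm_avg_two_le ha ha1 (mul_ne_zero hpi0 hξ)).trans ?_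
    refine mul_le_mul_of_nonneg_left ?_ (by positivity)
    rw [inv_pow, inv_pow, mul_pow, Real.norm_eq_abs, sq_abs, neg_sq]
    have : 0 < ξ ^ 2 := by positivity
    exact inv_anti₀ this (le_mul_of_one_le_left this.le hpi)

lemma norm_ftC_le {a : ℝ} (ha : 0 < a) (ha1 : a ≤ 1) {ξ : ℂ} (hξ : ξ ≠ 0) :
    ‖ftC a ξ‖ ≤ 10 ^ 8 * a⁻¹ ^ 4 * decay (‖ξ‖ ^ 2) := by
  have hai : 1 ≤ a⁻¹ := (one_le_inv₀ ha).mpr ha1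
  have hC : (4 : ℝ) ≤ 10 ^ 8 * a⁻¹ ^ 4 := by
    have := one_le_pow₀ hai (n := 4)
    linarith
  have hn := norm_pos_iff.mpr hξ
  have hC0 : (0 : ℝ) < 10 ^ 8 * a⁻¹ ^ 4 := by linarith
  rw [mul_comm, ← div_le_iff₀ hC0]
  refine le_decay (by positivity) ?_ ?_
  · rw [div_le_one hC0, ftC_eq ha, norm_mul]
    have h := norm_iterate_avg_le ha (norm_angAvg_le (-(4 * Real.pi) * ‖ξ‖) ξ.arg) 4 0
    have : ‖(1 / 2 : ℂ)‖ = 1 / 2 := by norm_num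
    rw [this]
    linarith [Real.pi_lt_four]
  · have hpi : (1 : ℝ) ≤ (4 * Real.pi) ^ 4 := one_le_pow₀ (by linarith [Real.pi_gt_three])
    rw [div_le_iff₀ hC0, ftC_eq ha, norm_mul, mul_comm (((‖ξ‖ ^ 2)⁻¹) ^ 2)]
    have h := norm_avg_four_le (α := ξ.arg) ha ha1
        (mul_ne_zero (by linarith [Real.pi_pos] : -(4 * Real.pi) ≠ 0) hn.ne')
    have h12 : ‖(1 / 2 : ℂ)‖ ≤ 1 := by norm_num
    refine (mul_le_of_le_one_left (norm_nonneg _) h12).trans (h.trans ?_)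
    refine mul_le_mul_of_nonneg_left ?_ (by positivity)
    rw [inv_pow, inv_pow, mul_pow, ← pow_mul, show (-(4 * Real.pi)) ^ 4 = (4 * Real.pi) ^ 4 by ring]
    have : 0 < ‖ξ‖ ^ (2 * 2) := by positivity
    exact inv_anti₀ this (le_mul_of_one_le_left this.le hpi)

end LocalFourier

section

open MeasureTheory Set

lemma hasCompactSupport_of_abs_le {f : ℝ → ℂ} (R : ℝ) (h : ∀ s, R < |s| → f s = 0) :
    HasCompactSupport f :=
  HasCompactSupport.of_support_subset_isCompact (isCompact_Icc (a := -R) (b := R)) fun s hs => by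
    by_contra hn
    refine hs (h s ?_)
    rw [mem_Icc, ← abs_le, not_le] at hn
    exact hn

lemma eq_of_laplace_eq {f g : ℝ → ℂ} (hf : Continuous f) (hg : Continuous g)
    (hf' : HasCompactSupport f) (hg' : HasCompactSupport g)
    (h : ∀ c : ℂ, c ≠ 0 → ∫ s : ℝ, f s * cexp (c * s) = ∫ s : ℝ, g s * cexp (c * s)) : f = g := by
  set F : ℝ → ℂ := fun s => (f s - g s) * cexp s with hF
  have hFc : Continuous F := by fun_prop
  have hFs : HasCompactSupport F := (hf'.sub hg').mul_right
  have hFT : FourierTransform.fourier F = 0 := by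
    funext t
    rw [Real.fourier_real_eq_integral_exp_smul, Pi.zero_apply]
    have hc : (1 - 2 * Real.pi * t * I : ℂ) ≠ 0 := fun h0 => by
      have := congrArg Complex.re h0
      simp at this
    have e1 : ∀ p : ℝ → ℂ, Continuous p → HasCompactSupport p →
        Integrable fun s : ℝ => p s * cexp ((1 - 2 * Real.pi * t * I) * s) := fun p hp hp' =>
      Continuous.integrable_of_hasCompactSupport (by fun_prop) hp'.mul_right
    have : ∀ s : ℝ, cexp (((-2 * Real.pi * s * t : ℝ) : ℂ) * I) • F s =
        f s * cexp ((1 - 2 * Real.pi * t * I) * s) - g s * cexp ((1 - 2 * Real.pi * t * I) * s) := by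
      intro s
      simp only [hF, smul_eq_mul]
      have : cexp ((1 - 2 * Real.pi * t * I) * s) =
          cexp (((-2 * Real.pi * s * t : ℝ) : ℂ) * I) * cexp s := by
        rw [← Complex.exp_add]; congr 1; push_cast; ring
      rw [this]; ring
    simp_rw [this]
    rw [integral_sub (e1 f hf hf') (e1 g hg hg'), h _ hc, sub_self]
  have hinv := hFc.fourierInv_fourier_eq (hFc.integrable_of_hasCompactSupport hFs)
    (by rw [hFT]; exact integrable_zero _ _ _)
  rw [hFT] at hinv
  funext s
  have := congrFun hinv s
  rw [Real.fourierInv_eq] at this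
  simp only [Pi.zero_apply, smul_zero, integral_zero] at this
  have h2 : (f s - g s) * cexp s = 0 := this.symm
  rcases mul_eq_zero.mp h2 with h3 | h3
  · exact sub_eq_zero.mp h3
  · exact absurd h3 (Complex.exp_ne_zero _)

lemma integral_bspline_mul_exp {a : ℝ} (ha : 0 < a) (k : ℕ) {c : ℂ} (hc : c ≠ 0) :
    ∫ v : ℝ, (bspline a k v : ℂ) * cexp (c * v) =
      (Complex.sinh (c * a) / (c * a)) ^ (k + 1) := by
  have h := integral_bspline ha k (F := fun v => cexp (c * v)) (by fun_prop)
  simp only [Complex.real_smul] at h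
  rw [h]
  have : ∀ j : ℕ, (avg a)^[j] (fun v => cexp (c * v)) =
      fun v : ℝ => (Complex.sinh (c * a) / (c * a)) ^ j * cexp (c * v) := by
    intro j
    induction j with
    | zero => funext v; simp
    | succ j ih =>
      rw [Function.iterate_succ_apply', ih]
      have := avg_smul (𝕜 := ℂ) a ((Complex.sinh (c * a) / (c * a)) ^ j)
        (fun v : ℝ => cexp (c * v))
      simp only [smul_eq_mul] at this
      rw [avg_exp ha.ne' hc] at this
      refine Eq.trans this ?_
      funext v
      simp only [pow_succ]
      ring
  rw [this]; simp

lemma norm_bspline_support {a : ℝ} (ha : 0 < a) {k : ℕ} {v : ℝ} (h : bspline a k v ≠ 0) :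
    |v| ≤ (k + 1) * a := by
  by_contra! hn
  exact h (bspline_eq_zero ha hn)

variable {ι : Type*} [Fintype ι]

/-- The density of a sum of independent variables with B-spline densities. -/
def convB (a : ℝ) (k : ι → ℕ) (k0 : ℕ) (s : ℝ) : ℝ :=
  ∫ μ : ι → ℝ, (∏ i, bspline a (k i) (μ i)) * bspline a k0 (s - ∑ i, μ i)

lemma continuous_convB_integrand {a : ℝ} (ha : 0 < a) {k : ι → ℕ} {k0 : ℕ} (hk : ∀ i, 1 ≤ k i)
    (hk0 : 1 ≤ k0) : Continuous fun p : ℝ × (ι → ℝ) =>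
      (∏ i, bspline a (k i) (p.2 i)) * bspline a k0 (p.1 - ∑ i, p.2 i) := by
  have hb : ∀ j, 1 ≤ j → Continuous (bspline a j) := fun j hj => by
    obtain ⟨j, rfl⟩ := Nat.exists_eq_add_of_le' hj
    exact continuous_bspline_succ ha j
  refine Continuous.mul (continuous_finsetProd _ fun i _ => (hb _ (hk i)).comp (by fun_prop))
    ((hb _ hk0).comp (by fun_prop))

lemma convB_integrand_support {a : ℝ} (ha : 0 < a) {k : ι → ℕ} {k0 : ℕ} {s : ℝ} {μ : ι → ℝ}
    (h : (∏ i, bspline a (k i) (μ i)) * bspline a k0 (s - ∑ i, μ i) ≠ 0) :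
    (∀ i, |μ i| ≤ (k i + 1) * a) ∧ |s| ≤ (∑ i, (k i + 1 : ℝ) * a) + (k0 + 1) * a := by
  have h1 := left_ne_zero_of_mul h
  have h2 := norm_bspline_support ha (right_ne_zero_of_mul h)
  have h3 : ∀ i, |μ i| ≤ (k i + 1) * a := fun i =>
    norm_bspline_support ha (Finset.prod_ne_zero_iff.mp h1 i (Finset.mem_univ i))
  refine ⟨h3, ?_⟩
  have h4 : |∑ i, μ i| ≤ ∑ i, (k i + 1 : ℝ) * a :=
    (Finset.abs_sum_le_sum_abs _ _).trans (Finset.sum_le_sum fun i _ => h3 i)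
  have := abs_add_le (∑ i, μ i) (s - ∑ i, μ i)
  rw [add_sub_cancel] at this
  linarith

lemma isCompact_setOf_abs_le (r : ι → ℝ) : IsCompact {μ : ι → ℝ | ∀ i, |μ i| ≤ r i} := by
  have : {μ : ι → ℝ | ∀ i, |μ i| ≤ r i} = Set.pi univ fun i => Icc (-(r i)) (r i) := by
    ext μ; simp only [Set.mem_ofPred_eq, Set.mem_pi, mem_univ, true_imp_iff, mem_Icc, abs_le]
  rw [this]
  exact isCompact_univ_pi fun i => isCompact_Icc

lemma hasCompactSupport_convB_integrand {a : ℝ} (ha : 0 < a) (k : ι → ℕ) (k0 : ℕ) :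
    HasCompactSupport fun p : ℝ × (ι → ℝ) =>
      (∏ i, bspline a (k i) (p.2 i)) * bspline a k0 (p.1 - ∑ i, p.2 i) := by
  refine HasCompactSupport.of_support_subset_isCompact
    ((isCompact_Icc (a := -((∑ i, (k i + 1 : ℝ) * a) + (k0 + 1) * a))
      (b := (∑ i, (k i + 1 : ℝ) * a) + (k0 + 1) * a)).prod
      (isCompact_setOf_abs_le fun i => (k i + 1 : ℝ) * a)) ?_
  rintro ⟨s, μ⟩ h
  obtain ⟨h1, h2⟩ := convB_integrand_support ha h
  exact ⟨abs_le.mp h2, h1⟩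

lemma continuous_convB {a : ℝ} (ha : 0 < a) {k : ι → ℕ} {k0 : ℕ} (hk : ∀ i, 1 ≤ k i)
    (hk0 : 1 ≤ k0) : Continuous (convB a k k0) := by
  have h := continuous_parametric_integral_of_continuous (μ := (volume : Measure (ι → ℝ)))
    (f := fun (s : ℝ) (μ : ι → ℝ) => (∏ i, bspline a (k i) (μ i)) * bspline a k0 (s - ∑ i, μ i))
    (continuous_convB_integrand ha hk hk0) (isCompact_setOf_abs_le fun i => (k i + 1 : ℝ) * a)
  convert h using 2 with s
  rw [convB, setIntegral_eq_integral_of_forall_compl_eq_zero]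
  intro μ hμ
  by_contra hn
  exact hμ (convB_integrand_support ha hn).1

lemma convB_eq_zero {a : ℝ} (ha : 0 < a) {k : ι → ℕ} {k0 : ℕ} {s : ℝ}
    (hs : (∑ i, (k i + 1 : ℝ) * a) + (k0 + 1) * a < |s|) : convB a k k0 s = 0 := by
  rw [convB, integral_eq_zero_of_ae]
  refine Filter.Eventually.of_forall fun μ => ?_
  by_contra hn
  exact absurd (convB_integrand_support ha hn).2 (not_le.mpr hs)

lemma integral_convB_mul_exp {a : ℝ} (ha : 0 < a) {k : ι → ℕ} {k0 : ℕ} (hk : ∀ i, 1 ≤ k i)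
    (hk0 : 1 ≤ k0) {c : ℂ} (hc : c ≠ 0) :
    ∫ s : ℝ, (convB a k k0 s : ℂ) * cexp (c * s) =
      (Complex.sinh (c * a) / (c * a)) ^ ((∑ i, (k i + 1)) + (k0 + 1)) := by
  have e1 : ∀ s : ℝ, (convB a k k0 s : ℂ) * cexp (c * s) = ∫ μ : ι → ℝ,
      (((∏ i, bspline a (k i) (μ i)) * bspline a k0 (s - ∑ i, μ i) : ℝ) : ℂ) * cexp (c * s) := by
    intro s
    rw [convB, ← integral_complex_ofReal, integral_mul_const]
  simp_rw [e1]
  rw [integral_integral_swap_of_hasCompactSupport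
    (f := fun (s : ℝ) (μ : ι → ℝ) => (((∏ i, bspline a (k i) (μ i)) *
      bspline a k0 (s - ∑ i, μ i) : ℝ) : ℂ) * cexp (c * s))
    ((Complex.continuous_ofReal.comp (continuous_convB_integrand ha hk hk0)).mul (by fun_prop))
    (((hasCompactSupport_convB_integrand ha k k0).comp_left Complex.ofReal_zero).mul_right)]
  have e2 : ∀ μ : ι → ℝ, ∫ s : ℝ, (((∏ i, bspline a (k i) (μ i)) *
      bspline a k0 (s - ∑ i, μ i) : ℝ) : ℂ) * cexp (c * s) =
      (Complex.sinh (c * a) / (c * a)) ^ (k0 + 1) *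
        ∏ i, ((bspline a (k i) (μ i) : ℂ) * cexp (c * μ i)) := by
    intro μ
    rw [← integral_bspline_mul_exp ha k0 hc,
      ← integral_sub_right_eq_self (fun v : ℝ => (bspline a k0 v : ℂ) * cexp (c * v)) (∑ i, μ i),
      ← integral_mul_const]
    congr 1; funext s
    rw [Finset.prod_mul_distrib, ← Complex.exp_sum, ← Finset.mul_sum]
    have : cexp (c * s) = cexp (c * ((s - ∑ i, μ i : ℝ) : ℂ)) * cexp (c * ∑ i, (μ i : ℂ)) := by
      rw [← Complex.exp_add]; congr 1; push_cast; ring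
    rw [this]; push_cast; ring
  simp_rw [e2]
  rw [integral_const_mul, integral_fintype_prod_volume_eq_prod
    (f := fun i (v : ℝ) => (bspline a (k i) v : ℂ) * cexp (c * v))]
  simp_rw [integral_bspline_mul_exp ha _ hc]
  rw [Finset.prod_pow_eq_pow_sum, ← pow_add, add_comm]

lemma weiss_eq_convB {n : ℕ} {A : ℝ} (hA : 0 < A) {Ψ : ℝ → ℝ} (hΨ : IsWeissWeight n A Ψ)
    {k : ι → ℕ} {k0 : ℕ} (hk : ∀ i, 1 ≤ k i) (hk0 : 1 ≤ k0)
    (hsum : (∑ i, (k i + 1)) + (k0 + 1) = 2 * n) (s : ℝ) :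
    Ψ (Real.exp (-s)) = convB A⁻¹ k k0 s := by
  have ha : 0 < A⁻¹ := inv_pos.mpr hA
  obtain ⟨h1, -, h3, h4⟩ := hΨ
  have key : (fun s : ℝ => (Ψ (Real.exp (-s)) : ℂ)) = fun s => (convB A⁻¹ k k0 s : ℂ) := by
    refine eq_of_laplace_eq (by fun_prop)
      (Complex.continuous_ofReal.comp (continuous_convB ha hk hk0)) ?_ ?_ ?_
    · refine hasCompactSupport_of_abs_le (2 * n / A) fun s hs => ?_
      rw [h3, Complex.ofReal_zero]
      rw [mem_Icc, Real.exp_le_exp, Real.exp_le_exp, neg_div, neg_le_neg_iff, neg_le,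
        and_comm, ← abs_le, not_le]
      exact hs
    · exact hasCompactSupport_of_abs_le _ fun s hs => by
        rw [convB_eq_zero ha hs, Complex.ofReal_zero]
    · intro c hc
      rw [integral_convB_mul_exp ha hk hk0 hc, hsum]
      have h5 := h4 (-c) (neg_ne_zero.mpr hc)
      have h2 : Ioi (0 : ℝ) = (fun w => Real.exp (-w)) '' univ := by
        rw [image_univ]
        have : (fun w : ℝ => Real.exp (-w)) = Real.exp ∘ fun w => -w := rfl
        rw [this, Function.Surjective.range_comp neg_surjective, Real.range_exp]
      rw [h2, integral_image_eq_integral_abs_deriv_smul MeasurableSet.univ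
        (fun x _ => ((hasDerivAt_neg x).exp).hasDerivWithinAt)
        (fun x _ y _ h => neg_injective (Real.exp_injective h)), Measure.restrict_univ] at h5
      convert h5 using 1
      · congr 1; funext w
        have hw : ((Real.exp (-w) : ℝ) : ℂ) ^ (-c - 1) = cexp (c * w) * cexp w := by
          rw [Complex.ofReal_exp, ← Complex.exp_add, Complex.cpow_def_of_ne_zero
            (Complex.exp_ne_zero _), ← Complex.ofReal_exp, ← Complex.ofReal_log (Real.exp_pos _).le,
            Real.log_exp]
          congr 1; push_cast; ring
        rw [hw]
        simp only [mul_neg, mul_one, abs_neg, Real.abs_exp, Complex.real_smul]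
        have : ((Real.exp (-w) : ℝ) : ℂ) * cexp w = 1 := by
          rw [Complex.ofReal_exp, ← Complex.exp_add]; simp
        linear_combination (-(Ψ (Real.exp (-w)) : ℂ) * cexp (c * w)) * this
      · congr 1
        rw [Complex.ofReal_inv, ← div_eq_mul_inv, neg_div, Complex.sinh_neg, neg_div_neg_eq]
  have := congrFun key s
  exact_mod_cast this

end

section

open MeasureTheory Set UnitAddTorus

variable {d : Type*} [Fintype d]

/-- The sum of a function over the integer translates of a point. -/
def perSum (f : (d → ℝ) → ℂ) (x : d → ℝ) : ℂ := ∑' m : d → ℤ, f fun i => x i + m i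

/-- The cube of integer points with coordinates bounded by `N`. -/
def intCube (d : Type*) [Fintype d] (N : ℕ) : Finset (d → ℤ) := by
  classical exact Fintype.piFinset fun _ => Finset.Icc (-(N : ℤ)) N

lemma mem_intCube {N : ℕ} {m : d → ℤ} : m ∈ intCube d N ↔ ∀ i, |m i| ≤ N := by
  simp [intCube, abs_le]

lemma perSum_eq {f : (d → ℝ) → ℂ} {R C : ℝ} {N : ℕ} (hf : ∀ x, (∃ i, R < |x i|) → f x = 0)
    (hN : R + C ≤ N) {x : d → ℝ} (hx : ∀ i, |x i| ≤ C) :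
    perSum f x = ∑ m ∈ intCube d N, f fun i => x i + m i := by
  refine tsum_eq_sum fun m hm => hf _ ?_
  rw [mem_intCube] at hm
  push Not at hm
  obtain ⟨i, hi⟩ := hm
  refine ⟨i, ?_⟩
  have h1 : (N : ℝ) < |(m i : ℝ)| := by exact_mod_cast hi
  have h2 := abs_sub_abs_le_abs_sub (m i : ℝ) (-x i)
  rw [abs_neg, sub_neg_eq_add, add_comm (m i : ℝ)] at h2
  linarith [hx i]

lemma continuous_perSum {f : (d → ℝ) → ℂ} (hc : Continuous f) {R : ℝ}
    (hf : ∀ x, (∃ i, R < |x i|) → f x = 0) : Continuous (perSum f) := by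
  rw [continuous_iff_continuousAt]
  intro x
  obtain ⟨N, hN⟩ := exists_nat_ge (R + (‖x‖ + 1))
  have h : perSum f =ᶠ[𝓝 x] fun y => ∑ m ∈ intCube d N, f fun i => y i + m i := by
    filter_upwards [Metric.ball_mem_nhds x one_pos] with y hy
    refine perSum_eq hf hN fun i => ?_
    have h1 : ‖y i‖ ≤ ‖y‖ := norm_le_pi_norm y i
    have h2 : ‖y‖ ≤ ‖x‖ + ‖y - x‖ := by simpa using norm_add_le x (y - x)
    rw [Metric.mem_ball, dist_eq_norm] at hy
    rw [← Real.norm_eq_abs]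
    linarith
  refine ContinuousAt.congr (Continuous.continuousAt ?_) h.symm
  exact continuous_finsetSum _ fun m _ => hc.comp (by fun_prop)

lemma perSum_add_int (f : (d → ℝ) → ℂ) (x : d → ℝ) (n : d → ℤ) :
    perSum f (fun i => x i + n i) = perSum f x := by
  rw [perSum, perSum, ← (Equiv.addLeft n).tsum_eq fun m : d → ℤ => f fun i => x i + m i]
  congr 1; funext m; congr 1; funext i
  simp; ring

lemma exists_torus_lift {P : (d → ℝ) → ℂ} (hP : Continuous P)
    (hper : ∀ x (n : d → ℤ), P (fun i => x i + n i) = P x) :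
    ∃ F : C(UnitAddTorus d, ℂ), ∀ x : d → ℝ, F (fun i => (x i : UnitAddCircle)) = P x := by
  have hq : IsOpenQuotientMap (Pi.map fun (_ : d) (x : ℝ) => (x : UnitAddCircle)) :=
    IsOpenQuotientMap.piMap fun _ => QuotientAddGroup.isOpenQuotientMap_mk
  set F : UnitAddTorus d → ℂ := fun y => P fun i => (AddCircle.equivIco 1 0 (y i) : ℝ) with hF
  have hFx : ∀ x : d → ℝ, F (fun i => (x i : UnitAddCircle)) = P x := by
    intro x
    have : ∀ i, ∃ n : ℤ, (AddCircle.equivIco 1 0 (x i : UnitAddCircle) : ℝ) = x i + n := by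
      intro i
      have h1 : ((AddCircle.equivIco 1 0 (x i : UnitAddCircle) : ℝ) : UnitAddCircle) = x i :=
        (AddCircle.equivIco 1 0).symm_apply_apply (x i : UnitAddCircle)
      rw [← sub_eq_zero, ← AddCircle.coe_sub, AddCircle.coe_eq_zero_iff] at h1
      obtain ⟨n, hn⟩ := h1
      refine ⟨n, ?_⟩
      rw [zsmul_one] at hn
      linarith
    choose n hn using this
    rw [hF]
    simp only [hn]
    exact hper x n
  refine ⟨⟨F, hq.isQuotientMap.continuous_iff.mpr ?_⟩, hFx⟩
  convert hP using 1
  funext x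
  exact hFx x

lemma mFourier_coe (n : d → ℤ) (x : d → ℝ) :
    mFourier n (fun i => (x i : UnitAddCircle)) = cexp (2 * Real.pi * I * ∑ i, n i * x i) := by
  simp only [mFourier, ContinuousMap.coe_mk, fourier_coe_apply, Complex.ofReal_one, div_one]
  rw [← Complex.exp_sum]
  congr 1
  push_cast
  rw [Finset.mul_sum]
  exact Finset.sum_congr rfl fun i _ => by ring

lemma integral_unitCube_sum {h : (d → ℝ) → ℂ} (hc : Continuous h) {R : ℝ} {N : ℕ}
    (hf : ∀ x, (∃ i, R < |x i|) → h x = 0) (hN : R + 1 ≤ N) :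
    ∫ x in {x : d → ℝ | ∀ i, x i ∈ Ioc (0 : ℝ) (0 + 1)},
      ∑ m ∈ intCube d N, h (fun i => x i + m i) = ∫ x, h x := by
  set B : (d → ℤ) → Set (d → ℝ) := fun m => {x | ∀ i, x i ∈ Ioc (m i : ℝ) (m i + 1)} with hB
  have hBpi : ∀ m, B m = Set.pi univ fun i => Ioc (m i : ℝ) (m i + 1) := fun m => by
    ext x; simp [hB]
  have hBm : ∀ m, MeasurableSet (B m) := fun m => by
    rw [hBpi]; exact MeasurableSet.univ_pi fun i => measurableSet_Ioc
  have hint : Integrable h := hc.integrable_of_hasCompactSupport <|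
    HasCompactSupport.of_support_subset_isCompact (isCompact_setOf_abs_le fun _ : d => R)
      fun x hx => by
        by_contra hn
        simp only [Set.mem_ofPred_eq, not_forall, not_le] at hn
        exact hx (hf x hn)
  have h1 : ∀ m : d → ℤ, ∫ x in {x : d → ℝ | ∀ i, x i ∈ Ioc (0 : ℝ) (0 + 1)},
      h (fun i => x i + m i) = ∫ x in B m, h x := by
    intro m
    have hmp := measurePreserving_add_right (volume : Measure (d → ℝ)) fun i => (m i : ℝ)
    have := hmp.setIntegral_preimage_emb (measurableEmbedding_addRight _) h (B m)
    rw [← this]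
    congr 2
    ext x
    simp [hB, add_comm _ (1 : ℝ)]
  have hBint : ∀ m : d → ℤ, Integrable (fun x : d → ℝ => h fun i => x i + m i) := fun m =>
    hint.comp_add_right (fun i => (m i : ℝ))
  rw [integral_finsetSum _ fun m _ => (hBint m).integrableOn]
  simp_rw [h1]
  rw [← integral_biUnion_finset _ (fun m _ => hBm m) ?_ fun m _ => hint.integrableOn,
    setIntegral_eq_integral_of_forall_compl_eq_zero]
  · intro x hx
    refine hf x ?_
    by_contra! hn
    refine hx (mem_biUnion (x := fun i => ⌈x i⌉ - 1) ?_ ?_)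
    · rw [Finset.mem_coe, mem_intCube]
      intro i
      have h2 := abs_le.mp (hn i)
      have h3 := Int.le_ceil (x i)
      have h4 := Int.ceil_lt_add_one (x i)
      have : |(((⌈x i⌉ - 1 : ℤ)) : ℝ)| ≤ N := by
        rw [abs_le]; push_cast; constructor <;> linarith
      exact_mod_cast this
    · simp only [hB, Set.mem_ofPred_eq, mem_Ioc]
      intro i
      have h3 := Int.le_ceil (x i)
      have h4 := Int.ceil_lt_add_one (x i)
      push_cast; constructor <;> linarith
  · intro m _ m' _ hne
    rw [Function.onFun, Set.disjoint_left]
    intro x h2 h3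
    refine hne (funext fun i => ?_)
    have h4 := h2 i
    have h5 := h3 i
    have h6 : (m i : ℝ) < m' i + 1 := h4.1.trans_le h5.2
    have h7 : (m' i : ℝ) < m i + 1 := h5.1.trans_le h4.2
    norm_cast at h6 h7
    omega

lemma poisson_enorm_le {f : (d → ℝ) → ℂ} (hc : Continuous f) {R : ℝ}
    (hf : ∀ x, (∃ i, R < |x i|) → f x = 0) :
    ‖(∑' m : d → ℤ, f fun i => m i) - ∫ x, f x‖ₑ ≤
      ∑' k : {k : d → ℤ // k ≠ 0},
        ‖∫ x : d → ℝ, cexp (2 * Real.pi * I * ∑ i, k.1 i * x i) * f x‖ₑ := by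
  obtain ⟨F, hF⟩ := exists_torus_lift (continuous_perSum hc hf) (perSum_add_int f)
  obtain ⟨N, hN⟩ := exists_nat_ge (R + 1)
  have hcoef : ∀ k : d → ℤ, mFourierCoeff F (-k) =
      ∫ x : d → ℝ, cexp (2 * Real.pi * I * ∑ i, k i * x i) * f x := by
    intro k
    have hcube : MeasurableSet {x : d → ℝ | ∀ i, x i ∈ Ioc (0 : ℝ) (0 + 1)} :=
      MeasurableSet.univ_pi' fun i => measurableSet_Ioc
    rw [mFourierCoeff_eq_integral _ _ 0, ← integral_unitCube_sum
      (h := fun x => cexp (2 * Real.pi * I * ∑ i, k i * x i) * f x) (by fun_prop)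
      (fun x hx => by rw [hf x hx, mul_zero]) hN]
    refine setIntegral_congr_fun hcube fun x hx => ?_
    simp only
    rw [hF, neg_neg, mFourier_coe, perSum_eq hf hN (C := 1), smul_eq_mul, Finset.mul_sum]
    · refine Finset.sum_congr rfl fun m _ => ?_
      congr 1
      have : 2 * Real.pi * I * ((∑ i, k i * (x i + m i) : ℝ) : ℂ) =
          2 * Real.pi * I * ((∑ i, k i * x i : ℝ) : ℂ) +
            (∑ i, k i * m i : ℤ) * (2 * Real.pi * I) := by
        push_cast
        simp_rw [mul_add]
        rw [Finset.sum_add_distrib]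
        ring
      rw [this, Complex.exp_add, Complex.exp_int_mul_two_pi_mul_I, mul_one]
    · intro i
      have := hx i
      rw [Pi.zero_apply, zero_add] at this
      rw [abs_of_pos this.1]; exact this.2
  have hP0 : perSum f 0 = ∑' m : d → ℤ, f fun i => m i := by
    simp [perSum]
  by_cases htop : ∑' k : {k : d → ℤ // k ≠ 0},
      ‖∫ x : d → ℝ, cexp (2 * Real.pi * I * ∑ i, k.1 i * x i) * f x‖ₑ = ⊤
  · rw [htop]; exact le_top
  simp_rw [← hcoef] at htop ⊢
  have hs1 : Summable fun k : {k : d → ℤ // k ≠ 0} => ‖mFourierCoeff F (-k.1)‖ := by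
    have := ENNReal.summable_toReal htop
    simpa using this
  have hs2 : Summable fun k : d → ℤ => mFourierCoeff F (-k) := by
    have h1 : Summable fun k : ({0}ᶜ : Set (d → ℤ)) => mFourierCoeff F (-k.1) := hs1.of_norm
    exact (Set.finite_singleton 0).summable_compl_iff.mp h1
  have hs3 : Summable (mFourierCoeff F) := (Equiv.neg (d → ℤ)).summable_iff.mp hs2
  have hsum := hasSum_mFourier_series_apply_of_summable hs3 fun _ => ((0 : ℝ) : UnitAddCircle)
  have hone : ∀ n : d → ℤ, mFourier n (fun _ => ((0 : ℝ) : UnitAddCircle)) = 1 := fun n => by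
    rw [mFourier_coe n (fun _ => 0)]; simp
  simp_rw [hone, smul_eq_mul, mul_one] at hsum
  rw [hF (fun _ => 0)] at hsum
  have h0 : perSum f (fun _ => 0) = perSum f 0 := rfl
  rw [h0, hP0] at hsum
  have hsum' := (Equiv.neg (d → ℤ)).hasSum_iff.mpr hsum
  have h1 := hs2.tsum_subtype_add_tsum_subtype_compl {0}
  rw [tsum_singleton (0 : d → ℤ) fun k => mFourierCoeff F (-k)] at h1
  have h2 := hcoef 0
  simp only [Pi.zero_apply, Int.cast_zero, zero_mul, Finset.sum_const_zero, Complex.ofReal_zero, mul_zero,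
    Complex.exp_zero, one_mul] at h2
  rw [h2, show ∑' k, mFourierCoeff F (-k) = _ from hsum'.tsum_eq] at h1
  rw [← h1, add_sub_cancel_left]
  exact enorm_tsum_le_tsum_enorm

end

section NFPoisson

open MeasureTheory Set NumberField.InfinitePlace NumberField.mixedEmbedding
open scoped Classical

/-- The trace pairing of an element of the field with a point of the mixed space. -/
def pair (β : K) (z : mixedSpace K) : ℝ :=
  ∑ w : {w : InfinitePlace K // IsReal w}, (mixedEmbedding K β).1 w * z.1 w +
    ∑ w : {w : InfinitePlace K // IsComplex w}, 2 * ((mixedEmbedding K β).2 w * z.2 w).re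

theorem pair_add (β : K) (z z' : mixedSpace K) : pair β (z + z') = pair β z + pair β z' := by
  simp only [pair, Prod.fst_add, Prod.snd_add, Pi.add_apply, mul_add, Finset.sum_add_distrib,
    Complex.add_re]
  ring

theorem pair_smul (β : K) (c : ℝ) (z : mixedSpace K) : pair β (c • z) = c * pair β z := by
  simp only [pair, Prod.smul_fst, Prod.smul_snd, Pi.smul_apply, smul_eq_mul, mul_add,
    Finset.mul_sum, Complex.real_smul]
  congr 1 <;> refine Finset.sum_congr rfl fun w _ => ?_
  · ring
  · rw [mul_left_comm, Complex.re_ofReal_mul]; ring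

/-- The trace pairing as a linear functional. -/
def pairHom (β : K) : mixedSpace K →ₗ[ℝ] ℝ where
  toFun := pair β
  map_add' := pair_add β
  map_smul' := pair_smul β

theorem sum_embeddings (f : (K →+* ℂ) → ℝ) (hf : ∀ φ, f (ComplexEmbedding.conjugate φ) = f φ) :
    ∑ φ, f φ = ∑ w : {w : InfinitePlace K // IsReal w}, f w.1.embedding +
      ∑ w : {w : InfinitePlace K // IsComplex w}, 2 * f w.1.embedding := by
  rw [← Equiv.sum_comp (mixedEmbedding.indexEquiv K) f, Fintype.sum_sum_type,
    Fintype.sum_prod_type]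
  congr 1
  refine Finset.sum_congr rfl fun w _ => ?_
  rw [Fin.sum_univ_two]
  simp only [mixedEmbedding.indexEquiv_apply_isComplex_fst,
    mixedEmbedding.indexEquiv_apply_isComplex_snd, hf]
  ring

theorem pair_mixedEmbedding (β α : K) :
    pair β (mixedEmbedding K α) = ((Algebra.trace ℚ K (β * α) : ℚ) : ℝ) := by
  have h := trace_eq_sum_embeddings ℂ (K := ℚ) (x := β * α)
  rw [← Equiv.sum_comp (RingHom.equivRatAlgHom K ℂ)] at h
  have h2 := congrArg Complex.re h
  rw [eq_ratCast, Complex.ratCast_re, Complex.re_sum] at h2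
  rw [h2, show (∑ i, ((RingHom.equivRatAlgHom K ℂ) i (β * α)).re) =
    ∑ φ : K →+* ℂ, (φ (β * α)).re from rfl,
    sum_embeddings (fun φ : K →+* ℂ => (φ (β * α)).re) (fun φ => by simp)]
  unfold pair
  congr 1 <;> refine Finset.sum_congr rfl fun w _ => ?_
  · rw [mixedEmbedding_apply_isReal, mixedEmbedding_apply_isReal]
    rw [← map_mul, ← embedding_of_isReal_apply w.2, Complex.ofReal_re]
  · rw [mixedEmbedding_apply_isComplex, mixedEmbedding_apply_isComplex, map_mul]

theorem integral_equivFun (I : (FractionalIdeal (nonZeroDivisors (𝓞 K)) K)ˣ)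
    (f : mixedSpace K → ℂ) :
    ∫ x, f ((fractionalIdealLatticeBasis K I).equivFunL.symm x) =
      (ZLattice.covolume (mixedEmbedding.idealLattice K I))⁻¹ • ∫ z, f z := by
  set b := fractionalIdealLatticeBasis K I
  set e := b.equivFunL
  set c := ZLattice.covolume (mixedEmbedding.idealLattice K I) with hc
  have hcpos : 0 < c := ZLattice.covolume_pos _ volume
  have hFD := fundamentalDomain_idealLattice K I
  have hcd : c = (volume (ZSpan.fundamentalDomain b)).toReal :=
    ZLattice.covolume_eq_measure_fundamentalDomain _ _ hFD
  set μ' : Measure (mixedSpace K) := Measure.map e.symm volume with hμ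
  have : μ'.IsAddHaarMeasure := e.symm.isAddHaarMeasure_map volume
  have h1 : μ' = μ'.addHaarScalarFactor volume • volume :=
    Measure.isAddLeftInvariant_eq_smul μ' volume
  have hmeas : MeasurableEmbedding e.symm := e.symm.toHomeomorph.measurableEmbedding
  have h2 : μ' (ZSpan.fundamentalDomain b) = 1 := by
    rw [hμ, hmeas.map_apply]
    have : e.symm ⁻¹' (ZSpan.fundamentalDomain b) =
        Set.pi Set.univ fun _ => Set.Ico (0 : ℝ) 1 := by
      ext x
      simp only [Set.mem_preimage, ZSpan.mem_fundamentalDomain, Set.mem_univ_pi]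
      refine forall_congr' fun i => ?_
      have hx : b.repr (e.symm x) i = x i := by
        have := congrFun (e.apply_symm_apply x) i
        exact this
      rw [hx]
    rw [this, volume_pi_pi]
    simp
  have h3 : (μ'.addHaarScalarFactor volume : ℝ) = c⁻¹ := by
    have h4 := congrArg (fun m => (m (ZSpan.fundamentalDomain b)).toReal) h1
    simp only [h2, Measure.smul_apply, ENNReal.toReal_one] at h4
    rw [ENNReal.smul_def, smul_eq_mul, ENNReal.toReal_mul, ← hcd] at h4
    exact eq_inv_of_mul_eq_one_left h4.symm
  rw [← h3, ← hmeas.integral_map, ← hμ]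
  conv_lhs => rw [h1]
  rw [integral_smul_nnreal_measure]
  rfl

theorem equivFunL_symm_int (I : (FractionalIdeal (nonZeroDivisors (𝓞 K)) K)ˣ)
    (m : Module.Free.ChooseBasisIndex ℤ I → ℤ) :
    (fractionalIdealLatticeBasis K I).equivFunL.symm (fun i => (m i : ℝ)) =
      mixedEmbedding K ((fractionalIdealBasis K (I : FractionalIdeal _ K)).equivFun.symm m : K) := by
  refine ((fractionalIdealLatticeBasis K I).equivFun_symm_apply _).trans ?_
  rw [Module.Basis.equivFun_symm_apply]
  simp only [AddSubmonoidClass.coe_finsetSum, map_sum]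
  refine Finset.sum_congr rfl fun i _ => ?_
  rw [fractionalIdealLatticeBasis_apply, basisOfFractionalIdeal_apply, Submodule.coe_smul_of_tower,
    map_zsmul, Int.cast_smul_eq_zsmul]

theorem poisson_ideal (I : (FractionalIdeal (nonZeroDivisors (𝓞 K)) K)ˣ) (ρ : mixedSpace K)
    {F : mixedSpace K → ℂ} (hc : Continuous F) (hs : HasCompactSupport F) :
    ‖(∑' α : (I : FractionalIdeal (nonZeroDivisors (𝓞 K)) K), F (ρ + mixedEmbedding K (α : K))) -
        (ZLattice.covolume (mixedEmbedding.idealLattice K I))⁻¹ • ∫ z, F z‖ₑ ≤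
      ENNReal.ofReal (ZLattice.covolume (mixedEmbedding.idealLattice K I))⁻¹ *
      ∑' β : {β : K // β ≠ 0 ∧ β ∈ FractionalIdeal.dual ℤ ℚ
          (I : FractionalIdeal (nonZeroDivisors (𝓞 K)) K)},
        ‖∫ z, cexp (2 * Real.pi * Complex.I * pair β.1 z) * F z‖ₑ := by
  set b := fractionalIdealLatticeBasis K I with hb
  set e := b.equivFunL with he
  set c := ZLattice.covolume (mixedEmbedding.idealLattice K I) with hcdef
  have hcpos : 0 < c := ZLattice.covolume_pos _ volume
  have hsum : (∑' α : (I : FractionalIdeal (nonZeroDivisors (𝓞 K)) K),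
      F (ρ + mixedEmbedding K (α : K))) =
      ∑' m : Module.Free.ChooseBasisIndex ℤ I → ℤ, F (ρ + e.symm fun i => (m i : ℝ)) := by
    refine (Equiv.tsum_eq (fractionalIdealBasis K
      (I : FractionalIdeal (nonZeroDivisors (𝓞 K)) K)).equivFun.symm.toEquiv
      (fun α => F (ρ + mixedEmbedding K (α : K)))).symm.trans ?_
    refine tsum_congr fun m => ?_
    rw [equivFunL_symm_int]
    rfl
  have hint : ∫ x, F (ρ + e.symm x) = c⁻¹ • ∫ z, F z := by
    rw [integral_equivFun I (fun z => F (ρ + z)), integral_add_left_eq_self]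
  have hcs : HasCompactSupport fun x => F (ρ + e.symm x) :=
    hs.comp_homeomorph (e.symm.toHomeomorph.trans (Homeomorph.addLeft ρ))
  obtain ⟨R, hR⟩ := hcs.isCompact.isBounded.exists_norm_le
  have hP := poisson_enorm_le (f := fun x => F (ρ + e.symm x))
    (hc.comp (continuous_const.add e.symm.continuous)) (R := R) (fun x ⟨i, hi⟩ => by
      by_contra h
      have h1 := hR x (subset_tsupport _ h)
      have h2 := norm_le_pi_norm x i
      rw [Real.norm_eq_abs] at h2
      linarith)
  rw [hint] at hP
  rw [hsum]
  refine hP.trans ?_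
  set B := basisOfFractionalIdeal K I with hB
  set D := (Algebra.traceForm ℚ K).dualBasis (traceForm_nondegenerate ℚ K) B with hD
  set bk : (Module.Free.ChooseBasisIndex ℤ I → ℤ) → K := fun k => ∑ i, (k i : ℚ) • D i with hbk
  have htr : ∀ k j, Algebra.trace ℚ K (bk k * B j) = k j := by
    intro k j
    have h1 : Algebra.traceForm ℚ K (bk k) (B j) = k j := by
      simp only [hbk, map_sum, map_smul, LinearMap.sum_apply, LinearMap.smul_apply, hD,
        LinearMap.BilinForm.apply_dualBasis_left]
      simp
    exact h1
  have hpair : ∀ k x, pair (bk k) (e.symm x) = ∑ i, k i * x i := by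
    intro k x
    have h1 : e.symm x = ∑ i, x i • b i := b.equivFun_symm_apply x
    rw [h1]
    have h2 := map_sum (pairHom (bk k)) (fun i => x i • b i) Finset.univ
    refine h2.trans (Finset.sum_congr rfl fun i _ => ?_)
    rw [map_smul, smul_eq_mul, mul_comm]
    congr 1
    rw [hb, fractionalIdealLatticeBasis_apply]
    refine (pair_mixedEmbedding _ _).trans ?_
    rw [htr]
    simp
  have hmem : ∀ k, bk k ∈ FractionalIdeal.dual ℤ ℚ
      (I : FractionalIdeal (nonZeroDivisors (𝓞 K)) K) := by
    intro k
    rw [FractionalIdeal.mem_dual I.ne_zero]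
    intro a ha
    have ha' := (mem_span_basisOfFractionalIdeal K (I := I)).mpr ha
    have : ∃ m : ℤ, Algebra.trace ℚ K (bk k * a) = m := by
      induction ha' using Submodule.span_induction with
      | mem x hx =>
        obtain ⟨j, rfl⟩ := hx
        exact ⟨k j, htr k j⟩
      | zero => exact ⟨0, by simp⟩
      | add x y hx1 hy1 hx hy =>
        obtain ⟨p, hp⟩ := hx ((mem_span_basisOfFractionalIdeal K).mp hx1)
        obtain ⟨q, hq⟩ := hy ((mem_span_basisOfFractionalIdeal K).mp hy1)
        exact ⟨p + q, by rw [mul_add, map_add, hp, hq]; push_cast; rfl⟩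
      | smul n x hx1 hx =>
        obtain ⟨p, hp⟩ := hx ((mem_span_basisOfFractionalIdeal K).mp hx1)
        exact ⟨n * p, by rw [mul_smul_comm, map_zsmul, hp]; simp⟩
    obtain ⟨m, hm⟩ := this
    exact ⟨m, by simp [Algebra.traceForm_apply, hm]⟩
  have hinj : Function.Injective bk := by
    intro k k' h
    funext j
    have := (htr k j).symm.trans ((congrArg (fun z => Algebra.trace ℚ K (z * B j)) h).trans
      (htr k' j))
    exact_mod_cast this
  have h0 : bk 0 = 0 := by simp [hbk]
  let φ : {k : Module.Free.ChooseBasisIndex ℤ I → ℤ // k ≠ 0} → {β : K // β ≠ 0 ∧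
      β ∈ FractionalIdeal.dual ℤ ℚ (I : FractionalIdeal (nonZeroDivisors (𝓞 K)) K)} :=
    fun k => ⟨bk k.1, fun h => k.2 (hinj (h.trans h0.symm)), hmem k.1⟩
  have hφ : Function.Injective φ := fun k k' h => Subtype.ext (hinj (congrArg Subtype.val h))
  rw [← ENNReal.tsum_mul_left]
  refine le_trans (le_of_eq ?_) (ENNReal.tsum_comp_le_tsum_of_injective hφ _)
  refine tsum_congr fun k => ?_
  have h1 : ∀ x, cexp (2 * Real.pi * Complex.I * (∑ i, k.1 i * x i : ℝ)) * F (ρ + e.symm x) =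
      (fun z => cexp (-(2 * Real.pi * Complex.I * pair (bk k.1) ρ)) *
        (cexp (2 * Real.pi * Complex.I * pair (bk k.1) z) * F z)) (ρ + e.symm x) := by
    intro x
    simp only
    rw [← mul_assoc, ← Complex.exp_add, pair_add, hpair]
    congr 2
    push_cast
    ring
  have h2 := integral_equivFun I (fun z => (fun z => cexp (-(2 * Real.pi * Complex.I *
    pair (bk k.1) ρ)) * (cexp (2 * Real.pi * Complex.I * pair (bk k.1) z) * F z)) (ρ + z))
  rw [integral_add_left_eq_self (fun z => cexp (-(2 * Real.pi * Complex.I *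
    pair (bk k.1) ρ)) * (cexp (2 * Real.pi * Complex.I * pair (bk k.1) z) * F z))] at h2
  rw [integral_congr_ae (Eventually.of_forall h1)]
  refine (congrArg (‖·‖ₑ) h2).trans ?_
  rw [integral_const_mul, enorm_smul, enorm_mul]
  rw [show ‖cexp (-(2 * Real.pi * Complex.I * pair (bk k.1) ρ))‖ₑ = 1 by
    rw [← ofReal_norm, show -(2 * Real.pi * Complex.I * pair (bk k.1) ρ) =
      ((-(2 * Real.pi * pair (bk k.1) ρ) : ℝ) : ℂ) * Complex.I by push_cast; ring,
      Complex.norm_exp_ofReal_mul_I, ENNReal.ofReal_one], one_mul,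
    Real.enorm_eq_ofReal (inv_nonneg.mpr hcpos.le)]

end NFPoisson

section Unfolding

open MeasureTheory Set NumberField.Units NumberField.Units.dirichletUnitTheorem
open scoped Classical ENNReal

variable (K) in
/-- A fundamental domain for the action of the units on logarithmic space. -/
def unitFD : Set (logSpace K) :=
  ZSpan.fundamentalDomain ((basisUnitLattice K).ofZLatticeBasis ℝ (unitLattice K))

variable (K) in
theorem isAddFundamentalDomain_unitFD :
    IsAddFundamentalDomain (unitLattice K) (unitFD K) (volume : Measure (logSpace K)) :=
  ZLattice.isAddFundamentalDomain _ _

variable (K) in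
theorem volume_unitFD : volume (unitFD K) = ENNReal.ofReal (regulator K) := by
  rw [regulator, ZLattice.covolume_eq_measure_fundamentalDomain _ _
    (isAddFundamentalDomain_unitFD K), Measure.real, ENNReal.ofReal_toReal]
  exact (ZSpan.fundamentalDomain_isBounded _).measure_lt_top.ne

/-- The logarithmic embedding of a unit. -/
def unitLog (u : (𝓞 K)ˣ) : logSpace K := logEmbedding K (Additive.ofMul u)

theorem tsum_units (h : logSpace K → ℝ≥0∞) :
    ∑' u : (𝓞 K)ˣ, h (unitLog u) = torsionOrder K * ∑' l : unitLattice K, h l := by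
  let ψ : ((𝓞 K)ˣ ⧸ torsion K) × torsion K ≃ (𝓞 K)ˣ :=
    Equiv.ofBijective (fun p => p.1.out * p.2) ⟨fun p p' h => by
      have h1 := congrArg (QuotientGroup.mk (s := torsion K)) h
      simp only [QuotientGroup.mk_mul_of_mem _ (SetLike.coe_mem _), QuotientGroup.out_eq'] at h1
      simp only [h1, mul_right_inj, SetLike.coe_eq_coe] at h
      exact Prod.ext h1 h, fun u => ⟨(QuotientGroup.mk u, ⟨(QuotientGroup.mk u : (𝓞 K)ˣ ⧸ torsion K).out⁻¹ * u, by
        rw [← QuotientGroup.eq, QuotientGroup.out_eq']⟩), by simp⟩⟩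
  rw [← Equiv.tsum_eq ψ]
  refine (ENNReal.tsum_prod (f := fun q t => h (unitLog (ψ (q, t))))).trans ?_
  have h1 : ∀ (q : (𝓞 K)ˣ ⧸ torsion K) (t : torsion K),
      h (unitLog (ψ (q, t))) = h (logEmbeddingEquiv K (Additive.ofMul q)) := by
    intro q t
    congr 1
    have h2 : (QuotientGroup.mk (ψ (q, t)) : (𝓞 K)ˣ ⧸ torsion K) = q := by
      change (QuotientGroup.mk (q.out * (t : (𝓞 K)ˣ)) : (𝓞 K)ˣ ⧸ torsion K) = q
      rw [QuotientGroup.mk_mul_of_mem _ t.2, QuotientGroup.out_eq']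
    conv_rhs => rw [← h2]
    rfl
  simp_rw [h1]
  simp only [ENNReal.tsum_const]
  rw [ENNReal.tsum_mul_left]
  congr 1
  · have hf : Finite (torsion K) := Nat.finite_of_card_ne_zero (torsionOrder_ne_zero K)
    rw [torsionOrder, ENat.card_eq_coe_natCard, ENat.toENNReal_coe]
  · exact Equiv.tsum_eq (Additive.ofMul.trans (logEmbeddingEquiv K).toEquiv) (fun l => h l)

theorem lintegral_units (h : logSpace K → ℝ≥0∞) :
    ∑' u : (𝓞 K)ˣ, ∫⁻ l in unitFD K, h (l + unitLog u) = torsionOrder K * ∫⁻ l, h l := by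
  have : VAddInvariantMeasure (unitLattice K) (logSpace K) volume :=
    ⟨fun c s _ => measure_preimage_add volume (c : logSpace K) s⟩
  rw [tsum_units (fun m => ∫⁻ l in unitFD K, h (l + m)),
    (isAddFundamentalDomain_unitFD K).lintegral_eq_tsum'']
  congr 1
  refine tsum_congr fun l => lintegral_congr fun m => ?_
  rw [add_comm]
  rfl

variable {X Y : Type*} {N : X → Y} {act : (𝓞 K)ˣ → X → X}

theorem unfold_fiber (hN : ∀ u x, N (act u x) = N x)
    (htrans : ∀ x x', N x = N x' → ∃ u, act u x = x')
    (hfree : ∀ u v x, act u x = act v x → u = v)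
    {f : X → logSpace K → ℝ≥0∞} (hf : ∀ u x l, f (act u x) l = f x (l + unitLog u)) (x₀ : X) :
    ∑' x : {x // N x = N x₀}, ∫⁻ l in unitFD K, f x.1 l = torsionOrder K * ∫⁻ l, f x₀ l := by
  let φ : (𝓞 K)ˣ ≃ {x // N x = N x₀} := Equiv.ofBijective (fun u => ⟨act u x₀, hN u x₀⟩)
    ⟨fun u v h => hfree u v x₀ (congrArg Subtype.val h), fun x => by
      obtain ⟨u, hu⟩ := htrans x₀ x.1 x.2.symm
      exact ⟨u, Subtype.ext hu⟩⟩
  rw [← Equiv.tsum_eq φ, ← lintegral_units]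
  exact tsum_congr fun u => lintegral_congr fun l => hf u x₀ l

theorem unfold_le (hN : ∀ u x, N (act u x) = N x)
    (htrans : ∀ x x', N x = N x' → ∃ u, act u x = x')
    (hfree : ∀ u v x, act u x = act v x → u = v)
    {f : X → logSpace K → ℝ≥0∞} (hf : ∀ u x l, f (act u x) l = f x (l + unitLog u))
    {B : Y → ℝ≥0∞} (hB : ∀ x, ∫⁻ l, f x l ≤ B (N x)) :
    ∑' x, ∫⁻ l in unitFD K, f x l ≤ torsionOrder K * ∑' y, B y := by
  rw [← Equiv.tsum_eq (Equiv.sigmaFiberEquiv N), ENNReal.tsum_sigma', ← ENNReal.tsum_mul_left]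
  refine ENNReal.tsum_le_tsum fun y => ?_
  by_cases hy : ∃ x, N x = y
  · obtain ⟨x, rfl⟩ := hy
    refine (unfold_fiber hN htrans hfree hf x).le.trans ?_
    gcongr
    exact hB x
  · have : IsEmpty {x // N x = y} := ⟨fun x => hy ⟨x.1, x.2⟩⟩
    simp

/-- Unfolding a weighted sum over ideals to an integral over the fundamental domain. -/
theorem unfold_integral [Countable X] (hN : ∀ u x, N (act u x) = N x)
    (htrans : ∀ x x', N x = N x' → ∃ u, act u x = x')
    (hfree : ∀ u v x, act u x = act v x → u = v) (hsurj : Function.Surjective N)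
    {f : X → logSpace K → ℝ} (hf0 : ∀ x l, 0 ≤ f x l) (hfm : ∀ x, Measurable (f x))
    (hf : ∀ u x l, f (act u x) l = f x (l + unitLog u))
    {B : Y → ℝ} (hB : ∀ x, ∫⁻ l, ENNReal.ofReal (f x l) = ENNReal.ofReal (B (N x)))
    (hB0 : ∀ y, 0 ≤ B y) {g : Y → ℂ} (hg : Summable fun y => ‖g y‖ * B y) :
    Integrable (fun l => ∑' x, g (N x) * f x l) (volume.restrict (unitFD K)) ∧
    ∫ l in unitFD K, ∑' x, g (N x) * f x l = torsionOrder K * ∑' y, g y * B y := by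
  set μ := (volume : Measure (logSpace K)).restrict (unitFD K) with hμ
  set w : ℝ := ((torsionOrder K : ℕ) : ℝ) with hw
  have hw0 : 0 ≤ w := Nat.cast_nonneg _
  have hfib : ∀ y, ∑' x : {x // N x = y}, ∫⁻ l, ENNReal.ofReal (f x.1 l) ∂μ =
      ENNReal.ofReal (w * B y) := by
    intro y
    obtain ⟨x, rfl⟩ := hsurj y
    rw [unfold_fiber (f := fun x l => ENNReal.ofReal (f x l)) hN htrans hfree
      (fun u x l => by rw [hf]), hB, ENNReal.ofReal_mul hw0, hw, ENNReal.ofReal_natCast]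
  have hen : ∀ x l, ‖g (N x) * f x l‖ₑ = ‖g (N x)‖ₑ * ENNReal.ofReal (f x l) := by
    intro x l
    rw [enorm_mul, ← ofReal_norm (f x l : ℂ), Complex.norm_real, Real.norm_of_nonneg (hf0 x l)]
  have htot : ∑' x, ∫⁻ l, ‖g (N x) * f x l‖ₑ ∂μ ≠ ⊤ := by
    simp_rw [hen]
    have h1 : ∀ x, ∫⁻ l, ‖g (N x)‖ₑ * ENNReal.ofReal (f x l) ∂μ =
        ‖g (N x)‖ₑ * ∫⁻ l, ENNReal.ofReal (f x l) ∂μ := fun x =>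
      lintegral_const_mul _ (hfm x).ennreal_ofReal
    simp_rw [h1]
    rw [← Equiv.tsum_eq (Equiv.sigmaFiberEquiv N), ENNReal.tsum_sigma']
    have h2 : ∀ y, ∑' x : {x // N x = y}, ‖g (N (Equiv.sigmaFiberEquiv N ⟨y, x⟩))‖ₑ *
        ∫⁻ l, ENNReal.ofReal (f (Equiv.sigmaFiberEquiv N ⟨y, x⟩) l) ∂μ =
        ENNReal.ofReal (w * (‖g y‖ * B y)) := by
      intro y
      rw [show w * (‖g y‖ * B y) = ‖g y‖ * (w * B y) by ring, ENNReal.ofReal_mul (norm_nonneg _),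
        ofReal_norm, ← hfib y, ← ENNReal.tsum_mul_left]
      refine tsum_congr fun x => ?_
      simp only [Equiv.sigmaFiberEquiv_apply, x.2]
    simp_rw [h2]
    rw [← ENNReal.ofReal_tsum_of_nonneg (fun y => by have := hB0 y; positivity) (hg.mul_left w)]
    exact ENNReal.ofReal_ne_top
  have hmeas : ∀ x, AEStronglyMeasurable (fun l => g (N x) * (f x l : ℂ)) μ := fun x =>
    (measurable_const.mul (Complex.measurable_ofReal.comp (hfm x))).aestronglyMeasurable
  have hint : ∀ x, Integrable (fun l => g (N x) * (f x l : ℂ)) μ := fun x =>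
    ⟨hmeas x, (ENNReal.ne_top_of_tsum_ne_top htot x).lt_top⟩
  have hae : ∀ᵐ l ∂μ, Summable fun x => g (N x) * (f x l : ℂ) := by
    rw [← lintegral_tsum fun x => (hmeas x).enorm] at htot
    filter_upwards [ae_lt_top' (AEMeasurable.tsum fun x => (hmeas x).enorm) htot] with l hl
    exact (tsum_enorm_ne_top_iff_summable_norm.1 hl.ne).of_norm
  have hsm : Summable fun x => ∫ l, g (N x) * (f x l : ℂ) ∂μ := by
    refine Summable.of_norm (tsum_enorm_ne_top_iff_summable_norm.1 (ne_top_of_le_ne_top htot ?_))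
    exact ENNReal.tsum_le_tsum fun x => enorm_integral_le_lintegral_enorm _
  constructor
  · refine ⟨aestronglyMeasurable_of_tendsto_ae (atTop : Filter (Finset X))
      (f := fun s l => ∑ x ∈ s, g (N x) * (f x l : ℂ)) (fun s => ?_) ?_, ?_⟩
    · exact Finset.aestronglyMeasurable_fun_sum s fun x _ => hmeas x
    · filter_upwards [hae] with l hl using hl.hasSum
    · refine lt_of_le_of_lt (lintegral_mono fun l => enorm_tsum_le_tsum_enorm) ?_
      rw [lintegral_tsum fun x => (hmeas x).enorm]
      exact htot.lt_top
  · rw [integral_tsum hmeas htot, ← Equiv.tsum_eq (Equiv.sigmaFiberEquiv N)]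
    refine (Summable.tsum_sigma
      ((Equiv.summable_iff (Equiv.sigmaFiberEquiv N)).mpr hsm)).trans ?_
    rw [← tsum_mul_left]
    refine tsum_congr fun y => ?_
    have h1 : ∀ x : {x // N x = y}, ∫ l, g (N (Equiv.sigmaFiberEquiv N ⟨y, x⟩)) *
        (f (Equiv.sigmaFiberEquiv N ⟨y, x⟩) l : ℂ) ∂μ =
        g y * (((∫⁻ l, ENNReal.ofReal (f x.1 l) ∂μ).toReal : ℝ) : ℂ) := by
      intro x
      simp only [Equiv.sigmaFiberEquiv_apply, x.2]
      rw [integral_const_mul, ← integral_eq_lintegral_of_nonneg_ae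
        (Eventually.of_forall (hf0 x.1)) (hfm x.1).aestronglyMeasurable]
      congr 1
      exact integral_ofReal
    have h2 : ∀ x : {x // N x = y}, ∫⁻ l, ENNReal.ofReal (f x.1 l) ∂μ ≠ ⊤ := fun x =>
      ENNReal.ne_top_of_tsum_ne_top (by rw [hfib y]; exact ENNReal.ofReal_ne_top) x
    refine (tsum_congr h1).trans ?_
    rw [tsum_mul_left, ← Complex.ofReal_tsum, ← ENNReal.tsum_toReal_eq h2, hfib,
      ENNReal.toReal_ofReal (mul_nonneg hw0 (hB0 y))]
    rw [hw]
    push_cast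
    ring

end Unfolding

section LocalProduct

open MeasureTheory Set NumberField.InfinitePlace NumberField.mixedEmbedding NumberField.Units
  NumberField.Units.dirichletUnitTheorem
open scoped Classical

theorem avg_one {a : ℝ} (ha : 0 < a) (c : ℂ) : avg a (fun _ => c) = fun _ => c := by
  funext v
  have h : (2 * a)⁻¹ * (a + a) = 1 := by field_simp; ring
  rw [avg, intervalIntegral.integral_const, sub_neg_eq_add, smul_smul, h, one_smul]

theorem iterate_avg_const {a : ℝ} (ha : 0 < a) (c : ℂ) (k : ℕ) :
    (avg a)^[k] (fun _ => c) = fun _ => c :=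
  Function.iterate_fixed (avg_one ha c) k

theorem ftR_zero {a : ℝ} (ha : 0 < a) : ftR a 0 = 1 := by
  rw [ftR_eq ha]
  simp [iterate_avg_const ha]

theorem ftC_zero {a : ℝ} (ha : 0 < a) : ftC a 0 = Real.pi := by
  have h : angAvg 0 (0 : ℂ).arg = fun _ => ((2 * Real.pi : ℝ) : ℂ) := by
    funext w
    simp only [angAvg, zero_mul, Complex.ofReal_zero, mul_zero, Complex.exp_zero,
      intervalIntegral.integral_const, sub_neg_eq_add, Complex.real_smul, mul_one, two_mul]
  rw [ftC_eq ha, norm_zero, mul_zero, h, iterate_avg_const ha]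
  push_cast
  ring

/-- The sign of a unit of `ℤ`, as a real number. -/
def sg (s : ℤˣ) : ℝ := ((s : ℤ) : ℝ)

theorem abs_sg (s : ℤˣ) : |sg s| = 1 := by
  rcases Int.units_eq_one_or s with rfl | rfl <;> simp [sg]

theorem sg_ne_zero (s : ℤˣ) : sg s ≠ 0 := fun h => by simpa [h] using abs_sg s

theorem integral_char_locR (a b : ℝ) {c : ℝ} (hc : c ≠ 0) :
    ∫ t : ℝ, cexp (2 * Real.pi * I * ((b * t : ℝ) : ℂ)) * (locR a (c * t) : ℂ) =
      ((|c|⁻¹ : ℝ) : ℂ) * ftR a (-(b / c)) := by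
  have h := Measure.integral_comp_mul_left
    (fun s : ℝ => locR a s • cexp (I * (-(2 * Real.pi) * (-(b / c) * s) : ℝ))) c
  rw [ftR, ← Complex.real_smul, ← abs_inv, ← h]
  congr 1; funext t
  rw [Complex.real_smul, mul_comm]
  congr 2
  have : b * t = b / c * (c * t) := by field_simp
  rw [this]
  push_cast
  ring

theorem integral_char_locC (a : ℝ) (b : ℂ) {y : ℝ} (hy : 0 < y) :
    ∫ z : ℂ, cexp (2 * Real.pi * I * ((2 * (b * z).re : ℝ) : ℂ)) * (locC a (y * z) : ℂ) =
      ((y⁻¹ ^ 2 : ℝ) : ℂ) * ftC a (-(b / y)) := by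
  have h := Measure.integral_comp_smul_of_nonneg (volume : Measure ℂ)
    (fun s : ℂ => locC a s • cexp (I * (-(2 * Real.pi) * (2 * (-(b / y) * s).re) : ℝ))) y
    (hR := hy.le)
  rw [Complex.finrank_real_complex] at h
  rw [ftC, ← Complex.real_smul, inv_pow, ← h]
  congr 1; funext t
  have hy' : (y : ℂ) ≠ 0 := by exact_mod_cast hy.ne'
  rw [Complex.real_smul, Complex.real_smul, mul_comm]
  congr 2
  have : b * t = -(-(b / y) * (y * t)) := by field_simp
  rw [this, Complex.neg_re]
  push_cast
  ring

/-- The product of the local test functions. -/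
def locProd (a : ℝ) (σ : {w : InfinitePlace K // IsReal w} → ℤˣ) (y : InfinitePlace K → ℝ)
    (z : mixedSpace K) : ℝ :=
  (∏ w : {w : InfinitePlace K // IsReal w}, locR a (sg (σ w) * y w.1 * z.1 w)) *
    ∏ w : {w : InfinitePlace K // IsComplex w}, locC a (y w.1 * z.2 w)

theorem continuous_locProd {a : ℝ} (ha : 0 < a) (σ : {w : InfinitePlace K // IsReal w} → ℤˣ)
    (y : InfinitePlace K → ℝ) : Continuous (locProd a σ y) := by
  have h1 := continuous_locR ha
  have h2 := continuous_locC ha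
  unfold locProd
  fun_prop

theorem hasCompactSupport_locProd {a : ℝ} (ha : 0 < a)
    (σ : {w : InfinitePlace K // IsReal w} → ℤˣ)
    {y : InfinitePlace K → ℝ} (hy : ∀ w, 0 < y w) : HasCompactSupport (locProd a σ y) := by
  refine HasCompactSupport.intro (K :=
    (Set.pi univ fun w : {w : InfinitePlace K // IsReal w} =>
      Metric.closedBall 0 ((y w.1)⁻¹ * Real.exp (2 * a))) ×ˢ
    (Set.pi univ fun w : {w : InfinitePlace K // IsComplex w} =>
      Metric.closedBall 0 ((y w.1)⁻¹ * Real.exp (2 * a))))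
    ((isCompact_univ_pi fun w => isCompact_closedBall _ _).prod
      (isCompact_univ_pi fun w => isCompact_closedBall _ _)) fun z hz => ?_
  rw [mem_prod, not_and_or] at hz
  simp only [mem_univ_pi, mem_closedBall_zero_iff, not_forall, not_le] at hz
  rcases hz with ⟨w, hw⟩ | ⟨w, hw⟩
  · rw [locProd, Finset.prod_eq_zero (Finset.mem_univ w), zero_mul]
    refine locR_eq_zero ha ?_
    rw [inv_mul_lt_iff₀ (hy w.1)] at hw
    rwa [norm_mul, norm_mul, Real.norm_eq_abs (sg _), abs_sg, one_mul,
      Real.norm_of_nonneg (hy w.1).le]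
  · rw [inv_mul_lt_iff₀ (hy w.1)] at hw
    have h0 : locC a (y w.1 * z.2 w) = 0 := locC_eq_zero ha (by
      rwa [norm_mul, Complex.norm_real, Real.norm_of_nonneg (hy w.1).le])
    rw [locProd, Finset.prod_eq_zero (Finset.mem_univ w) h0, mul_zero]

theorem integral_pair_locProd (a : ℝ) (σ : {w : InfinitePlace K // IsReal w} → ℤˣ)
    {y : InfinitePlace K → ℝ} (hy : ∀ w, 0 < y w) (β : K) :
    ∫ z, cexp (2 * Real.pi * I * pair β z) * (locProd a σ y z : ℂ) =
      (∏ w : {w : InfinitePlace K // IsReal w}, (((y w.1)⁻¹ : ℝ) : ℂ) *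
        ftR a (-((mixedEmbedding K β).1 w / (sg (σ w) * y w.1)))) *
      ∏ w : {w : InfinitePlace K // IsComplex w}, (((y w.1)⁻¹ ^ 2 : ℝ) : ℂ) *
        ftC a (-((mixedEmbedding K β).2 w / y w.1)) := by
  have h1 : ∀ z : mixedSpace K, cexp (2 * Real.pi * I * pair β z) * (locProd a σ y z : ℂ) =
      (∏ w : {w : InfinitePlace K // IsReal w},
        cexp (2 * Real.pi * I * (((mixedEmbedding K β).1 w * z.1 w : ℝ) : ℂ)) *
          (locR a (sg (σ w) * y w.1 * z.1 w) : ℂ)) *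
      ∏ w : {w : InfinitePlace K // IsComplex w},
        cexp (2 * Real.pi * I * ((2 * ((mixedEmbedding K β).2 w * z.2 w).re : ℝ) : ℂ)) *
          (locC a (y w.1 * z.2 w) : ℂ) := by
    intro z
    rw [Finset.prod_mul_distrib, Finset.prod_mul_distrib, ← Complex.exp_sum, ← Complex.exp_sum,
      mul_mul_mul_comm, ← Complex.exp_add, ← Finset.mul_sum, ← Finset.mul_sum, ← mul_add, pair,
      locProd]
    push_cast
    rfl
  simp_rw [h1]
  rw [Measure.volume_eq_prod]
  refine (integral_prod_mul (fun z : {w : InfinitePlace K // IsReal w} → ℝ =>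
    ∏ w : {w : InfinitePlace K // IsReal w},
        cexp (2 * Real.pi * I * (((mixedEmbedding K β).1 w * z w : ℝ) : ℂ)) *
          (locR a (sg (σ w) * y w.1 * z w) : ℂ)) (fun z : {w : InfinitePlace K // IsComplex w} → ℂ =>
      ∏ w : {w : InfinitePlace K // IsComplex w},
        cexp (2 * Real.pi * I * ((2 * ((mixedEmbedding K β).2 w * z w).re : ℝ) : ℂ)) *
          (locC a (y w.1 * z w) : ℂ))).trans ?_
  congr 1
  · refine (integral_fintype_prod_volume_eq_prod
      fun (w : {w : InfinitePlace K // IsReal w}) (t : ℝ) =>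
        cexp (2 * Real.pi * I * (((mixedEmbedding K β).1 w * t : ℝ) : ℂ)) *
          (locR a (sg (σ w) * y w.1 * t) : ℂ)).trans ?_
    refine Finset.prod_congr rfl fun w _ => ?_
    rw [integral_char_locR _ _ (mul_ne_zero (sg_ne_zero _) (hy w.1).ne'), abs_mul, abs_sg, one_mul,
      abs_of_pos (hy w.1)]
  · refine (integral_fintype_prod_volume_eq_prod
      fun (w : {w : InfinitePlace K // IsComplex w}) (t : ℂ) =>
        cexp (2 * Real.pi * I * ((2 * ((mixedEmbedding K β).2 w * t).re : ℝ) : ℂ)) *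
          (locC a (y w.1 * t) : ℂ)).trans ?_
    exact Finset.prod_congr rfl fun w _ => integral_char_locC _ _ (hy w.1)

theorem integral_locProd {a : ℝ} (ha : 0 < a) (σ : {w : InfinitePlace K // IsReal w} → ℤˣ)
    {y : InfinitePlace K → ℝ} (hy : ∀ w, 0 < y w) :
    ∫ z, (locProd a σ y z : ℂ) =
      (((∏ w, y w ^ mult w)⁻¹ * Real.pi ^ nrComplexPlaces K : ℝ) : ℂ) := by
  have h := integral_pair_locProd a σ hy 0
  simp only [pair, map_zero, Prod.fst_zero, Prod.snd_zero, Pi.zero_apply, zero_mul, zero_div,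
    neg_zero, Complex.zero_re, mul_zero, Finset.sum_const_zero, add_zero, Complex.ofReal_zero,
    Complex.exp_zero, one_mul, ftR_zero ha, ftC_zero ha, mul_one] at h
  rw [h, prod_eq_prod_mul_prod]
  simp only [mult_isReal, mult_isComplex, pow_one, Finset.prod_mul_distrib, Finset.prod_const,
    Finset.card_univ]
  push_cast
  rw [mul_inv, Finset.prod_inv_distrib, mul_assoc]
  simp only [inv_pow, Finset.prod_inv_distrib]

theorem norm_integral_pair_locProd_le {a : ℝ} (ha : 0 < a) (ha1 : a ≤ 1)
    (σ : {w : InfinitePlace K // IsReal w} → ℤˣ)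
    {y : InfinitePlace K → ℝ} (hy : ∀ w, 0 < y w) {β : K} (hβ : β ≠ 0) :
    ‖∫ z, cexp (2 * Real.pi * I * pair β z) * (locProd a σ y z : ℂ)‖ ≤
      (∏ w, y w ^ mult w)⁻¹ * (10 ^ 8 * a⁻¹ ^ 4) ^ nK K *
        ∏ w : InfinitePlace K, decay ((w β / y w) ^ mult w) := by
  have hai : 1 ≤ a⁻¹ := (one_le_inv₀ ha).mpr ha1
  have hd : ∀ τ : ℝ, 0 ≤ τ → 0 ≤ decay τ := fun τ hτ => by unfold decay; positivity
  set M : ℝ := 10 ^ 8 * a⁻¹ ^ 4 with hM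
  have hM1 : 1 ≤ M := by
    have := one_le_pow₀ hai (n := 4)
    nlinarith
  have hMm : ∏ w : InfinitePlace K, M ^ mult w = M ^ nK K := by
    rw [Finset.prod_pow_eq_pow_sum, sum_mult_eq, nK]
  rw [integral_pair_locProd a σ hy, norm_mul, norm_prod, norm_prod]
  calc _ ≤ (∏ w : {w : InfinitePlace K // IsReal w}, (y w.1 ^ mult w.1)⁻¹ * M ^ mult w.1 *
          decay ((w.1 β / y w.1) ^ mult w.1)) *
        ∏ w : {w : InfinitePlace K // IsComplex w}, (y w.1 ^ mult w.1)⁻¹ * M ^ mult w.1 *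
          decay ((w.1 β / y w.1) ^ mult w.1) := by
        refine mul_le_mul (Finset.prod_le_prod (fun w _ => norm_nonneg _) fun w _ => ?_)
          (Finset.prod_le_prod (fun w _ => norm_nonneg _) fun w _ => ?_)
          (Finset.prod_nonneg fun w _ => norm_nonneg _) (Finset.prod_nonneg fun w _ => ?_)
        · have hw := hy w.1
          have hb : (mixedEmbedding K β).1 w ≠ 0 := by
            simpa [mixedEmbedding_apply_isReal] using hβ
          have hb' : ‖(mixedEmbedding K β).1 w‖ = w.1 β := by
            rw [mixedEmbedding_apply_isReal]; exact norm_embedding_of_isReal w.2 β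
          rw [norm_mul, Complex.norm_real, Real.norm_of_nonneg (by positivity), mult_isReal,
            pow_one, pow_one, pow_one, mul_assoc]
          refine mul_le_mul_of_nonneg_left ?_ (by positivity)
          refine (norm_ftR_le ha ha1 (neg_ne_zero.mpr (div_ne_zero hb
            (mul_ne_zero (sg_ne_zero _) hw.ne')))).trans ?_
          rw [norm_neg, norm_div, norm_mul, Real.norm_eq_abs (sg _), abs_sg, one_mul,
            Real.norm_of_nonneg hw.le, hb']
          refine mul_le_mul_of_nonneg_right ?_ (hd _ (by positivity))
          rw [hM]
          gcongr 10 ^ 8 * ?_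
          exact pow_le_pow_right₀ hai (by norm_num)
        · have hw := hy w.1
          have hb' : ‖(mixedEmbedding K β).2 w‖ = w.1 β := by
            rw [mixedEmbedding_apply_isComplex]; exact norm_embedding_eq _ β
          have hb : (mixedEmbedding K β).2 w ≠ 0 := by
            rw [← norm_ne_zero_iff, hb']; simpa using hβ
          rw [norm_mul, Complex.norm_real, Real.norm_of_nonneg (by positivity), mult_isComplex,
            mul_assoc, inv_pow]
          refine mul_le_mul_of_nonneg_left ?_ (by positivity)
          refine (norm_ftC_le ha ha1 (neg_ne_zero.mpr (div_ne_zero hb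
            (by exact_mod_cast hw.ne')))).trans ?_
          rw [norm_neg, norm_div, Complex.norm_real, Real.norm_of_nonneg hw.le, hb']
          refine mul_le_mul_of_nonneg_right ?_ (hd _ (by positivity))
          nlinarith
        · have := hy w.1
          have := hd ((w.1 β / y w.1) ^ mult w.1) (by positivity)
          positivity
    _ = _ := by
        rw [← prod_eq_prod_mul_prod (fun w : InfinitePlace K => (y w ^ mult w)⁻¹ * M ^ mult w *
          decay ((w β / y w) ^ mult w)), Finset.prod_mul_distrib, Finset.prod_mul_distrib, hMm,
          Finset.prod_inv_distrib]

end LocalProduct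

section LogScale

open MeasureTheory Set NumberField.InfinitePlace NumberField.mixedEmbedding NumberField.Units
  NumberField.Units.dirichletUnitTheorem
open scoped Classical ENNReal

/-- The extension of a point of logarithmic space to a vector with sum zero indexed by all the
infinite places. -/
def extLog (l : logSpace K) (w : InfinitePlace K) : ℝ :=
  if h : w ≠ w₀ then l ⟨w, h⟩ else -∑ v, l v

theorem extLog_coe (l : logSpace K) (w : {w : InfinitePlace K // w ≠ w₀}) :
    extLog l w.1 = l w := by
  rw [extLog, dif_pos w.2]

theorem extLog_w₀ (l : logSpace K) : extLog l w₀ = -∑ v, l v := by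
  rw [extLog, dif_neg (not_not.mpr rfl)]

theorem sum_extLog (l : logSpace K) : ∑ w, extLog l w = 0 := by
  rw [Fintype.sum_eq_add_sum_subtype_ne _ w₀, extLog_w₀]
  simp [extLog_coe]

theorem extLog_add_unitLog (l : logSpace K) (u : (𝓞 K)ˣ) (w : InfinitePlace K) :
    extLog (l + unitLog u) w = extLog l w + mult w * Real.log (w (u : K)) := by
  by_cases h : w = w₀
  · subst h
    simp only [extLog_w₀, Pi.add_apply, Finset.sum_add_distrib, unitLog,
      sum_logEmbedding_component]
    ring
  · have := extLog_coe (l + unitLog u) ⟨w, h⟩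
    have h2 := extLog_coe l ⟨w, h⟩
    simp only at this h2
    rw [this, h2, Pi.add_apply, unitLog, logEmbedding_component]

theorem continuous_extLog (w : InfinitePlace K) :
    Continuous fun l : logSpace K => extLog l w := by
  unfold extLog
  split_ifs <;> fun_prop

/-- The scale at each infinite place. -/
def scaleAt (X : ℝ) (l : logSpace K) (w : InfinitePlace K) : ℝ :=
  Real.exp (extLog l w / mult w - Real.log X / nK K)

theorem scaleAt_pos (X : ℝ) (l : logSpace K) (w : InfinitePlace K) : 0 < scaleAt X l w :=
  Real.exp_pos _

theorem nK_pos : 0 < nK K := Module.finrank_pos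

theorem scaleAt_pow_mult (X : ℝ) (l : logSpace K) (w : InfinitePlace K) :
    scaleAt X l w ^ mult w = Real.exp (extLog l w - mult w * (Real.log X / nK K)) := by
  have : (mult w : ℝ) ≠ 0 := mult_coe_ne_zero
  rw [scaleAt, ← Real.exp_nat_mul]
  congr 1
  field_simp

theorem prod_scaleAt {X : ℝ} (hX : 0 < X) (l : logSpace K) :
    ∏ w, scaleAt X l w ^ mult w = X⁻¹ := by
  have hn : (nK K : ℝ) ≠ 0 := by exact_mod_cast (nK_pos (K := K)).ne'
  have hs : ∑ w : InfinitePlace K, (mult w : ℝ) = nK K := by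
    exact_mod_cast sum_mult_eq (K := K)
  simp_rw [scaleAt_pow_mult]
  rw [← Real.exp_sum, Finset.sum_sub_distrib, sum_extLog, ← Finset.sum_mul, hs,
    mul_div_cancel₀ _ hn, zero_sub, Real.exp_neg, Real.exp_log hX]

theorem scaleAt_add_unitLog (X : ℝ) (l : logSpace K) (u : (𝓞 K)ˣ) (w : InfinitePlace K) :
    scaleAt X (l + unitLog u) w = scaleAt X l w * w (u : K) := by
  have h0 : (mult w : ℝ) ≠ 0 := mult_coe_ne_zero
  have h1 : 0 < w (u : K) := InfinitePlace.pos_iff.mpr (by simp)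
  rw [scaleAt, scaleAt, extLog_add_unitLog]
  conv_rhs => rw [← Real.exp_log h1]
  rw [← Real.exp_add]
  congr 1
  field_simp
  ring

/-- The weight attached to a nonzero element of the field. -/
def wgt (a X : ℝ) (α : K) (l : logSpace K) : ℝ :=
  ∏ w : InfinitePlace K, bspline a (2 * mult w - 1)
    (extLog l w + mult w * (Real.log (w α) - Real.log X / nK K))

theorem one_le_two_mul_mult_sub_one (w : InfinitePlace K) : 1 ≤ 2 * mult w - 1 := by
  have := mult_pos (w := w)
  omega

theorem continuous_bspline_of_one_le {a : ℝ} (ha : 0 < a) {j : ℕ} (hj : 1 ≤ j) :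
    Continuous (bspline a j) := by
  obtain ⟨j, rfl⟩ := Nat.exists_eq_add_of_le' hj
  exact continuous_bspline_succ ha j

theorem wgt_nonneg {a : ℝ} (ha : 0 < a) (X : ℝ) (α : K) (l : logSpace K) : 0 ≤ wgt a X α l :=
  Finset.prod_nonneg fun _ _ => bspline_nonneg ha _ _

theorem continuous_wgt {a : ℝ} (ha : 0 < a) (X : ℝ) (α : K) : Continuous (wgt a X α) :=
  continuous_finsetProd _ fun w _ =>
    (continuous_bspline_of_one_le ha (one_le_two_mul_mult_sub_one w)).comp
      ((continuous_extLog w).add continuous_const)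

theorem wgt_unit_mul (a X : ℝ) {α : K} (hα : α ≠ 0) (u : (𝓞 K)ˣ) (l : logSpace K) :
    wgt a X ((u : K) * α) l = wgt a X α (l + unitLog u) := by
  refine Finset.prod_congr rfl fun w _ => ?_
  rw [extLog_add_unitLog, map_mul, Real.log_mul (by simp) (by simpa using hα)]
  congr 1
  ring

theorem prod_abs_pow_mult (α : K) : ∏ w : InfinitePlace K, w α ^ mult w = |Algebra.norm ℚ α| := by
  exact_mod_cast prod_eq_abs_norm α

theorem sum_mult_log {X : ℝ} (hX : 0 < X) {α : K} (hα : α ≠ 0) :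
    ∑ w : InfinitePlace K, (mult w : ℝ) * (Real.log (w α) - Real.log X / nK K) =
      -Real.log (X / |(Algebra.norm ℚ α : ℝ)|) := by
  have hn : (nK K : ℝ) ≠ 0 := by exact_mod_cast (nK_pos (K := K)).ne'
  have hs : ∑ w : InfinitePlace K, (mult w : ℝ) = nK K := by
    exact_mod_cast sum_mult_eq (K := K)
  have hN : |(Algebra.norm ℚ α : ℝ)| ≠ 0 := by simpa using hα
  have := prod_abs_pow_mult α
  simp_rw [mul_sub]
  rw [Finset.sum_sub_distrib, ← Finset.sum_mul, hs, mul_div_cancel₀ _ hn,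
    Real.log_div hX.ne' hN]
  push_cast at this
  rw [← this, Real.log_prod (fun w _ => pow_ne_zero _ (by simpa using hα))]
  simp only [Real.log_pow]
  ring

theorem lintegral_wgt {A : ℝ} (hA : 0 < A) {Ψ : ℝ → ℝ} (hΨ : IsWeissWeight (nK K) A Ψ)
    {X : ℝ} (hX : 0 < X) {α : K} (hα : α ≠ 0) :
    ∫⁻ l, ENNReal.ofReal (wgt A⁻¹ X α l) =
      ENNReal.ofReal (Ψ (X / |(Algebra.norm ℚ α : ℝ)|)) := by
  have ha : 0 < A⁻¹ := inv_pos.mpr hA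
  have hN : 0 < |(Algebra.norm ℚ α : ℝ)| := by simpa using hα
  set c : InfinitePlace K → ℝ := fun w => mult w * (Real.log (w α) - Real.log X / nK K) with hc
  set k : {w : InfinitePlace K // w ≠ w₀} → ℕ := fun w => 2 * mult w.1 - 1 with hk
  set k0 : ℕ := 2 * mult (w₀ : InfinitePlace K) - 1 with hk0
  set cv : logSpace K := fun i => c i.1 with hcv
  set s : ℝ := ∑ w, c w with hs
  have hsum : (∑ i, (k i + 1)) + (k0 + 1) = 2 * nK K := by
    rw [nK, ← sum_mult_eq, Fintype.sum_eq_add_sum_subtype_ne _ w₀, mul_add, Finset.mul_sum,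
      add_comm]
    congr 1
    · have := one_le_two_mul_mult_sub_one (w₀ : InfinitePlace K)
      omega
    · refine Finset.sum_congr rfl fun w _ => ?_
      have := one_le_two_mul_mult_sub_one w.1
      simp only [hk]
      omega
  have hsl : s = -Real.log (X / |(Algebra.norm ℚ α : ℝ)|) := sum_mult_log hX hα
  have hkey := weiss_eq_convB hA hΨ (k := k) (k0 := k0)
    (fun w => one_le_two_mul_mult_sub_one w.1) (one_le_two_mul_mult_sub_one _) hsum s
  rw [hsl, neg_neg, Real.exp_log (div_pos hX hN), ← hsl] at hkey
  set G : logSpace K → ℝ := fun μ =>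
    (∏ i, bspline A⁻¹ (k i) (μ i)) * bspline A⁻¹ k0 (s - ∑ i, μ i) with hG
  have hw : ∀ l, wgt A⁻¹ X α l = G (l + cv) := by
    intro l
    rw [wgt, Fintype.prod_eq_mul_prod_subtype_ne _ w₀, mul_comm]
    simp only [hG, extLog_coe, extLog_w₀, Pi.add_apply]
    congr 2
    rw [hs, Fintype.sum_eq_add_sum_subtype_ne _ w₀, Finset.sum_add_distrib]
    simp only [hcv, hc]
    ring
  have hGc : Continuous G := (continuous_convB_integrand ha (k := k) (k0 := k0)
    (fun w => one_le_two_mul_mult_sub_one w.1) (one_le_two_mul_mult_sub_one _)).comp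
      (continuous_const.prodMk continuous_id)
  have hGs : HasCompactSupport G := HasCompactSupport.of_support_subset_isCompact
    (isCompact_setOf_abs_le fun i => (k i + 1 : ℝ) * A⁻¹)
    fun μ h => (convB_integrand_support ha h).1
  simp_rw [hw]
  rw [lintegral_add_right_eq_self (fun μ => ENNReal.ofReal (G μ)) cv, hkey, convB,
    ofReal_integral_eq_lintegral_ofReal (hGc.integrable_of_hasCompactSupport hGs)]
  exact Eventually.of_forall fun μ =>
    mul_nonneg (Finset.prod_nonneg fun _ _ => bspline_nonneg ha _ _) (bspline_nonneg ha _ _)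

/-- The signs of a field element at the real places. -/
def signVec (α : K) (w : {w : InfinitePlace K // IsReal w}) : ℤˣ :=
  if 0 < (mixedEmbedding K α).1 w then 1 else -1

theorem abs_mixedEmbedding_fst (α : K) (w : {w : InfinitePlace K // IsReal w}) :
    |(mixedEmbedding K α).1 w| = w.1 α := by
  rw [mixedEmbedding_apply_isReal, ← Real.norm_eq_abs]
  exact norm_embedding_of_isReal w.2 α

theorem norm_mixedEmbedding_snd (α : K) (w : {w : InfinitePlace K // IsComplex w}) :
    ‖(mixedEmbedding K α).2 w‖ = w.1 α := by
  rw [mixedEmbedding_apply_isComplex]; exact norm_embedding_eq _ α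

theorem sg_signVec_mul (α : K) (w : {w : InfinitePlace K // IsReal w}) :
    sg (signVec α w) * (mixedEmbedding K α).1 w = w.1 α := by
  rw [← abs_mixedEmbedding_fst, signVec]
  split_ifs with h
  · rw [abs_of_pos h]; simp [sg]
  · rw [abs_of_nonpos (not_lt.mp h)]; simp [sg]

theorem locProd_mixedEmbedding (a : ℝ) {X : ℝ} (hX : 0 < X)
    (σ : {w : InfinitePlace K // IsReal w} → ℤˣ) (l : logSpace K) {α : K} (hα : α ≠ 0) :
    locProd a σ (scaleAt X l) (mixedEmbedding K α) =
      if σ = signVec α then wgt a X α l * (X / |(Algebra.norm ℚ α : ℝ)|) else 0 := by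
  have hwα : ∀ w : InfinitePlace K, 0 < w α := fun w => InfinitePlace.pos_iff.mpr hα
  have hlog : ∀ w : InfinitePlace K, (mult w : ℝ) * Real.log (scaleAt X l w * w α) =
      extLog l w + mult w * (Real.log (w α) - Real.log X / nK K) := by
    intro w
    have h0 : (mult w : ℝ) ≠ 0 := mult_coe_ne_zero
    rw [Real.log_mul (scaleAt_pos X l w).ne' (hwα w).ne', scaleAt, Real.log_exp]
    field_simp
    ring
  split_ifs with hσ
  · subst hσ
    have hprod : (∏ w : InfinitePlace K, (scaleAt X l w * w α) ^ mult w) =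
        (X / |(Algebra.norm ℚ α : ℝ)|)⁻¹ := by
      have := prod_abs_pow_mult α
      push_cast at this
      simp_rw [mul_pow]
      rw [Finset.prod_mul_distrib, prod_scaleAt hX, this, inv_div, div_eq_inv_mul]
    rw [← inv_inv (X / _), ← hprod, ← div_eq_mul_inv, wgt, ← Finset.prod_div_distrib,
      prod_eq_prod_mul_prod, locProd]
    congr 1
    · refine Finset.prod_congr rfl fun w _ => ?_
      have h1 := hlog w.1
      rw [mult_isReal, Nat.cast_one, one_mul, one_mul] at h1
      rw [mul_right_comm, sg_signVec_mul _, mul_comm, locR,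
        if_pos (mul_pos (scaleAt_pos X l w.1) (hwα w.1)), h1, mult_isReal, pow_one]
      simp
    · refine Finset.prod_congr rfl fun w _ => ?_
      have h1 := hlog w.1
      rw [mult_isComplex] at h1
      push_cast at h1
      rw [locC, norm_mul, norm_mixedEmbedding_snd, Complex.norm_real,
        Real.norm_of_nonneg (scaleAt_pos X l w.1).le, h1, mult_isComplex]
      simp
  · obtain ⟨w, hw⟩ := Function.ne_iff.mp hσ
    have hs : sg (σ w) = -sg (signVec α w) := by
      rcases Int.units_eq_one_or (σ w) with h | h <;>
        rcases Int.units_eq_one_or (signVec α w) with h' | h' <;>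
        simp [sg, h, h'] at hw ⊢
    have : locR a (sg (σ w) * scaleAt X l w.1 * (mixedEmbedding K α).1 w) = 0 := by
      rw [locR, if_neg]
      rw [mul_right_comm, hs, neg_mul, sg_signVec_mul _, not_lt]
      have := scaleAt_pos X l w.1
      have := hwα w.1
      nlinarith
    rw [locProd, Finset.prod_eq_zero (Finset.mem_univ w) this, zero_mul]

theorem locProd_zero (a : ℝ) (σ : {w : InfinitePlace K // IsReal w} → ℤˣ)
    (y : InfinitePlace K → ℝ) : locProd a σ y 0 = 0 := by
  obtain ⟨w⟩ : Nonempty (InfinitePlace K) := inferInstance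
  rw [locProd]
  rcases isReal_or_isComplex w with h | h
  · rw [Finset.prod_eq_zero (Finset.mem_univ (⟨w, h⟩ : {w : InfinitePlace K // IsReal w}))
      (by simp [locR]), zero_mul]
  · rw [Finset.prod_eq_zero (Finset.mem_univ (⟨w, h⟩ : {w : InfinitePlace K // IsComplex w}))
      (by simp [locC]), mul_zero]

theorem measurable_decay : Measurable decay := by
  unfold decay
  fun_prop

theorem integral_exp_neg_abs_sub (d : ℝ) : ∫ t : ℝ, Real.exp (-(|d - t| / 2)) = 4 := by
  rw [integral_sub_left_eq_self (fun t : ℝ => Real.exp (-(|t| / 2))) volume d,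
    integral_comp_abs (f := fun x => Real.exp (-(x / 2)))]
  have h := integral_exp_mul_Ioi (a := -(1 / 2)) (by norm_num) 0
  have e : ∀ x : ℝ, -(1 / 2) * x = -(x / 2) := fun x => by ring
  simp only [e] at h
  rw [h]
  norm_num

/-- The bound for the Fourier coefficients of the local test functions. -/
def prodDecay (X : ℝ) (β : K) (l : logSpace K) : ℝ :=
  ∏ w : InfinitePlace K, decay ((w β / scaleAt X l w) ^ mult w)

theorem measurable_prodDecay (X : ℝ) (β : K) : Measurable (prodDecay X β) := by
  refine Finset.measurable_fun_prod _ fun w _ => measurable_decay.comp ?_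
  have : Measurable fun l : logSpace K => scaleAt X l w :=
    (Real.continuous_exp.comp (((continuous_extLog w).div_const _).sub
      continuous_const)).measurable
  fun_prop

theorem prodDecay_unit_mul (X : ℝ) (β : K) (u : (𝓞 K)ˣ) (l : logSpace K) :
    prodDecay X (((u⁻¹ : (𝓞 K)ˣ) : K) * β) l = prodDecay X β (l + unitLog u) := by
  refine Finset.prod_congr rfl fun w _ => ?_
  rw [scaleAt_add_unitLog, map_mul]
  congr 2
  have h1 : w (u : K) ≠ 0 := by simp
  have h2 : w ((u⁻¹ : (𝓞 K)ˣ) : K) = (w (u : K))⁻¹ := by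
    rw [← map_inv₀]
    congr 1
    simp
  have := (scaleAt_pos X l w).ne'
  rw [h2]
  field_simp

theorem lintegral_prodDecay_le {X : ℝ} (hX : 0 < X) {β : K} (hβ : β ≠ 0) :
    ∫⁻ l, ENNReal.ofReal (prodDecay X β l) ≤
      ENNReal.ofReal (4 ^ nK K * (|(Algebra.norm ℚ β : ℝ)| * X) ^ (-(3 / 2) : ℝ)) := by
  have hwβ : ∀ w : InfinitePlace K, 0 < w β := fun w => InfinitePlace.pos_iff.mpr hβ
  set d : InfinitePlace K → ℝ := fun w => mult w * (Real.log (w β) + Real.log X / nK K) with hd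
  have hτ : ∀ l w, 0 < (w β / scaleAt X l w) ^ mult w := fun l w =>
    pow_pos (div_pos (hwβ w) (scaleAt_pos X l w)) _
  have hlog : ∀ (l : logSpace K) w, Real.log ((w β / scaleAt X l w) ^ mult w) =
      d w - extLog l w := by
    intro l w
    have h0 : (mult w : ℝ) ≠ 0 := mult_coe_ne_zero
    rw [Real.log_pow, Real.log_div (hwβ w).ne' (scaleAt_pos X l w).ne', scaleAt, Real.log_exp]
    simp only [hd]
    field_simp
    ring
  have hprod : ∀ l : logSpace K, ∏ w, ((w β / scaleAt X l w) ^ mult w) ^ (-(3 / 2) : ℝ) =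
      (|(Algebra.norm ℚ β : ℝ)| * X) ^ (-(3 / 2) : ℝ) := by
    intro l
    have := prod_abs_pow_mult β
    push_cast at this
    rw [Real.finsetProd_rpow _ _ fun w _ => (hτ l w).le]
    simp_rw [div_pow]
    rw [Finset.prod_div_distrib, prod_scaleAt hX, this, div_inv_eq_mul]
  set E : logSpace K → ℝ := fun l => ∏ i, Real.exp (-(|d i.1 - l i| / 2)) with hE
  have hle : ∀ l, prodDecay X β l ≤ (|(Algebra.norm ℚ β : ℝ)| * X) ^ (-(3 / 2) : ℝ) * E l := by
    intro l
    simp only [prodDecay, decay]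
    rw [Finset.prod_mul_distrib, hprod]
    refine mul_le_mul_of_nonneg_left ?_ (by positivity)
    rw [Fintype.prod_eq_mul_prod_subtype_ne _ w₀]
    refine (mul_le_of_le_one_left (Finset.prod_nonneg fun _ _ => (Real.exp_pos _).le)
      (Real.exp_le_one_iff.mpr (neg_nonpos.mpr (div_nonneg (abs_nonneg _) zero_le_two)))).trans (le_of_eq ?_)
    refine Finset.prod_congr rfl fun i _ => ?_
    rw [hlog, extLog_coe]
  have hint : ∫ l, E l = 4 ^ Fintype.card {w : InfinitePlace K // w ≠ w₀} := by
    rw [hE, integral_fintype_prod_volume_eq_prod (fun (i : {w : InfinitePlace K // w ≠ w₀})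
      (t : ℝ) => Real.exp (-(|d i.1 - t| / 2)))]
    simp_rw [integral_exp_neg_abs_sub]
    simp
  have hEi : Integrable E := Integrable.of_integral_ne_zero (by rw [hint]; positivity)
  have hcard : Fintype.card {w : InfinitePlace K // w ≠ w₀} ≤ nK K := by
    rw [nK, ← sum_mult_eq]
    refine (Fintype.card_subtype_le _).trans ?_
    rw [Fintype.card_eq_sum_ones]
    exact Finset.sum_le_sum fun w _ => mult_pos
  calc ∫⁻ l, ENNReal.ofReal (prodDecay X β l) ≤ ∫⁻ l, ENNReal.ofReal
        ((|(Algebra.norm ℚ β : ℝ)| * X) ^ (-(3 / 2) : ℝ) * E l) :=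
        lintegral_mono fun l => ENNReal.ofReal_le_ofReal (hle l)
    _ = ENNReal.ofReal (∫ l, (|(Algebra.norm ℚ β : ℝ)| * X) ^ (-(3 / 2) : ℝ) * E l) :=
        (ofReal_integral_eq_lintegral_ofReal (hEi.const_mul _) (Eventually.of_forall fun l =>
          mul_nonneg (by positivity) (Finset.prod_nonneg fun _ _ => (Real.exp_pos _).le))).symm
    _ ≤ _ := by
        refine ENNReal.ofReal_le_ofReal ?_
        rw [integral_const_mul, hint, mul_comm]
        gcongr
        norm_num

end LogScale

section IdealPoisson

open MeasureTheory Set NumberField.InfinitePlace NumberField.mixedEmbedding NumberField.Units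
  NumberField.Units.dirichletUnitTheorem
open scoped Classical ENNReal

theorem norm_apply_le_norm_mixedEmbedding (x : K) (w : InfinitePlace K) :
    w x ≤ ‖mixedEmbedding K x‖ := by
  rw [← normAtPlace_apply w x, norm_eq_sup'_normAtPlace]
  exact Finset.le_sup' (fun w => normAtPlace w (mixedEmbedding K x)) (Finset.mem_univ w)

theorem finite_mixedEmbedding_mem {s : Set (mixedSpace K)} (hs : IsCompact s) :
    {α : 𝓞 K | mixedEmbedding K (α : K) ∈ s}.Finite := by
  obtain ⟨B, hB⟩ := hs.isBounded.exists_norm_le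
  refine Set.Finite.subset (s := (fun α : 𝓞 K => (α : K)) ⁻¹'
    {x : K | IsIntegral ℤ x ∧ ∀ φ : K →+* ℂ, ‖φ x‖ ≤ B})
    ((NumberField.Embeddings.finite_of_norm_le K ℂ B).preimage
      (RingOfIntegers.coe_injective.injOn)) fun α hα => ⟨α.isIntegral_coe, fun φ => ?_⟩
  exact (norm_apply_le_norm_mixedEmbedding (α : K) (InfinitePlace.mk φ)).trans (hB _ hα)

/-- A sum over an ideal `𝔞`, split into the residue classes of a modulus `𝔮` coprime to `𝔞`. -/
theorem tsum_ideal_eq_sum_tsum {𝔮 𝔞 : Ideal (𝓞 K)} [Fintype (𝓞 K ⧸ 𝔮)] (hc : IsCoprime 𝔮 𝔞) :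
    ∃ ρ : (𝓞 K ⧸ 𝔮) → 𝓞 K, ∀ g : 𝓞 K → ℂ, (Function.support g).Finite →
      (∑' α : 𝔞, g α) = ∑ r, ∑' γ : (𝔮 * 𝔞 : Ideal (𝓞 K)), g (ρ r + γ) ∧
      ∀ (r : 𝓞 K ⧸ 𝔮) (γ : (𝔮 * 𝔞 : Ideal (𝓞 K))), Ideal.Quotient.mk 𝔮 (ρ r + γ) = r := by
  obtain ⟨j, hj, i, hi, hij⟩ := Ideal.isCoprime_iff_exists.mp hc
  set ρ : (𝓞 K ⧸ 𝔮) → 𝓞 K := fun r => i * Quotient.out r with hρ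
  have hmk : ∀ r, Ideal.Quotient.mk 𝔮 (ρ r) = r := fun r => by
    have h1 : Ideal.Quotient.mk 𝔮 i = 1 := by
      rw [← map_one (Ideal.Quotient.mk 𝔮), ← hij, map_add, Ideal.Quotient.eq_zero_iff_mem.mpr hj,
        zero_add]
    rw [hρ, map_mul, h1, one_mul]
    exact Quotient.out_eq r
  have hmk2 : ∀ (r : 𝓞 K ⧸ 𝔮) (γ : (𝔮 * 𝔞 : Ideal (𝓞 K))),
      Ideal.Quotient.mk 𝔮 (ρ r + γ) = r := fun r γ => by
    rw [map_add, hmk, Ideal.Quotient.eq_zero_iff_mem.mpr (Ideal.mul_le_left γ.2), add_zero]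
  have hmem : ∀ r, ρ r ∈ 𝔞 := fun r => 𝔞.mul_mem_right _ hi
  refine ⟨ρ, fun g hg => ⟨?_, hmk2⟩⟩
  let F : (𝓞 K ⧸ 𝔮) × (𝔮 * 𝔞 : Ideal (𝓞 K)) → 𝔞 := fun p =>
    ⟨ρ p.1 + p.2, 𝔞.add_mem (hmem _) (Ideal.mul_le_right p.2.2)⟩
  have hF : Function.Bijective F := by
    constructor
    · rintro ⟨r, γ⟩ ⟨r', γ'⟩ h
      have h0 : ρ r + (γ : 𝓞 K) = ρ r' + γ' := congrArg Subtype.val h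
      have h1 : r = r' := by rw [← hmk2 r γ, ← hmk2 r' γ', h0]
      subst h1
      exact Prod.ext rfl (Subtype.ext (add_left_cancel h0))
    · rintro ⟨α, hα⟩
      refine ⟨⟨Ideal.Quotient.mk 𝔮 α, ⟨α - ρ (Ideal.Quotient.mk 𝔮 α), ?_⟩⟩, Subtype.ext ?_⟩
      · rw [Ideal.mul_eq_inf_of_isCoprime hc]
        refine ⟨?_, 𝔞.sub_mem hα (hmem _)⟩
        exact Ideal.Quotient.eq_zero_iff_mem.mp (by rw [map_sub, hmk, sub_self])
      · exact add_sub_cancel _ _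
  have hs : Summable fun p => g (F p) := by
    refine summable_of_hasFiniteSupport ?_
    exact hg.preimage (Function.Injective.injOn (Subtype.val_injective.comp hF.1))
  refine ((Equiv.ofBijective F hF).tsum_eq (fun α : 𝔞 => g α)).symm.trans ?_
  refine (hs.tsum_prod' fun r => hs.comp_injective (Prod.mk_right_injective r)).trans ?_
  exact tsum_fintype _

theorem poisson_residue_sum {𝔮 𝔞 : Ideal (𝓞 K)} [Fintype (𝓞 K ⧸ 𝔮)] (h𝔮 : 𝔮 ≠ ⊥) (h𝔞 : 𝔞 ≠ ⊥)
    (hc : IsCoprime 𝔮 𝔞) {a : ℝ} (ha : 0 < a) (ha1 : a ≤ 1) {X : ℝ} (hX : 0 < X) (l : logSpace K)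
    (g : (𝓞 K ⧸ 𝔮) → ({w : InfinitePlace K // IsReal w} → ℤˣ) → ℂ) (hg : ∀ r σ, ‖g r σ‖ ≤ 1)
    {V : ℝ} (hV : V = (Ideal.absNorm 𝔮 * Ideal.absNorm 𝔞) * (2⁻¹) ^ nrComplexPlaces K *
      √|(discr K : ℝ)|) :
    ‖(∑' α : 𝔞, ∑ σ, g (Ideal.Quotient.mk 𝔮 α) σ *
          (locProd a σ (scaleAt X l) (mixedEmbedding K ((α : 𝓞 K) : K)) : ℂ)) -
        ((V⁻¹ * X * Real.pi ^ nrComplexPlaces K : ℝ) : ℂ) * ∑ r, ∑ σ, g r σ‖ₑ ≤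
      ENNReal.ofReal (V⁻¹ * Ideal.absNorm 𝔮 * 2 ^ nrRealPlaces K * X *
        (10 ^ 8 * a⁻¹ ^ 4) ^ nK K) *
      ∑' β : {β : K // β ≠ 0 ∧ β ∈ FractionalIdeal.dual ℤ ℚ
          ((𝔮 * 𝔞 : Ideal (𝓞 K)) : FractionalIdeal (nonZeroDivisors (𝓞 K)) K)},
        ENNReal.ofReal (prodDecay X β.1 l) := by
  have hy : ∀ w, 0 < scaleAt X l w := scaleAt_pos X l
  have h0 : 𝔮 * 𝔞 ∈ nonZeroDivisors (Ideal (𝓞 K)) :=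
    mem_nonZeroDivisors_of_ne_zero (mul_ne_zero h𝔮 h𝔞)
  set I := FractionalIdeal.mk0 K ⟨𝔮 * 𝔞, h0⟩ with hI
  have hIc : (I : FractionalIdeal (nonZeroDivisors (𝓞 K)) K) = ((𝔮 * 𝔞 : Ideal (𝓞 K)) :
    FractionalIdeal (nonZeroDivisors (𝓞 K)) K) := FractionalIdeal.coe_mk0 (K := K) ⟨𝔮 * 𝔞, h0⟩
  have hcov : ZLattice.covolume (mixedEmbedding.idealLattice K I) = V := by
    rw [NumberField.mixedEmbedding.covolume_idealLattice, hIc, FractionalIdeal.coeIdeal_absNorm,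
      map_mul, hV]
    push_cast
    rfl
  have hVpos : 0 < V := hcov ▸ ZLattice.covolume_pos _ volume
  let F : (𝓞 K ⧸ 𝔮) → mixedSpace K → ℂ := fun r z =>
    ∑ σ, g r σ * (locProd a σ (scaleAt X l) z : ℂ)
  have hlc : ∀ σ, Continuous fun z => (locProd a σ (scaleAt X l) z : ℂ) := fun σ =>
    Complex.continuous_ofReal.comp (continuous_locProd ha σ _)
  have hls : ∀ σ, HasCompactSupport fun z => (locProd a σ (scaleAt X l) z : ℂ) := fun σ =>
    (hasCompactSupport_locProd ha σ hy).comp_left Complex.ofReal_zero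
  have hFc : ∀ r, Continuous (F r) := fun r =>
    continuous_finsetSum _ fun σ _ => continuous_const.mul (hlc σ)
  let Z : Set (mixedSpace K) := ⋃ σ, tsupport fun z => (locProd a σ (scaleAt X l) z : ℂ)
  have hZ : IsCompact Z := isCompact_iUnion fun σ => hls σ
  have hFZ : ∀ r z, z ∉ Z → F r z = 0 := fun r z hz => by
    refine Finset.sum_eq_zero fun σ _ => ?_
    have : z ∉ tsupport fun z => (locProd a σ (scaleAt X l) z : ℂ) := fun h =>
      hz (mem_iUnion.mpr ⟨σ, h⟩)
    have h1 := image_eq_zero_of_notMem_tsupport this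
    exact (congrArg (g r σ * ·) h1).trans (mul_zero _)
  have hFs : ∀ r, HasCompactSupport (F r) := fun r => HasCompactSupport.intro hZ (hFZ r)
  have hpair : ∀ β : K, Continuous fun z : mixedSpace K => pair β z := fun β =>
    LinearMap.continuous_of_finiteDimensional (pairHom β)
  have hint : ∀ (β : K) σ, Integrable fun z : mixedSpace K =>
      cexp (2 * Real.pi * Complex.I * pair β z) * (locProd a σ (scaleAt X l) z : ℂ) := fun β σ =>
    Continuous.integrable_of_hasCompactSupport (Continuous.mul (by have := hpair β; fun_prop)
      (hlc σ)) (hls σ).mul_left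
  have hint0 : ∀ σ, Integrable fun z : mixedSpace K => (locProd a σ (scaleAt X l) z : ℂ) :=
    fun σ => (hlc σ).integrable_of_hasCompactSupport (hls σ)
  have hprod : (∏ w, scaleAt X l w ^ mult w)⁻¹ = X := by rw [prod_scaleAt hX, inv_inv]
  have hF0 : ∀ r, ∫ z, F r z =
      ((X * Real.pi ^ nrComplexPlaces K : ℝ) : ℂ) * ∑ σ, g r σ := fun r => by
    rw [integral_finsetSum _ fun σ _ => (hint0 σ).const_mul _, Finset.mul_sum]
    refine Finset.sum_congr rfl fun σ _ => ?_
    rw [integral_const_mul, integral_locProd ha σ hy, hprod, mul_comm]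
  have hcard : Fintype.card ({w : InfinitePlace K // IsReal w} → ℤˣ) = 2 ^ nrRealPlaces K := by
    rw [Fintype.card_fun, Fintype.card_units_int, nrRealPlaces]
  have hFβ : ∀ r (β : K), β ≠ 0 → ‖∫ z, cexp (2 * Real.pi * Complex.I * pair β z) * F r z‖ ≤
      2 ^ nrRealPlaces K * X * (10 ^ 8 * a⁻¹ ^ 4) ^ nK K * prodDecay X β l := fun r β hβ => by
    have h1 : ∀ z, cexp (2 * Real.pi * Complex.I * pair β z) * F r z = ∑ σ, g r σ *
        (cexp (2 * Real.pi * Complex.I * pair β z) * (locProd a σ (scaleAt X l) z : ℂ)) :=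
      fun z => by
        rw [Finset.mul_sum]
        exact Finset.sum_congr rfl fun σ _ => by ring
    simp_rw [h1]
    rw [integral_finsetSum _ fun σ _ => (hint β σ).const_mul _]
    refine (norm_sum_le _ _).trans ?_
    calc _ ≤ ∑ _σ : {w : InfinitePlace K // IsReal w} → ℤˣ,
          X * (10 ^ 8 * a⁻¹ ^ 4) ^ nK K * prodDecay X β l := by
          refine Finset.sum_le_sum fun σ _ => ?_
          rw [integral_const_mul, norm_mul]
          refine (mul_le_of_le_one_left (norm_nonneg _) (hg r σ)).trans ?_
          have := norm_integral_pair_locProd_le ha ha1 σ hy hβ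
          rwa [hprod] at this
      _ = _ := by
          rw [Finset.sum_const, Finset.card_univ, hcard, nsmul_eq_mul]
          push_cast
          ring
  obtain ⟨ρ, hρ⟩ := tsum_ideal_eq_sum_tsum hc
  have hfin : (Function.support fun α : 𝓞 K =>
      F (Ideal.Quotient.mk 𝔮 α) (mixedEmbedding K (α : K))).Finite := by
    refine (finite_mixedEmbedding_mem hZ).subset fun α hα => ?_
    by_contra h
    exact hα (hFZ _ _ h)
  obtain ⟨hsum, hmk⟩ := hρ _ hfin
  let e : (𝔮 * 𝔞 : Ideal (𝓞 K)) ≃ (I : FractionalIdeal (nonZeroDivisors (𝓞 K)) K) :=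
    Equiv.ofBijective (fun γ => ⟨((γ : 𝓞 K) : K), by
      rw [hIc]; exact FractionalIdeal.mem_coeIdeal_of_mem _ γ.2⟩) (by
      constructor
      · intro γ γ' h
        have h' : ((γ : 𝓞 K) : K) = ((γ' : 𝓞 K) : K) := by
          simpa only [Subtype.mk.injEq] using h
        exact Subtype.ext (RingOfIntegers.coe_injective h')
      · rintro ⟨x, hx⟩
        have hx' : x ∈ (I : FractionalIdeal (nonZeroDivisors (𝓞 K)) K) := hx
        rw [hIc, FractionalIdeal.mem_coeIdeal] at hx'
        obtain ⟨y, hy, rfl⟩ := hx'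
        exact ⟨⟨y, hy⟩, rfl⟩)
  have hmain : (∑' α : 𝔞, ∑ σ, g (Ideal.Quotient.mk 𝔮 α) σ *
      (locProd a σ (scaleAt X l) (mixedEmbedding K ((α : 𝓞 K) : K)) : ℂ)) =
      ∑ r, ∑' γ : (I : FractionalIdeal (nonZeroDivisors (𝓞 K)) K),
        F r (mixedEmbedding K (ρ r : K) + mixedEmbedding K (γ : K)) := by
    refine hsum.trans (Finset.sum_congr rfl fun r _ => ?_)
    refine Eq.trans ?_ (e.tsum_eq (fun γ : (I : FractionalIdeal (nonZeroDivisors (𝓞 K)) K) =>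
      F r (mixedEmbedding K (ρ r : K) + mixedEmbedding K (γ : K))))
    refine tsum_congr fun γ => ?_
    rw [hmk]
    exact congrArg (F r) ((congrArg (mixedEmbedding K) (map_add (algebraMap (𝓞 K) K) _ _)).trans
      (map_add _ _ _))
  have hconst : ((V⁻¹ * X * Real.pi ^ nrComplexPlaces K : ℝ) : ℂ) * ∑ r, ∑ σ, g r σ =
      ∑ r, V⁻¹ • ∫ z, F r z := by
    rw [Finset.mul_sum]
    refine Finset.sum_congr rfl fun r _ => ?_
    rw [hF0, Complex.real_smul, ← mul_assoc, ← Complex.ofReal_mul, mul_assoc]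
  rw [hmain, hconst, ← Finset.sum_sub_distrib]
  refine (enorm_sum_le _ _).trans ?_
  have hterm : ∀ r, ‖(∑' γ : (I : FractionalIdeal (nonZeroDivisors (𝓞 K)) K),
        F r (mixedEmbedding K (ρ r : K) + mixedEmbedding K (γ : K))) - V⁻¹ • ∫ z, F r z‖ₑ ≤
      ENNReal.ofReal (V⁻¹ * 2 ^ nrRealPlaces K * X * (10 ^ 8 * a⁻¹ ^ 4) ^ nK K) *
      ∑' β : {β : K // β ≠ 0 ∧ β ∈ FractionalIdeal.dual ℤ ℚ
          ((𝔮 * 𝔞 : Ideal (𝓞 K)) : FractionalIdeal (nonZeroDivisors (𝓞 K)) K)},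
        ENNReal.ofReal (prodDecay X β.1 l) := fun r => by
    have h := poisson_ideal I (mixedEmbedding K (ρ r : K)) (hFc r) (hFs r)
    rw [hcov] at h
    refine h.trans ?_
    rw [show V⁻¹ * 2 ^ nrRealPlaces K * X * (10 ^ 8 * a⁻¹ ^ 4) ^ nK K =
      V⁻¹ * (2 ^ nrRealPlaces K * X * (10 ^ 8 * a⁻¹ ^ 4) ^ nK K) by ring,
      ENNReal.ofReal_mul (by positivity), mul_assoc (ENNReal.ofReal V⁻¹), hIc]
    refine mul_le_mul_right ?_ _
    rw [← ENNReal.tsum_mul_left]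
    refine ENNReal.tsum_le_tsum fun β => ?_
    rw [← ENNReal.ofReal_mul (by positivity), ← ofReal_norm]
    exact ENNReal.ofReal_le_ofReal (hFβ r β.1 β.2.1)
  refine (Finset.sum_le_sum fun r _ => hterm r).trans (le_of_eq ?_)
  rw [Finset.sum_const, Finset.card_univ, nsmul_eq_mul, ← mul_assoc,
    ← ENNReal.ofReal_natCast, ← ENNReal.ofReal_mul (by positivity)]
  congr 2
  rw [show Fintype.card (𝓞 K ⧸ 𝔮) = Ideal.absNorm 𝔮 by
    rw [Ideal.absNorm_apply, Submodule.cardQuot_apply, Nat.card_eq_fintype_card]]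
  ring

end IdealPoisson

section Orbits

open nonZeroDivisors FractionalIdeal

variable (K) in
theorem countable_numberField : Countable K :=
  (Module.finBasis ℚ K).equivFun.toEquiv.injective.countable

variable {C : Type*}

/-- Pairs consisting of an index `c` and a nonzero element of the fractional ideal `J c`. -/
abbrev Gen (J : C → FractionalIdeal (𝓞 K)⁰ K) : Type _ := Σ c, {β : K // β ≠ 0 ∧ β ∈ J c}

variable {J : C → FractionalIdeal (𝓞 K)⁰ K}

theorem countable_gen [Countable C] : Countable (Gen J) := by
  have := countable_numberField K
  infer_instance

theorem exists_quotient (hJ : ∀ c, J c ≠ 0) (p : Gen J) :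
    ∃ I : {I : Ideal (𝓞 K) // I ≠ ⊥}, ((I.1 : Ideal (𝓞 K)) : FractionalIdeal (𝓞 K)⁰ K) * J p.1 =
      spanSingleton (𝓞 K)⁰ p.2.1 := by
  have h1 : spanSingleton (𝓞 K)⁰ p.2.1 / J p.1 ≤ 1 := by
    rw [div_eq_mul_inv, ← mul_inv_cancel₀ (hJ p.1)]
    exact mul_le_mul_left (spanSingleton_le_iff_mem.mpr p.2.2.2) _
  obtain ⟨I, hI⟩ := le_one_iff_exists_coeIdeal.mp h1
  have h2 : ((I : Ideal (𝓞 K)) : FractionalIdeal (𝓞 K)⁰ K) * J p.1 =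
      spanSingleton (𝓞 K)⁰ p.2.1 := by
    rw [hI, div_mul_cancel₀ _ (hJ p.1)]
  refine ⟨⟨I, ?_⟩, h2⟩
  rintro rfl
  rw [coeIdeal_bot, zero_mul, eq_comm, spanSingleton_eq_zero_iff] at h2
  exact p.2.2.1 h2

/-- The integral ideal `β (J c)⁻¹` attached to a nonzero element `β` of `J c`. -/
def quotientIdeal (hJ : ∀ c, J c ≠ 0) (p : Gen J) : {I : Ideal (𝓞 K) // I ≠ ⊥} :=
  (exists_quotient hJ p).choose

theorem quotientIdeal_mul (hJ : ∀ c, J c ≠ 0) (p : Gen J) :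
    (((quotientIdeal hJ p).1 : Ideal (𝓞 K)) : FractionalIdeal (𝓞 K)⁰ K) * J p.1 =
      spanSingleton (𝓞 K)⁰ p.2.1 :=
  (exists_quotient hJ p).choose_spec

theorem quotientIdeal_eq (hJ : ∀ c, J c ≠ 0) {p : Gen J} {I : Ideal (𝓞 K)}
    (h : (I : FractionalIdeal (𝓞 K)⁰ K) * J p.1 = spanSingleton (𝓞 K)⁰ p.2.1) :
    (quotientIdeal hJ p).1 = I := by
  rw [← quotientIdeal_mul hJ p] at h
  exact (coeIdeal_injective (K := K) (mul_right_cancel₀ (hJ p.1) h)).symm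

theorem absNorm_quotientIdeal (hJ : ∀ c, J c ≠ 0) (p : Gen J) :
    (Ideal.absNorm (quotientIdeal hJ p).1 : ℝ) * (FractionalIdeal.absNorm (J p.1) : ℚ) =
      |(Algebra.norm ℚ p.2.1 : ℝ)| := by
  have h := congrArg FractionalIdeal.absNorm (quotientIdeal_mul hJ p)
  rw [map_mul, coeIdeal_absNorm, absNorm_span_singleton] at h
  exact_mod_cast congrArg (Rat.cast : ℚ → ℝ) h

/-- The action of the units on the nonzero elements of the ideals `J c`. -/
def genAct (u : (𝓞 K)ˣ) (p : Gen J) : Gen J :=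
  ⟨p.1, ((u : 𝓞 K) : K) * p.2.1, mul_ne_zero (by simp) p.2.2.1, by
    have := (J p.1 : Submodule (𝓞 K) K).smul_mem (u : 𝓞 K) p.2.2.2
    rwa [Algebra.smul_def] at this⟩

theorem quotientIdeal_genAct (hJ : ∀ c, J c ≠ 0) (u : (𝓞 K)ˣ) (p : Gen J) :
    quotientIdeal hJ (genAct u p) = quotientIdeal hJ p := by
  refine Subtype.ext (quotientIdeal_eq hJ ?_)
  refine (quotientIdeal_mul hJ p).trans ?_
  refine spanSingleton_eq_spanSingleton.mpr ⟨u, ?_⟩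
  rw [Units.smul_def, Algebra.smul_def]
  rfl

theorem exists_genAct_eq (hJ : ∀ c, J c ≠ 0)
    (hJ' : ∀ c c' (x : K), x ≠ 0 → J c = spanSingleton (𝓞 K)⁰ x * J c' → c = c')
    (p p' : Gen J) (h : quotientIdeal hJ p = quotientIdeal hJ p') : ∃ u, genAct u p = p' := by
  obtain ⟨c, β, hβ0, hβ⟩ := p
  obtain ⟨c', β', hβ0', hβ'⟩ := p'
  have h1 := quotientIdeal_mul hJ ⟨c, β, hβ0, hβ⟩
  have h2 := quotientIdeal_mul hJ ⟨c', β', hβ0', hβ'⟩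
  rw [← h] at h2
  simp only at h1 h2
  set I : FractionalIdeal (𝓞 K)⁰ K :=
    (((quotientIdeal hJ ⟨c, β, hβ0, hβ⟩).1 : Ideal (𝓞 K)) : FractionalIdeal (𝓞 K)⁰ K) with hI
  have hI0 : I ≠ 0 := coeIdeal_ne_zero.mpr (quotientIdeal hJ ⟨c, β, hβ0, hβ⟩).2
  have hcc : c = c' := by
    refine hJ' c c' (β / β') (div_ne_zero hβ0 hβ0') (mul_left_cancel₀ hI0 ?_)
    rw [h1, mul_left_comm, h2, spanSingleton_mul_spanSingleton, div_mul_cancel₀ _ hβ0']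
  subst hcc
  rw [h1] at h2
  obtain ⟨z, hz⟩ := spanSingleton_eq_spanSingleton.mp h2
  refine ⟨z, ?_⟩
  have : ((z : 𝓞 K) : K) * β = β' := by
    rw [← hz, Units.smul_def, Algebra.smul_def]
  unfold genAct
  simp only [this]

theorem genAct_injective (u v : (𝓞 K)ˣ) (p : Gen J) (h : genAct u p = genAct v p) : u = v := by
  obtain ⟨c, β, hβ0, hβ⟩ := p
  have h1 : ((u : 𝓞 K) : K) * β = ((v : 𝓞 K) : K) * β := by
    simpa [genAct] using h
  have h2 := mul_right_cancel₀ hβ0 h1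
  exact Units.ext (RingOfIntegers.coe_injective h2)

theorem quotientIdeal_surjective (hJ : ∀ c, J c ≠ 0)
    (hJs : ∀ I : Ideal (𝓞 K), I ≠ ⊥ → ∃ c, ∃ β : K, (I : FractionalIdeal (𝓞 K)⁰ K) * J c =
      spanSingleton (𝓞 K)⁰ β) : Function.Surjective (quotientIdeal hJ) := by
  rintro ⟨I, hI⟩
  obtain ⟨c, β, h⟩ := hJs I hI
  have hβ0 : β ≠ 0 := by
    rintro rfl
    rw [spanSingleton_zero] at h
    exact mul_ne_zero (coeIdeal_ne_zero.mpr hI) (hJ c) h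
  have hβ : β ∈ J c := by
    rw [← spanSingleton_le_iff_mem (S := (𝓞 K)⁰), ← h]
    exact (mul_le_mul_left coeIdeal_le_one _).trans (one_mul _).le
  exact ⟨⟨c, β, hβ0, hβ⟩, Subtype.ext (quotientIdeal_eq hJ h)⟩

end Orbits

section ClassSum

open MeasureTheory Set nonZeroDivisors NumberField.InfinitePlace NumberField.mixedEmbedding
  NumberField.Units NumberField.Units.dirichletUnitTheorem
open scoped Classical ENNReal

variable {C : Type*}

/-- A system of nonzero integral ideals representing every ideal class exactly once. -/
structure ClassReps (𝔞 : C → Ideal (𝓞 K)) : Prop where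
  ne_bot : ∀ c, 𝔞 c ≠ ⊥
  eq_of : ∀ c c' (x : K), x ≠ 0 → (𝔞 c : FractionalIdeal (𝓞 K)⁰ K) =
    FractionalIdeal.spanSingleton (𝓞 K)⁰ x * (𝔞 c' : FractionalIdeal (𝓞 K)⁰ K) → c = c'
  exists_gen : ∀ I : Ideal (𝓞 K), I ≠ ⊥ → ∃ c, ∃ β : K, (I : FractionalIdeal (𝓞 K)⁰ K) *
    (𝔞 c : FractionalIdeal (𝓞 K)⁰ K) = FractionalIdeal.spanSingleton (𝓞 K)⁰ β

/-- The fractional ideals attached to a family of integral ideals. -/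
abbrev fracOf (𝔞 : C → Ideal (𝓞 K)) (c : C) : FractionalIdeal (𝓞 K)⁰ K := 𝔞 c

/-- The duals of the ideals `𝔮 𝔞 c` under the trace form. -/
abbrev dualOf (𝔮 : Ideal (𝓞 K)) (𝔞 : C → Ideal (𝓞 K)) (c : C) : FractionalIdeal (𝓞 K)⁰ K :=
  FractionalIdeal.dual ℤ ℚ ((𝔮 * 𝔞 c : Ideal (𝓞 K)) : FractionalIdeal (𝓞 K)⁰ K)

theorem ClassReps.fracOf_ne_zero {𝔞 : C → Ideal (𝓞 K)} (h : ClassReps 𝔞) (c : C) :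
    fracOf 𝔞 c ≠ 0 := FractionalIdeal.coeIdeal_ne_zero.mpr (h.ne_bot c)

theorem ClassReps.dualOf_ne_zero {𝔮 : Ideal (𝓞 K)} (h𝔮 : 𝔮 ≠ ⊥) {𝔞 : C → Ideal (𝓞 K)}
    (h : ClassReps 𝔞) (c : C) : dualOf 𝔮 𝔞 c ≠ 0 :=
  FractionalIdeal.dual_ne_zero_iff.mpr
    (FractionalIdeal.coeIdeal_ne_zero.mpr (mul_ne_zero h𝔮 (h.ne_bot c)))

theorem absNorm_dual_one : FractionalIdeal.absNorm
    (FractionalIdeal.dual ℤ ℚ (1 : FractionalIdeal (𝓞 K)⁰ K)) = (DK K : ℚ)⁻¹ := by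
  rw [← inv_inv (FractionalIdeal.dual ℤ ℚ (1 : FractionalIdeal (𝓞 K)⁰ K)), map_inv₀,
    ← coeIdeal_differentIdeal ℤ ℚ, FractionalIdeal.coeIdeal_absNorm,
    NumberField.absNorm_differentIdeal (K := K)]
  rfl

theorem absNorm_dualOf (𝔮 : Ideal (𝓞 K)) (𝔞 : C → Ideal (𝓞 K)) (c : C) :
    FractionalIdeal.absNorm (dualOf 𝔮 𝔞 c) =
      ((DK K : ℚ) * Ideal.absNorm 𝔮 * Ideal.absNorm (𝔞 c))⁻¹ := by
  rw [dualOf, FractionalIdeal.dual_eq_mul_inv, map_mul, absNorm_dual_one, map_inv₀,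
    FractionalIdeal.coeIdeal_absNorm, map_mul]
  push_cast
  rw [mul_assoc (DK K : ℚ), mul_inv, mul_inv, mul_inv]

theorem ClassReps.dualOf_eq_of {𝔮 : Ideal (𝓞 K)} (h𝔮 : 𝔮 ≠ ⊥) {𝔞 : C → Ideal (𝓞 K)}
    (h : ClassReps 𝔞) (c c' : C) (x : K) (hx : x ≠ 0)
    (he : dualOf 𝔮 𝔞 c = FractionalIdeal.spanSingleton (𝓞 K)⁰ x * dualOf 𝔮 𝔞 c') : c = c' := by
  rw [dualOf, dualOf, FractionalIdeal.dual_eq_mul_inv,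
    FractionalIdeal.dual_eq_mul_inv ℤ ℚ (I := ((𝔮 * 𝔞 c' : Ideal (𝓞 K)) :
      FractionalIdeal (𝓞 K)⁰ K)), mul_left_comm] at he
  have h1 : FractionalIdeal.dual ℤ ℚ (1 : FractionalIdeal (𝓞 K)⁰ K) ≠ 0 :=
    FractionalIdeal.dual_ne_zero_iff.mpr one_ne_zero
  have h2 := mul_left_cancel₀ h1 he
  refine h.eq_of c c' x⁻¹ (inv_ne_zero hx) ?_
  have h3 : (𝔮 : FractionalIdeal (𝓞 K)⁰ K) ≠ 0 := FractionalIdeal.coeIdeal_ne_zero.mpr h𝔮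
  rw [← inv_inj, inv_inv, mul_inv, inv_inv, FractionalIdeal.spanSingleton_inv] at h2
  rw [FractionalIdeal.coeIdeal_mul, FractionalIdeal.coeIdeal_mul, mul_left_comm] at h2
  exact mul_left_cancel₀ h3 h2

variable [Finite C]

theorem lintegral_prodDecay_dual_le {𝔮 : Ideal (𝓞 K)} (h𝔮 : 𝔮 ≠ ⊥) {𝔞 : C → Ideal (𝓞 K)}
    (h : ClassReps 𝔞) {x : ℝ} (hx : 0 < x) :
    ∫⁻ l in unitFD K, ∑' p : Gen (dualOf 𝔮 𝔞),
        ENNReal.ofReal (prodDecay (x * Ideal.absNorm (𝔞 p.1)) p.2.1 l) ≤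
      torsionOrder K * ∑' I : {I : Ideal (𝓞 K) // I ≠ ⊥}, ENNReal.ofReal (4 ^ nK K *
        (x * Ideal.absNorm I.1 / (DK K * Ideal.absNorm 𝔮)) ^ (-(3 / 2) : ℝ)) := by
  have := countable_gen (J := dualOf 𝔮 𝔞)
  rw [lintegral_tsum fun p => (measurable_prodDecay _ _).ennreal_ofReal.aemeasurable]
  have hJ := h.dualOf_ne_zero h𝔮
  refine unfold_le (act := fun u p => genAct u⁻¹ p) (N := quotientIdeal hJ)
    (f := fun p l => ENNReal.ofReal (prodDecay (x * Ideal.absNorm (𝔞 p.1)) p.2.1 l))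
    (B := fun I : {I : Ideal (𝓞 K) // I ≠ ⊥} => ENNReal.ofReal (4 ^ nK K *
        (x * Ideal.absNorm I.1 / (DK K * Ideal.absNorm 𝔮)) ^ (-(3 / 2) : ℝ)))
    (fun u p => quotientIdeal_genAct hJ _ p) (fun p p' hp => ?_) (fun u v p hp => ?_)
    (fun u p l => ?_) (fun p => ?_)
  · obtain ⟨u, hu⟩ := exists_genAct_eq hJ (h.dualOf_eq_of h𝔮) p p' hp
    exact ⟨u⁻¹, by simpa using hu⟩
  · exact inv_injective (genAct_injective _ _ p hp)
  · rw [← prodDecay_unit_mul]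
    rfl
  · have hN : 0 < (Ideal.absNorm (𝔞 p.1) : ℝ) := by
      exact_mod_cast Nat.pos_of_ne_zero (Ideal.absNorm_ne_zero_iff_mem_nonZeroDivisors.mpr
        (mem_nonZeroDivisors_of_ne_zero (h.ne_bot p.1)))
    refine (lintegral_prodDecay_le (mul_pos hx hN) p.2.2.1).trans (le_of_eq ?_)
    congr 3
    rw [← absNorm_quotientIdeal hJ p, absNorm_dualOf]
    push_cast
    field_simp

theorem absNorm_pos {I : Ideal (𝓞 K)} (h : I ≠ ⊥) : 0 < (Ideal.absNorm I : ℝ) := by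
  exact_mod_cast Nat.pos_of_ne_zero (Ideal.absNorm_ne_zero_iff_mem_nonZeroDivisors.mpr
    (mem_nonZeroDivisors_of_ne_zero h))

theorem finite_weiss_support {n : ℕ} {A : ℝ} {Ψ : ℝ → ℝ} (hΨ : IsWeissWeight n A Ψ) (x : ℝ) :
    {I : {I : Ideal (𝓞 K) // I ≠ ⊥} | Ψ (x / Ideal.absNorm I.1) ≠ 0}.Finite := by
  obtain ⟨-, -, hs, -⟩ := hΨ
  set E := Real.exp (-(2 * (n : ℝ)) / A)
  have hfin := (Ideal.finite_setOfPred_absNorm_le (S := 𝓞 K) ⌈x / E⌉₊).preimage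
    (f := fun I : {I : Ideal (𝓞 K) // I ≠ ⊥} => I.1) Subtype.val_injective.injOn
  refine hfin.subset fun I hI => ?_
  have h1 : x / Ideal.absNorm I.1 ∈ Icc E (Real.exp ((2 * (n : ℝ)) / A)) := by
    by_contra h
    exact hI (hs _ h)
  have h2 := (le_div_iff₀ (absNorm_pos I.2)).mp h1.1
  have h3 : (Ideal.absNorm I.1 : ℝ) ≤ x / E := by
    rw [le_div_iff₀ (Real.exp_pos _)]
    linarith
  exact Nat.cast_le.mp (h3.trans (Nat.le_ceil _))

theorem integral_tsum_wgt {𝔞 : C → Ideal (𝓞 K)} (h : ClassReps 𝔞) {x : ℝ} (hx : 0 < x)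
    {A : ℝ} (hA : 0 < A) {Ψ : ℝ → ℝ} (hΨ : IsWeissWeight (nK K) A Ψ) (f : Ideal (𝓞 K) → ℂ) :
    Integrable (fun l => ∑' p : Gen (fracOf 𝔞), f (quotientIdeal h.fracOf_ne_zero p).1 /
        (Ideal.absNorm (quotientIdeal h.fracOf_ne_zero p).1 : ℂ) *
        (wgt A⁻¹ (x * Ideal.absNorm (𝔞 p.1)) p.2.1 l : ℂ)) (volume.restrict (unitFD K)) ∧
    ∫ l in unitFD K, ∑' p : Gen (fracOf 𝔞), f (quotientIdeal h.fracOf_ne_zero p).1 /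
        (Ideal.absNorm (quotientIdeal h.fracOf_ne_zero p).1 : ℂ) *
        (wgt A⁻¹ (x * Ideal.absNorm (𝔞 p.1)) p.2.1 l : ℂ) =
      torsionOrder K * ∑' I : {I : Ideal (𝓞 K) // I ≠ ⊥},
        f I.1 / (Ideal.absNorm I.1 : ℂ) * (Ψ (x / Ideal.absNorm I.1) : ℂ) := by
  have := countable_gen (J := fracOf 𝔞)
  have hJ := h.fracOf_ne_zero
  refine unfold_integral (act := genAct) (N := quotientIdeal hJ)
    (f := fun p l => wgt A⁻¹ (x * Ideal.absNorm (𝔞 p.1)) p.2.1 l)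
    (B := fun I : {I : Ideal (𝓞 K) // I ≠ ⊥} => Ψ (x / Ideal.absNorm I.1))
    (g := fun I : {I : Ideal (𝓞 K) // I ≠ ⊥} => f I.1 / (Ideal.absNorm I.1 : ℂ))
    (fun u p => quotientIdeal_genAct hJ u p) (exists_genAct_eq hJ h.eq_of) genAct_injective
    (quotientIdeal_surjective hJ h.exists_gen) (fun p l => wgt_nonneg (inv_pos.mpr hA) _ _ _)
    (fun p => (continuous_wgt (inv_pos.mpr hA) _ _).measurable)
    (fun u p l => wgt_unit_mul _ _ p.2.2.1 u l) (fun p => ?_) (fun I => (hΨ.2.1 _).1) ?_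
  · have hN := absNorm_pos (h.ne_bot p.1)
    rw [lintegral_wgt hA hΨ (mul_pos hx hN) p.2.2.1]
    congr 2
    rw [← absNorm_quotientIdeal hJ p, FractionalIdeal.coeIdeal_absNorm]
    push_cast
    rw [mul_div_mul_right _ _ hN.ne']
  · refine summable_of_hasFiniteSupport ((finite_weiss_support hΨ x).subset fun I hI hI' => hI ?_)
    simp only
    rw [hI', mul_zero]

end ClassSum

section ClassSumBound

open MeasureTheory Set nonZeroDivisors NumberField.InfinitePlace NumberField.mixedEmbedding
  NumberField.Units NumberField.Units.dirichletUnitTheorem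
open scoped Classical ENNReal

variable {C : Type*}

/-- The sum over sign vectors of the local products attached to an integer `α`. -/
def signSum (a X : ℝ) (l : logSpace K) {𝔮 : Ideal (𝓞 K)}
    (g : (𝓞 K ⧸ 𝔮) → ({w : InfinitePlace K // IsReal w} → ℤˣ) → ℂ) (α : 𝓞 K) : ℂ :=
  ∑ σ, g (Ideal.Quotient.mk 𝔮 α) σ *
    (locProd a σ (scaleAt X l) (mixedEmbedding K (α : K)) : ℂ)

theorem finite_signSum_support {a : ℝ} (ha : 0 < a) (X : ℝ) (l : logSpace K) {𝔮 : Ideal (𝓞 K)}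
    (g : (𝓞 K ⧸ 𝔮) → ({w : InfinitePlace K // IsReal w} → ℤˣ) → ℂ) :
    {α : 𝓞 K | signSum a X l g α ≠ 0}.Finite := by
  have hls : ∀ σ, IsCompact (tsupport (locProd (K := K) a σ (scaleAt X l))) := fun σ =>
    hasCompactSupport_locProd ha σ (scaleAt_pos X l)
  refine (finite_mixedEmbedding_mem (isCompact_iUnion hls)).subset fun α hα => ?_
  obtain ⟨σ, -, hσ⟩ := Finset.exists_ne_zero_of_sum_ne_zero hα
  refine mem_iUnion.mpr ⟨σ, subset_tsupport _ fun h => hσ ?_⟩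
  rw [h, Complex.ofReal_zero, mul_zero]

theorem signSum_zero (a X : ℝ) (l : logSpace K) {𝔮 : Ideal (𝓞 K)}
    (g : (𝓞 K ⧸ 𝔮) → ({w : InfinitePlace K // IsReal w} → ℤˣ) → ℂ) :
    signSum a X l g 0 = 0 := by
  have h0 : ((0 : 𝓞 K) : K) = 0 := map_zero _
  refine Finset.sum_eq_zero fun σ _ => ?_
  rw [h0, map_zero (mixedEmbedding K), locProd_zero, Complex.ofReal_zero, mul_zero]

theorem signSum_eq {a X : ℝ} (hX : 0 < X) (l : logSpace K) {𝔮 : Ideal (𝓞 K)}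
    (g : (𝓞 K ⧸ 𝔮) → ({w : InfinitePlace K // IsReal w} → ℤˣ) → ℂ) {α : 𝓞 K} (hα : α ≠ 0) :
    signSum a X l g α = g (Ideal.Quotient.mk 𝔮 α) (signVec (α : K)) *
      (wgt a X (α : K) l * (X / |(Algebra.norm ℚ (α : K) : ℝ)|) : ℝ) := by
  have hα' : (α : K) ≠ 0 := RingOfIntegers.coe_ne_zero_iff.mpr hα
  unfold signSum
  rw [Finset.sum_eq_single (signVec (α : K)) (fun σ _ hσ => ?_)
    (fun h => absurd (Finset.mem_univ _) h), locProd_mixedEmbedding a hX _ l hα', if_pos rfl]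
  rw [locProd_mixedEmbedding a hX _ l hα', if_neg hσ, Complex.ofReal_zero, mul_zero]

/-- The nonzero elements of an ideal, as nonzero elements of the fractional ideal. -/
def genEquiv (𝔞 : C → Ideal (𝓞 K)) (c : C) :
    {α : 𝔞 c // α ≠ 0} ≃ {β : K // β ≠ 0 ∧ β ∈ fracOf 𝔞 c} :=
  Equiv.ofBijective (fun α => ⟨((α.1 : 𝓞 K) : K), by
      refine RingOfIntegers.coe_ne_zero_iff.mpr fun h => α.2 (Subtype.ext h),
      FractionalIdeal.mem_coeIdeal_of_mem _ α.1.2⟩) (by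
    constructor
    · intro α α' h
      have h' : ((α.1 : 𝓞 K) : K) = ((α'.1 : 𝓞 K) : K) := by
        simpa only [Subtype.mk.injEq] using h
      exact Subtype.ext (Subtype.ext (RingOfIntegers.coe_injective h'))
    · rintro ⟨x, hx0, hx⟩
      obtain ⟨y, hy, rfl⟩ := (FractionalIdeal.mem_coeIdeal _).mp hx
      exact ⟨⟨⟨y, hy⟩, fun h => hx0 (by
        have h' : y = 0 := congrArg Subtype.val h
        rw [h', map_zero])⟩, rfl⟩)

theorem tsum_gen_eq [Fintype C] {𝔮 : Ideal (𝓞 K)} {𝔞 : C → Ideal (𝓞 K)} (h : ClassReps 𝔞)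
    {x : ℝ} (hx : 0 < x) {a : ℝ} (ha : 0 < a) (l : logSpace K) {f : Ideal (𝓞 K) → ℂ} {e : C → ℂ}
    {g : (𝓞 K ⧸ 𝔮) → ({w : InfinitePlace K // IsReal w} → ℤˣ) → ℂ}
    (hfg : ∀ c (α : 𝓞 K), α ≠ 0 → ∀ I, Ideal.span {α} = I * 𝔞 c →
      f I = e c * g (Ideal.Quotient.mk 𝔮 α) (signVec (α : K))) :
    ∑' p : Gen (fracOf 𝔞), f (quotientIdeal h.fracOf_ne_zero p).1 /
        (Ideal.absNorm (quotientIdeal h.fracOf_ne_zero p).1 : ℂ) *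
        (wgt a (x * Ideal.absNorm (𝔞 p.1)) p.2.1 l : ℂ) =
      ∑ c, e c / x * ∑' α : 𝔞 c, signSum a (x * Ideal.absNorm (𝔞 c)) l g α := by
  set F : Gen (fracOf 𝔞) → ℂ := fun p => f (quotientIdeal h.fracOf_ne_zero p).1 /
        (Ideal.absNorm (quotientIdeal h.fracOf_ne_zero p).1 : ℂ) *
        (wgt a (x * Ideal.absNorm (𝔞 p.1)) p.2.1 l : ℂ) with hF
  set E : (Σ c, {α : 𝔞 c // α ≠ 0}) ≃ Gen (fracOf 𝔞) := Equiv.sigmaCongrRight (genEquiv 𝔞) with hE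
  have hFE : ∀ q, F (E q) = e q.1 / x * signSum a (x * Ideal.absNorm (𝔞 q.1)) l g q.2.1 := by
    rintro ⟨c, α, hα⟩
    have hα0 : (α : 𝓞 K) ≠ 0 := fun h => hα (Subtype.ext h)
    have hN := absNorm_pos (h.ne_bot c)
    set p : Gen (fracOf 𝔞) := E ⟨c, α, hα⟩ with hp
    have hI := quotientIdeal_mul h.fracOf_ne_zero p
    have hspan : Ideal.span {(α : 𝓞 K)} = (quotientIdeal h.fracOf_ne_zero p).1 * 𝔞 c := by
      refine FractionalIdeal.coeIdeal_injective (K := K) ?_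
      simp only
      rw [FractionalIdeal.coeIdeal_mul, FractionalIdeal.coeIdeal_span_singleton]
      exact hI.symm
    have hnorm := absNorm_quotientIdeal h.fracOf_ne_zero p
    rw [FractionalIdeal.coeIdeal_absNorm] at hnorm
    have hIpos := absNorm_pos (quotientIdeal h.fracOf_ne_zero p).2
    rw [signSum_eq (mul_pos hx hN) l g hα0]
    have h1 : F p = f (quotientIdeal h.fracOf_ne_zero p).1 /
        (Ideal.absNorm (quotientIdeal h.fracOf_ne_zero p).1 : ℂ) *
        (wgt a (x * Ideal.absNorm (𝔞 c)) ((α : 𝓞 K) : K) l : ℂ) := rfl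
    rw [h1, hfg c α hα0 _ hspan]
    have h2 : |(Algebra.norm ℚ ((α : 𝓞 K) : K) : ℝ)| =
        (Ideal.absNorm (quotientIdeal h.fracOf_ne_zero p).1 : ℝ) * Ideal.absNorm (𝔞 c) :=
      hnorm.symm.trans (by push_cast; rfl)
    rw [h2, mul_div_mul_right _ _ hN.ne']
    have hx' : (x : ℂ) ≠ 0 := Complex.ofReal_ne_zero.mpr hx.ne'
    push_cast
    field_simp
  have hfin : ∀ c, {α : 𝔞 c | signSum a (x * Ideal.absNorm (𝔞 c)) l g α ≠ 0}.Finite := fun c =>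
    (finite_signSum_support ha _ l g).preimage Subtype.val_injective.injOn
  have hfin' : ∀ c, {α : {α : 𝔞 c // α ≠ 0} |
      signSum a (x * Ideal.absNorm (𝔞 c)) l g α.1 ≠ 0}.Finite := fun c =>
    (hfin c).preimage Subtype.val_injective.injOn
  have hs1 : Summable fun q => F (E q) := by
    refine summable_of_hasFiniteSupport ((Set.finite_iUnion fun c =>
      (hfin' c).image (Sigma.mk c)).subset ?_)
    rintro ⟨c, α⟩ hα
    refine mem_iUnion.mpr ⟨c, α, fun h0 => hα ?_, rfl⟩
    refine (hFE _).trans ?_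
    simp only at h0 ⊢
    rw [h0, mul_zero]
  have hs2 : ∀ c, Summable fun α : {α : 𝔞 c // α ≠ 0} => F (E ⟨c, α⟩) := fun c =>
    hs1.comp_injective sigma_mk_injective
  rw [← E.tsum_eq, hs1.tsum_sigma' hs2, tsum_fintype]
  refine Finset.sum_congr rfl fun c _ => ?_
  simp_rw [hFE]
  rw [tsum_mul_left]
  congr 1
  refine tsum_subtype_eq_of_support_subset (s := {α : 𝔞 c | α ≠ 0})
    (f := fun α : 𝔞 c => signSum a (x * Ideal.absNorm (𝔞 c)) l g α) fun α hα h0 => hα ?_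
  simp only
  rw [h0]
  exact signSum_zero _ _ _ _

end ClassSumBound

section ClassSumBound

open MeasureTheory Set nonZeroDivisors NumberField.InfinitePlace NumberField.mixedEmbedding
  NumberField.Units NumberField.Units.dirichletUnitTheorem
open scoped Classical ENNReal

variable {C : Type*}

/-- The density of the main term: the residue of `ζ_K`, up to the factor `2 ^ r₁ h`, over `N𝔮`. -/
def mainConst (K : Type*) [Field K] [NumberField K] (𝔮 : Ideal (𝓞 K)) : ℝ :=
  (Ideal.absNorm 𝔮 * (2⁻¹ : ℝ) ^ nrComplexPlaces K * √|(discr K : ℝ)|)⁻¹ *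
    Real.pi ^ nrComplexPlaces K

theorem one_le_sqrt_discr : 1 ≤ √|(discr K : ℝ)| := by
  rw [Real.one_le_sqrt, ← Int.cast_abs]
  exact_mod_cast Int.one_le_abs (discr_ne_zero K)

theorem nrPlaces_pow_le : (2 : ℝ) ^ nrRealPlaces K * 2 ^ nrComplexPlaces K ≤ 2 ^ nK K := by
  rw [← pow_add]
  refine pow_le_pow_right₀ (by norm_num) ?_
  rw [nK, ← card_add_two_mul_card_eq_rank]
  omega

/-- A pointwise form of the class sum estimate. -/
theorem enorm_sum_signSum_sub_le [Fintype C] {𝔮 : Ideal (𝓞 K)} [Fintype (𝓞 K ⧸ 𝔮)] (h𝔮 : 𝔮 ≠ ⊥)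
    {𝔞 : C → Ideal (𝓞 K)} (h : ClassReps 𝔞) (hc : ∀ c, IsCoprime 𝔮 (𝔞 c)) {x : ℝ} (hx : 0 < x)
    {A : ℝ} (hA : 1 ≤ A) (l : logSpace K) {e : C → ℂ}
    {g : (𝓞 K ⧸ 𝔮) → ({w : InfinitePlace K // IsReal w} → ℤˣ) → ℂ}
    (he : ∀ c, ‖e c‖ ≤ 1) (hg : ∀ r σ, ‖g r σ‖ ≤ 1) :
    ‖(∑ c, e c / x * ∑' α : 𝔞 c, signSum A⁻¹ (x * Ideal.absNorm (𝔞 c)) l g α) -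
        (mainConst K 𝔮 : ℂ) * (∑ r, ∑ σ, g r σ) * ∑ c, e c‖ₑ ≤
      ENNReal.ofReal ((2 * (10 ^ 8 * A ^ 4)) ^ nK K) *
        ∑' p : Gen (dualOf 𝔮 𝔞), ENNReal.ofReal (prodDecay (x * Ideal.absNorm (𝔞 p.1)) p.2.1 l) := by
  have hA0 : 0 < A := by linarith
  have hN𝔮 := absNorm_pos h𝔮
  have hd := one_le_sqrt_discr (K := K)
  have hd0 : 0 < √|(discr K : ℝ)| := by linarith
  have hx' : (x : ℂ) ≠ 0 := Complex.ofReal_ne_zero.mpr hx.ne'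
  rw [ENNReal.tsum_sigma', tsum_fintype, Finset.mul_sum (Finset.univ : Finset C),
    Finset.mul_sum (Finset.univ : Finset C), ← Finset.sum_sub_distrib]
  refine (enorm_sum_le _ _).trans (Finset.sum_le_sum fun c _ => ?_)
  have hN := absNorm_pos (h.ne_bot c)
  set V : ℝ := (Ideal.absNorm 𝔮 * Ideal.absNorm (𝔞 c)) * (2⁻¹) ^ nrComplexPlaces K *
    √|(discr K : ℝ)| with hV
  have hV0 : 0 < V := by positivity
  have key := poisson_residue_sum h𝔮 (h.ne_bot c) (hc c) (inv_pos.mpr hA0)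
    (inv_le_one_of_one_le₀ hA) (mul_pos hx hN) l g hg hV
  have hVX : V⁻¹ * (x * Ideal.absNorm (𝔞 c)) * Real.pi ^ nrComplexPlaces K =
      x * mainConst K 𝔮 := by
    rw [hV, mainConst]
    field_simp
  rw [hVX] at key
  have hsplit : e c / x * ∑' α : 𝔞 c, signSum A⁻¹ (x * Ideal.absNorm (𝔞 c)) l g α -
      (mainConst K 𝔮 : ℂ) * (∑ r, ∑ σ, g r σ) * e c =
      e c / x * ((∑' α : 𝔞 c, signSum A⁻¹ (x * Ideal.absNorm (𝔞 c)) l g α) -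
        ((x * mainConst K 𝔮 : ℝ) : ℂ) * ∑ r, ∑ σ, g r σ) := by
    push_cast
    field_simp
  rw [hsplit, enorm_mul]
  have hex : ‖e c / x‖ₑ ≤ ENNReal.ofReal x⁻¹ := by
    rw [← ofReal_norm, norm_div, Complex.norm_real, Real.norm_of_nonneg hx.le]
    refine ENNReal.ofReal_le_ofReal ?_
    rw [div_eq_mul_inv]
    exact mul_le_of_le_one_left (inv_nonneg.mpr hx.le) (he c)
  refine (mul_le_mul' hex key).trans ?_
  rw [← mul_assoc, ← ENNReal.ofReal_mul (inv_nonneg.mpr hx.le)]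
  refine mul_le_mul' (ENNReal.ofReal_le_ofReal ?_) le_rfl
  have h2 : x⁻¹ * (V⁻¹ * Ideal.absNorm 𝔮 * 2 ^ nrRealPlaces K * (x * Ideal.absNorm (𝔞 c)) *
      (10 ^ 8 * A⁻¹⁻¹ ^ 4) ^ nK K) = (2 ^ nrRealPlaces K * 2 ^ nrComplexPlaces K) *
      (10 ^ 8 * A ^ 4) ^ nK K / √|(discr K : ℝ)| := by
    rw [hV, inv_inv]
    field_simp
    rw [one_div, inv_pow, inv_mul_cancel₀ (by positivity)]
  rw [h2, mul_pow 2]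
  refine (div_le_self (by positivity) hd).trans ?_
  exact mul_le_mul_of_nonneg_right nrPlaces_pow_le (by positivity)

theorem enorm_tsum_sub_main_le [Fintype C] {𝔮 : Ideal (𝓞 K)} [Fintype (𝓞 K ⧸ 𝔮)] (h𝔮 : 𝔮 ≠ ⊥)
    {𝔞 : C → Ideal (𝓞 K)} (h : ClassReps 𝔞) (hc : ∀ c, IsCoprime 𝔮 (𝔞 c)) {x : ℝ} (hx : 0 < x)
    {A : ℝ} (hA : 1 ≤ A) {Ψ : ℝ → ℝ} (hΨ : IsWeissWeight (nK K) A Ψ)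
    {f : Ideal (𝓞 K) → ℂ} {e : C → ℂ}
    {g : (𝓞 K ⧸ 𝔮) → ({w : InfinitePlace K // IsReal w} → ℤˣ) → ℂ}
    (he : ∀ c, ‖e c‖ ≤ 1) (hg : ∀ r σ, ‖g r σ‖ ≤ 1)
    (hfg : ∀ c (α : 𝓞 K), α ≠ 0 → ∀ I, Ideal.span {α} = I * 𝔞 c →
      f I = e c * g (Ideal.Quotient.mk 𝔮 α) (signVec (α : K))) :
    ‖(∑' I : {I : Ideal (𝓞 K) // I ≠ ⊥},
        f I.1 / (Ideal.absNorm I.1 : ℂ) * (Ψ (x / Ideal.absNorm I.1) : ℂ)) -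
        ((regulator K / torsionOrder K * mainConst K 𝔮 : ℝ) : ℂ) * (∑ r, ∑ σ, g r σ) *
          ∑ c, e c‖ₑ ≤
      ENNReal.ofReal ((2 * (10 ^ 8 * A ^ 4)) ^ nK K) *
        ∑' I : {I : Ideal (𝓞 K) // I ≠ ⊥}, ENNReal.ofReal (4 ^ nK K *
          (x * Ideal.absNorm I.1 / (DK K * Ideal.absNorm 𝔮)) ^ (-(3 / 2) : ℝ)) := by
  have hA0 : 0 < A := by linarith
  obtain ⟨hint, hval⟩ := integral_tsum_wgt h hx hA0 hΨ f
  set S := ∑' I : {I : Ideal (𝓞 K) // I ≠ ⊥},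
        f I.1 / (Ideal.absNorm I.1 : ℂ) * (Ψ (x / Ideal.absNorm I.1) : ℂ) with hS
  set L : ℂ := (mainConst K 𝔮 : ℂ) * (∑ r, ∑ σ, g r σ) * ∑ c, e c with hL
  have hvol : volume.real (unitFD K) = regulator K := by
    rw [measureReal_def, volume_unitFD, ENNReal.toReal_ofReal (regulator_pos K).le]
  have hfinv : volume (unitFD K) ≠ ⊤ := by rw [volume_unitFD]; exact ENNReal.ofReal_ne_top
  have hcint : IntegrableOn (fun _ => L) (unitFD K) := integrableOn_const hfinv
  have hw : (torsionOrder K : ℂ) ≠ 0 := Nat.cast_ne_zero.mpr (torsionOrder_ne_zero K)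
  have hsub : (torsionOrder K : ℂ) * (S - ((regulator K / torsionOrder K * mainConst K 𝔮 : ℝ) : ℂ) *
      (∑ r, ∑ σ, g r σ) * ∑ c, e c) = ∫ l in unitFD K, ((∑ c, e c / x * ∑' α : 𝔞 c,
        signSum A⁻¹ (x * Ideal.absNorm (𝔞 c)) l g α) - L) := by
    simp_rw [← tsum_gen_eq h hx (inv_pos.mpr hA0) _ hfg]
    rw [integral_sub hint hcint, hval, setIntegral_const, hvol, hL, Complex.real_smul]
    push_cast
    field_simp
  have hbound : (torsionOrder K : ℝ≥0∞) * ‖S - ((regulator K / torsionOrder K * mainConst K 𝔮 : ℝ) : ℂ) *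
      (∑ r, ∑ σ, g r σ) * ∑ c, e c‖ₑ ≤ (torsionOrder K : ℝ≥0∞) *
      (ENNReal.ofReal ((2 * (10 ^ 8 * A ^ 4)) ^ nK K) *
        ∑' I : {I : Ideal (𝓞 K) // I ≠ ⊥}, ENNReal.ofReal (4 ^ nK K *
          (x * Ideal.absNorm I.1 / (DK K * Ideal.absNorm 𝔮)) ^ (-(3 / 2) : ℝ))) := by
    have hwe : (torsionOrder K : ℝ≥0∞) = ‖(torsionOrder K : ℂ)‖ₑ := by
      rw [← ofReal_norm, Complex.norm_natCast, ENNReal.ofReal_natCast]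
    rw [hwe, ← enorm_mul, hsub, ← hwe]
    refine (enorm_integral_le_lintegral_enorm _).trans ?_
    refine (lintegral_mono fun l => enorm_sum_signSum_sub_le h𝔮 h hc hx hA l he hg).trans ?_
    rw [lintegral_const_mul' _ _ ENNReal.ofReal_ne_top, mul_left_comm (torsionOrder K : ℝ≥0∞)]
    exact mul_le_mul' le_rfl (lintegral_prodDecay_dual_le h𝔮 h hx)
  refine (ENNReal.mul_le_mul_iff_right ?_ (ENNReal.natCast_ne_top _)).mp hbound
  exact Nat.cast_ne_zero.mpr (torsionOrder_ne_zero K)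

end ClassSumBound

section CharacterData

open NumberField.InfinitePlace NumberField.mixedEmbedding
open scoped Classical

theorem mixedEmbedding_fst_comp (φ : K →+* ℝ) :
    ∃ w : {w : InfinitePlace K // IsReal w}, ∀ α : K, (mixedEmbedding K α).1 w = φ α := by
  have hφ : ComplexEmbedding.IsReal ((Complex.ofRealHom : ℝ →+* ℂ).comp φ) := by
    ext α
    simp
  refine ⟨⟨mk _, isReal_mk_iff.mpr hφ⟩, fun α => ?_⟩
  rw [mixedEmbedding_apply_isReal]
  have h := embedding_of_isReal_apply (isReal_mk_iff.mpr hφ) α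
  rw [embedding_mk_eq_of_isReal hφ] at h
  exact Complex.ofReal_injective h

theorem totPos_mul_of_signVec_eq {α β : 𝓞 K} (hα : α ≠ 0) (hβ : β ≠ 0)
    (h : signVec (α : K) = signVec (β : K)) : TotPos K (α * β) := by
  intro φ
  obtain ⟨w, hw⟩ := mixedEmbedding_fst_comp φ
  have hα' : φ (α : K) ≠ 0 := (map_ne_zero φ).mpr (RingOfIntegers.coe_ne_zero_iff.mpr hα)
  have hβ' : φ (β : K) ≠ 0 := (map_ne_zero φ).mpr (RingOfIntegers.coe_ne_zero_iff.mpr hβ)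
  have h1 := congrFun h w
  rw [signVec, signVec, hw, hw] at h1
  rw [map_mul, map_mul]
  change 0 < φ (α : K) * φ (β : K)
  split_ifs at h1 with ha hb hb
  · exact mul_pos ha hb
  · exact absurd h1 (by decide)
  · exact absurd h1 (by decide)
  · exact mul_pos_of_neg_of_neg (lt_of_le_of_ne (not_lt.mp ha) hα')
      (lt_of_le_of_ne (not_lt.mp hb) hβ')

theorem isCoprime_span_congr {𝔮 : Ideal (𝓞 K)} {α β : 𝓞 K} (h : α - β ∈ 𝔮)
    (hα : IsCoprime (Ideal.span {α}) 𝔮) : IsCoprime (Ideal.span {β}) 𝔮 := by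
  obtain ⟨i, hi, j, hj, hij⟩ := Ideal.isCoprime_iff_exists.mp hα
  obtain ⟨c, rfl⟩ := Ideal.mem_span_singleton'.mp hi
  rw [Ideal.isCoprime_iff_exists]
  exact ⟨c * β, Ideal.mem_span_singleton'.mpr ⟨c, rfl⟩, c * (α - β) + j,
    𝔮.add_mem (𝔮.mul_mem_left _ h) hj, by rw [← hij]; ring⟩

theorem HeckeChar.span_congr {𝔮 : Ideal (𝓞 K)} (h𝔮 : 𝔮 ≠ ⊥) (χ : HeckeChar K 𝔮) {α β : 𝓞 K}
    (hα : α ≠ 0) (hβ : β ≠ 0) (h : α - β ∈ 𝔮) (hs : signVec (α : K) = signVec (β : K)) :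
    χ.toFun (Ideal.span {α}) = χ.toFun (Ideal.span {β}) := by
  by_cases hc : IsCoprime (Ideal.span {α}) 𝔮
  · obtain ⟨γ, hγ, hγα, hγc⟩ := exists_totPos_inv h𝔮 hc
    have h1 : χ.toFun (Ideal.span {γ * γ * (α * α)}) = 1 := by
      refine χ.ray_one' _ ((hγ.mul hγ).mul (totPos_mul_of_signVec_eq hα hα rfl)) ?_
      have : γ * γ * (α * α) - 1 = (γ * α + 1) * (γ * α - 1) := by ring
      rw [this]
      exact 𝔮.mul_mem_left _ hγα
    have h2 : χ.toFun (Ideal.span {γ * γ * (α * β)}) = 1 := by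
      refine χ.ray_one' _ ((hγ.mul hγ).mul (totPos_mul_of_signVec_eq hα hβ hs)) ?_
      have : γ * γ * (α * β) - 1 = (γ * α + 1) * (γ * α - 1) - γ * γ * α * (α - β) := by ring
      rw [this]
      exact 𝔮.sub_mem (𝔮.mul_mem_left _ hγα) (𝔮.mul_mem_left _ h)
    have e1 : γ * γ * (α * α) = γ * γ * α * α := by ring
    have e2 : γ * γ * (α * β) = γ * γ * α * β := by ring
    rw [e1, ← Ideal.span_singleton_mul_span_singleton, χ.map_mul'] at h1
    rw [e2, ← Ideal.span_singleton_mul_span_singleton, χ.map_mul'] at h2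
    refine mul_left_cancel₀ ?_ (h1.trans h2.symm)
    intro h0
    rw [h0, zero_mul] at h1
    exact zero_ne_one h1
  · rw [χ.eq_zero' _ hc, χ.eq_zero' _ fun hc' => hc (isCoprime_span_congr ?_ hc')]
    rw [← neg_sub]
    exact 𝔮.neg_mem h

theorem HeckeChar.norm_le_one {𝔮 : Ideal (𝓞 K)} (χ : HeckeChar K 𝔮) (𝔞 : Ideal (𝓞 K)) :
    ‖χ.toFun 𝔞‖ ≤ 1 := by
  by_cases h : IsCoprime 𝔞 𝔮
  · exact (χ.norm_one' 𝔞 h).le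
  · rw [χ.eq_zero' 𝔞 h, norm_zero]; exact zero_le_one

/-- The function on residues and signs through which a Hecke character acts on principal ideals. -/
def HeckeChar.signFun {𝔮 : Ideal (𝓞 K)} (χ : HeckeChar K 𝔮) (r : 𝓞 K ⧸ 𝔮)
    (σ : {w : InfinitePlace K // IsReal w} → ℤˣ) : ℂ :=
  if h : ∃ α : 𝓞 K, α ≠ 0 ∧ Ideal.Quotient.mk 𝔮 α = r ∧ signVec (α : K) = σ then
    χ.toFun (Ideal.span {h.choose}) else 0

theorem HeckeChar.norm_signFun_le {𝔮 : Ideal (𝓞 K)} (χ : HeckeChar K 𝔮) (r : 𝓞 K ⧸ 𝔮)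
    (σ : {w : InfinitePlace K // IsReal w} → ℤˣ) : ‖χ.signFun r σ‖ ≤ 1 := by
  unfold HeckeChar.signFun
  split_ifs with h
  · exact χ.norm_le_one _
  · rw [norm_zero]; exact zero_le_one

theorem HeckeChar.signFun_mk {𝔮 : Ideal (𝓞 K)} (h𝔮 : 𝔮 ≠ ⊥) (χ : HeckeChar K 𝔮) {α : 𝓞 K}
    (hα : α ≠ 0) : χ.signFun (Ideal.Quotient.mk 𝔮 α) (signVec (α : K)) =
      χ.toFun (Ideal.span {α}) := by
  have h : ∃ β : 𝓞 K, β ≠ 0 ∧ Ideal.Quotient.mk 𝔮 β = Ideal.Quotient.mk 𝔮 α ∧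
      signVec (β : K) = signVec (α : K) := ⟨α, hα, rfl, rfl⟩
  rw [HeckeChar.signFun, dif_pos h]
  exact χ.span_congr h𝔮 h.choose_spec.1 hα (Ideal.Quotient.eq.mp h.choose_spec.2.1) h.choose_spec.2.2

theorem isUnit_mk_iff {𝔮 : Ideal (𝓞 K)} (α : 𝓞 K) :
    IsUnit (Ideal.Quotient.mk 𝔮 α) ↔ IsCoprime (Ideal.span {α}) 𝔮 := by
  rw [Ideal.isCoprime_iff_exists, isUnit_iff_exists_inv]
  constructor
  · rintro ⟨b, hb⟩
    obtain ⟨b, rfl⟩ := Ideal.Quotient.mk_surjective b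
    rw [← map_mul, ← map_one (Ideal.Quotient.mk 𝔮), Ideal.Quotient.eq] at hb
    exact ⟨b * α, Ideal.mem_span_singleton'.mpr ⟨b, rfl⟩, -(α * b - 1), 𝔮.neg_mem hb, by ring⟩
  · rintro ⟨i, hi, j, hj, hij⟩
    obtain ⟨c, rfl⟩ := Ideal.mem_span_singleton'.mp hi
    refine ⟨Ideal.Quotient.mk 𝔮 c, ?_⟩
    rw [← map_mul, ← map_one (Ideal.Quotient.mk 𝔮), Ideal.Quotient.eq, ← hij]
    have : α * c - (c * α + j) = -j := by ring
    rw [this]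
    exact 𝔮.neg_mem hj

theorem HeckeChar.eq_inv_mul {𝔮 : Ideal (𝓞 K)} (χ : HeckeChar K 𝔮) {I 𝔞 : Ideal (𝓞 K)} {α : 𝓞 K}
    (ha : IsCoprime 𝔮 𝔞) (h : Ideal.span {α} = I * 𝔞) :
    χ.toFun I = (χ.toFun 𝔞)⁻¹ * χ.toFun (Ideal.span {α}) := by
  rw [h, χ.map_mul', mul_comm (χ.toFun I), inv_mul_cancel_left₀ (χ.ne_zero ha.symm)]

end CharacterData

section ClassReps

open nonZeroDivisors

theorem ClassReps.mul_left {C : Type*} {𝔞 : C → Ideal (𝓞 K)} (h : ClassReps 𝔞) {𝔟 : Ideal (𝓞 K)}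
    (hb : 𝔟 ≠ ⊥) : ClassReps fun c => 𝔟 * 𝔞 c where
  ne_bot c := mul_ne_zero hb (h.ne_bot c)
  eq_of c c' x hx hcc := by
    refine h.eq_of c c' x hx ?_
    rw [FractionalIdeal.coeIdeal_mul, FractionalIdeal.coeIdeal_mul, mul_left_comm] at hcc
    exact mul_left_cancel₀ (FractionalIdeal.coeIdeal_ne_zero.mpr hb) hcc
  exists_gen I hI := by
    obtain ⟨c, β, hβ⟩ := h.exists_gen (I * 𝔟) (mul_ne_zero hI hb)
    refine ⟨c, β, ?_⟩
    rw [← hβ, FractionalIdeal.coeIdeal_mul, FractionalIdeal.coeIdeal_mul, mul_assoc]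

/-- Every ideal class has an integral representative coprime to a given modulus. -/
theorem exists_classReps {𝔮 : Ideal (𝓞 K)} (h𝔮 : 𝔮 ≠ ⊥) :
    ∃ 𝔞 : ClassGroup (𝓞 K) → Ideal (𝓞 K), ClassReps 𝔞 ∧ ∀ c, IsCoprime 𝔮 (𝔞 c) := by
  obtain ⟨P, hP0, hP1⟩ := Ring.not_isField_iff_exists_ideal_bot_lt_and_lt_top.mp
    (RingOfIntegers.not_isField K)
  have h1 : ∀ c : ClassGroup (𝓞 K), ∃ 𝔠 : (Ideal (𝓞 K))⁰, ClassGroup.mk0 𝔠 = c ∧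
      IsCoprime 𝔮 (𝔠 : Ideal (𝓞 K)) := by
    intro c
    obtain ⟨J, hJ⟩ := ClassGroup.mk0_surjective c⁻¹
    have hJ0 : (J : Ideal (𝓞 K)) ≠ ⊥ := nonZeroDivisors.coe_ne_zero J
    obtain ⟨α, 𝔠, -, -, hα, hc⟩ := exists_mul_eq_span (𝔤 := ⊤) (𝔮 := 𝔮 * P) top_ne_bot
      (mul_ne_zero h𝔮 hP0.ne') hJ0 (by rw [Ideal.isCoprime_iff_sup_eq, sup_top_eq])
    have hc0 : 𝔠 ≠ ⊥ := by
      rintro rfl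
      rw [Ideal.isCoprime_iff_sup_eq, bot_sup_eq] at hc
      exact hP1.ne (top_le_iff.mp (hc ▸ Ideal.mul_le_right))
    refine ⟨⟨𝔠, mem_nonZeroDivisors_of_ne_zero hc0⟩, ?_,
      (isCoprime_of_le_right hc Ideal.mul_le_left).symm⟩
    have h2 : ClassGroup.mk0 J * ClassGroup.mk0 ⟨𝔠, mem_nonZeroDivisors_of_ne_zero hc0⟩ = 1 := by
      rw [← map_mul]
      refine (ClassGroup.mk0_eq_one_iff (Submonoid.mul_mem _ J.2
        (mem_nonZeroDivisors_of_ne_zero hc0))).mpr ⟨α, hα⟩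
    rw [hJ, inv_mul_eq_one] at h2
    exact h2.symm
  choose 𝔠 hmk hcop using h1
  refine ⟨fun c => 𝔠 c, ⟨fun c => nonZeroDivisors.coe_ne_zero _, fun c c' x hx h => ?_,
    fun I hI => ?_⟩, hcop⟩
  · rw [← hmk c, ← hmk c']
    exact ((ClassGroup.mk0_eq_mk0_iff_exists_fraction_ring K).mpr ⟨x, hx, h.symm⟩).symm
  · set J : (Ideal (𝓞 K))⁰ := ⟨I, mem_nonZeroDivisors_of_ne_zero hI⟩ with hJ
    refine ⟨(ClassGroup.mk0 J)⁻¹, ?_⟩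
    set L := 𝔠 (ClassGroup.mk0 J)⁻¹ with hL
    have h2 : ClassGroup.mk0 (J * L) = 1 := by
      rw [map_mul, hL, hmk, mul_inv_cancel]
    obtain ⟨α, h3⟩ := (ClassGroup.mk0_eq_one_iff (Submonoid.mul_mem _ J.2 L.2)).mp h2
    refine ⟨(α : K), ?_⟩
    change I * (L : Ideal (𝓞 K)) = Ideal.span {α} at h3
    rw [← FractionalIdeal.coeIdeal_mul, h3, FractionalIdeal.coeIdeal_span_singleton]

end ClassReps

section ZetaBound

open UniqueFactorizationMonoid
open scoped Classical ENNReal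

/-- The rational prime below a prime ideal. -/
def below (P : Ideal (𝓞 K)) : ℕ := Ideal.absNorm (Ideal.under ℤ P)

theorem below_prime {P : Ideal (𝓞 K)} (hP : Prime P) : (below P).Prime := by
  have := Ideal.isPrime_of_prime hP
  have : NeZero P := ⟨hP.ne_zero⟩
  exact Nat.absNorm_under_prime P

theorem below_le_absNorm {P : Ideal (𝓞 K)} (hP : Prime P) : below P ≤ Ideal.absNorm P :=
  Nat.le_of_dvd (Nat.pos_of_ne_zero fun h => hP.ne_zero (Ideal.absNorm_eq_zero_iff.mp h))
    (Int.absNorm_under_dvd_absNorm P)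

/-- The primes above a given rational prime can be labelled by `Fin n`. -/
theorem exists_label (K : Type*) [Field K] [NumberField K] :
    ∃ lab : Ideal (𝓞 K) → Fin (nK K), ∀ P P' : Ideal (𝓞 K), Prime P → Prime P' →
      below P = below P' → lab P = lab P' → P = P' := by
  have h1 : ∀ p : ℕ, ∃ e : Ideal (𝓞 K) → Fin (nK K), p.Prime → ∀ P P' : Ideal (𝓞 K),
      P ∈ IsDedekindDomain.primesOverFinset (Ideal.span {(p : ℤ)}) (𝓞 K) →
      P' ∈ IsDedekindDomain.primesOverFinset (Ideal.span {(p : ℤ)}) (𝓞 K) →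
      e P = e P' → P = P' := by
    intro p
    have hn : 0 < nK K := Module.finrank_pos
    by_cases hp : p.Prime
    · have hpi : Prime (p : ℤ) := Nat.prime_iff_prime_int.mp hp
      have : (Ideal.span {(p : ℤ)}).IsMaximal :=
        PrincipalIdealRing.isMaximal_of_irreducible hpi.irreducible
      have hcard : Fintype.card (IsDedekindDomain.primesOverFinset (Ideal.span {(p : ℤ)}) (𝓞 K)) ≤
          Fintype.card (Fin (nK K)) := by
        rw [Fintype.card_coe, Fintype.card_fin]
        exact Ideal.card_primesOverFinset_le_finrank (𝓞 K) ℚ K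
          (by rw [ne_eq, Ideal.span_singleton_eq_bot]; exact hpi.ne_zero)
      obtain ⟨e⟩ := Function.Embedding.nonempty_of_card_le hcard
      refine ⟨fun P => if h : P ∈ IsDedekindDomain.primesOverFinset (Ideal.span {(p : ℤ)}) (𝓞 K)
        then e ⟨P, h⟩ else ⟨0, hn⟩, fun _ P P' hP hP' h => ?_⟩
      simp only [dif_pos hP, dif_pos hP'] at h
      exact congrArg Subtype.val (e.injective h)
    · exact ⟨fun _ => ⟨0, hn⟩, fun h => absurd h hp⟩
  choose e he using h1
  have hmem : ∀ P : Ideal (𝓞 K), Prime P →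
      P ∈ IsDedekindDomain.primesOverFinset (Ideal.span {(below P : ℤ)}) (𝓞 K) := by
    intro P hP
    have hpi : Prime (below P : ℤ) := Nat.prime_iff_prime_int.mp (below_prime hP)
    have : (Ideal.span {(below P : ℤ)}).IsMaximal :=
      PrincipalIdealRing.isMaximal_of_irreducible hpi.irreducible
    refine (IsDedekindDomain.mem_primesOverFinset_iff
      (by rw [ne_eq, Ideal.span_singleton_eq_bot]; exact hpi.ne_zero) _).mpr
      ⟨Ideal.isPrime_of_prime hP, Int.liesOver_span_absNorm P⟩
  refine ⟨fun P => e (below P) P, fun P P' hP hP' hb hl => ?_⟩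
  have hm' := hmem P' hP'
  rw [← hb] at hm'
  simp only [← hb] at hl
  exact he (below P) (below_prime hP) P P' (hmem P hP) hm' hl

theorem prod_prod_filter {α : Type*} {n : ℕ} (lab : α → Fin n) (f : α → ℕ) (s : Multiset α) :
    ∏ j, ((s.filter fun a => lab a = j).map f).prod = (s.map f).prod := by
  induction s using Multiset.induction_on with
  | empty => simp
  | cons a s ih =>
    rw [Multiset.map_cons, Multiset.prod_cons, ← ih,
      ← Finset.mul_prod_erase _ _ (Finset.mem_univ (lab a)),
      ← Finset.mul_prod_erase _ _ (Finset.mem_univ (lab a)), Multiset.filter_cons_of_pos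
        (p := fun b => lab b = lab a) _ rfl,
      Multiset.map_cons, Multiset.prod_cons, mul_assoc]
    congr 2
    refine Finset.prod_congr rfl fun j hj => ?_
    rw [Multiset.filter_cons_of_neg (p := fun b => lab b = j) _ (Finset.ne_of_mem_erase hj).symm]

/-- Ideals inject into `n`-tuples of positive integers whose product is at most the norm. -/
theorem exists_tuple (K : Type*) [Field K] [NumberField K] :
    ∃ φ : {I : Ideal (𝓞 K) // I ≠ ⊥} → Fin (nK K) → ℕ, Function.Injective φ ∧
      (∀ I j, 0 < φ I j) ∧ ∀ I, ∏ j, φ I j ≤ Ideal.absNorm I.1 := by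
  obtain ⟨lab, hlab⟩ := exists_label K
  have hpr : ∀ (I : Ideal (𝓞 K)) (j : Fin (nK K)), ∀ p ∈
      (((normalizedFactors I).filter fun P => lab P = j).map below), Prime p := by
    intro I j p hp
    obtain ⟨P, hP, rfl⟩ := Multiset.mem_map.mp hp
    exact Nat.prime_iff.mp (below_prime (prime_of_normalized_factor P (Multiset.mem_filter.mp hP).1))
  refine ⟨fun I j => (((normalizedFactors I.1).filter fun P => lab P = j).map below).prod,
    fun I I' h => ?_, fun I j => ?_, fun I => ?_⟩
  · have hcount : ∀ (J P : Ideal (𝓞 K)), Prime P → (normalizedFactors J).count P =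
        (((normalizedFactors J).filter fun P' => lab P' = lab P).map below).count (below P) := by
      intro J P hP
      rw [Multiset.count_map, Multiset.filter_filter, Multiset.count_eq_card_filter_eq]
      congr 1
      refine Multiset.filter_congr fun P' hP' => ⟨?_, fun h => ?_⟩
      · rintro rfl; exact ⟨rfl, rfl⟩
      · exact hlab _ _ hP (prime_of_normalized_factor P' hP') h.1 h.2.symm
    have hnf : normalizedFactors I.1 = normalizedFactors I'.1 := by
      ext P
      by_cases hP : Prime P
      · rw [hcount _ _ hP, hcount _ _ hP, ← normalizedFactors_prod_of_prime (hpr I.1 (lab P)),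
          ← normalizedFactors_prod_of_prime (hpr I'.1 (lab P))]
        have := congrFun h (lab P)
        simp only at this
        rw [this]
      · rw [Multiset.count_eq_zero_of_notMem fun h => hP (prime_of_normalized_factor P h),
          Multiset.count_eq_zero_of_notMem fun h => hP (prime_of_normalized_factor P h)]
    refine Subtype.ext ?_
    rw [← Ideal.prod_normalizedFactors_eq_self I.2, hnf, Ideal.prod_normalizedFactors_eq_self I'.2]
  · exact Nat.pos_of_ne_zero (Multiset.prod_ne_zero fun h0 => (hpr I.1 j 0 h0).ne_zero rfl)
  · rw [prod_prod_filter]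
    conv_rhs => rw [← Ideal.prod_normalizedFactors_eq_self I.2, map_multiset_prod]
    refine Multiset.prod_map_le_prod_map₀ _ _ (fun _ _ => Nat.zero_le _) fun P hP => ?_
    exact below_le_absNorm (prime_of_normalized_factor P hP)

theorem tsum_absNorm_rpow_le {s : ℝ} (hs : 1 < s) :
    ∑' I : {I : Ideal (𝓞 K) // I ≠ ⊥}, ENNReal.ofReal ((Ideal.absNorm I.1 : ℝ) ^ (-s)) ≤
      ENNReal.ofReal ((∑' m : ℕ, (m : ℝ) ^ (-s)) ^ nK K) := by
  obtain ⟨φ, hφ, hpos, hle⟩ := exists_tuple K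
  have hsum : Summable fun m : ℕ => (m : ℝ) ^ (-s) := Real.summable_nat_rpow.mpr (by linarith)
  rw [ENNReal.tsum_eq_iSup_sum]
  refine iSup_le fun F => ?_
  rw [← ENNReal.ofReal_sum_of_nonneg fun _ _ => by positivity]
  refine ENNReal.ofReal_le_ofReal ?_
  obtain ⟨N, hN⟩ : ∃ N, ∀ I ∈ F, ∀ j, φ I j < N := by
    refine ⟨F.sup (fun I => Finset.univ.sup fun j => φ I j) + 1, fun I hI j => Nat.lt_succ_of_le ?_⟩
    exact (Finset.le_sup (f := fun j => φ I j) (Finset.mem_univ j)).trans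
      (Finset.le_sup (f := fun I => Finset.univ.sup fun j => φ I j) hI)
  calc ∑ I ∈ F, (Ideal.absNorm I.1 : ℝ) ^ (-s)
      ≤ ∑ I ∈ F, ∏ j, ((φ I j : ℕ) : ℝ) ^ (-s) := by
        refine Finset.sum_le_sum fun I _ => ?_
        rw [Real.finsetProd_rpow _ _ fun _ _ => Nat.cast_nonneg _]
        refine Real.rpow_le_rpow_of_nonpos (Finset.prod_pos fun j _ => Nat.cast_pos.mpr (hpos I j))
          (by exact_mod_cast hle I) (by linarith)
    _ = ∑ q ∈ F.image φ, ∏ j, ((q j : ℕ) : ℝ) ^ (-s) :=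
        (Finset.sum_image (f := fun q : Fin (nK K) → ℕ => ∏ j, ((q j : ℕ) : ℝ) ^ (-s))
          hφ.injOn).symm
    _ ≤ ∑ q ∈ Fintype.piFinset fun _ => Finset.range N, ∏ j, ((q j : ℕ) : ℝ) ^ (-s) := by
        refine Finset.sum_le_sum_of_subset_of_nonneg ?_ fun _ _ _ => by positivity
        intro q hq
        obtain ⟨I, hI, rfl⟩ := Finset.mem_image.mp hq
        exact Fintype.mem_piFinset.mpr fun j => Finset.mem_range.mpr (hN I hI j)
    _ = (∑ m ∈ Finset.range N, (m : ℝ) ^ (-s)) ^ nK K := by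
        rw [← Finset.prod_univ_sum (fun _ => Finset.range N) fun _ m => ((m : ℕ) : ℝ) ^ (-s)]
        simp
    _ ≤ (∑' m : ℕ, (m : ℝ) ^ (-s)) ^ nK K :=
        pow_le_pow_left₀ (Finset.sum_nonneg fun _ _ => by positivity)
          (hsum.sum_le_tsum _ fun _ _ => by positivity) _

theorem summable_absNorm_rpow {s : ℝ} (hs : 1 < s) :
    Summable fun I : {I : Ideal (𝓞 K) // I ≠ ⊥} => (Ideal.absNorm I.1 : ℝ) ^ (-s) := by
  refine summable_of_sum_le (c := (∑' m : ℕ, (m : ℝ) ^ (-s)) ^ nK K) (fun _ => by positivity) ?_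
  intro F
  have h := (ENNReal.sum_le_tsum F).trans (tsum_absNorm_rpow_le (K := K) hs)
  rw [← ENNReal.ofReal_sum_of_nonneg fun _ _ => by positivity] at h
  refine (ENNReal.ofReal_le_ofReal_iff (pow_nonneg (tsum_nonneg fun m => ?_) _)).mp h
  positivity

end ZetaBound

section Residue

open scoped Real

theorem LSeries_natCard_eq (σ : ℝ) (hσ : 1 < σ) :
    LSeries (fun n => Nat.card {I : Ideal (𝓞 K) // Ideal.absNorm I = n}) (σ : ℂ) =
      ((∑' 𝔞 : {I : Ideal (𝓞 K) // I ≠ ⊥}, (Ideal.absNorm 𝔞.1 : ℝ) ^ (-σ) : ℝ) : ℂ) := by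
  set N : {I : Ideal (𝓞 K) // I ≠ ⊥} → ℕ := fun I => Ideal.absNorm I.1 with hN
  have hsum := summable_absNorm_rpow (K := K) hσ
  have hsum' : Summable fun p : Σ n : ℕ, {I // N I = n} => (N p.2.1 : ℝ) ^ (-σ) :=
    (Equiv.sigmaFiberEquiv N).summable_iff.mpr hsum
  have h1 : ∑' 𝔞 : {I : Ideal (𝓞 K) // I ≠ ⊥}, (Ideal.absNorm 𝔞.1 : ℝ) ^ (-σ) =
      ∑' n : ℕ, ∑' I : {I // N I = n}, (N I.1 : ℝ) ^ (-σ) := by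
    refine ((Equiv.sigmaFiberEquiv N).tsum_eq fun I => (N I : ℝ) ^ (-σ)).symm.trans ?_
    exact hsum'.tsum_sigma
  rw [h1, LSeries, Complex.ofReal_tsum]
  refine tsum_congr fun n => ?_
  rcases Nat.eq_zero_or_pos n with rfl | hn
  · have : IsEmpty {I // N I = 0} :=
      ⟨fun I => I.1.2 (Ideal.absNorm_eq_zero_iff.mp I.2)⟩
    rw [LSeries.term_zero, tsum_empty, Complex.ofReal_zero]
  · have e : {I : Ideal (𝓞 K) // Ideal.absNorm I = n} ≃ {I // N I = n} :=
      { toFun := fun I => ⟨⟨I.1, fun h => hn.ne' (by rw [← I.2, h, Ideal.absNorm_bot])⟩, I.2⟩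
        invFun := fun I => ⟨I.1.1, I.2⟩
        left_inv := fun _ => rfl
        right_inv := fun _ => rfl }
    have h2 : ∑' I : {I // N I = n}, (N I.1 : ℝ) ^ (-σ) =
        Nat.card {I // N I = n} * (n : ℝ) ^ (-σ) := by
      rw [tsum_congr fun I : {I // N I = n} => by rw [I.2], tsum_const, nsmul_eq_mul]
    rw [h2, LSeries.term_of_ne_zero hn.ne', Nat.card_congr e, Complex.ofReal_mul,
      Complex.ofReal_cpow (Nat.cast_nonneg _), Complex.ofReal_neg, Complex.ofReal_natCast,
      Complex.ofReal_natCast, Complex.cpow_neg, div_eq_mul_inv]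

theorem IsResidue.eq_dedekindZeta_residue {κ : ℝ} (h : IsResidue K κ) :
    κ = dedekindZeta_residue K := by
  refine Complex.ofReal_injective (tendsto_nhds_unique
    ((Complex.continuous_ofReal.tendsto κ).comp h)
    ((tendsto_sub_one_mul_dedekindZeta_nhdsGT K).congr' ?_))
  filter_upwards [self_mem_nhdsWithin] with σ hσ
  rw [Function.comp_apply, Complex.ofReal_mul, dedekindZeta, LSeries_natCard_eq σ hσ,
    Complex.ofReal_sub, Complex.ofReal_one]

end Residue

section MainTerm

open NumberField.InfinitePlace NumberField.Units
open scoped Classical ENNReal Real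

/-- The smoothed sum of `f (𝔫) / N𝔫`. -/
def smoothSum (f : Ideal (𝓞 K) → ℂ) (Ψ : ℝ → ℝ) (x : ℝ) : ℂ :=
  ∑' I : {I : Ideal (𝓞 K) // I ≠ ⊥},
    f I.1 / (Ideal.absNorm I.1 : ℂ) * (Ψ (x / Ideal.absNorm I.1) : ℂ)

/-- The bound for the error term in the smoothed sum. -/
def errBound (𝔮 : Ideal (𝓞 K)) (A x : ℝ) : ℝ :=
  (8 * 10 ^ 8 * (∑' m : ℕ, (m : ℝ) ^ (-(3 / 2) : ℝ)) * A ^ 4) ^ nK K *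
    ((DK K * Ideal.absNorm 𝔮 : ℝ) ^ (3 / 2 : ℝ) * x ^ (-(3 / 2) : ℝ))

theorem errBound_nonneg (𝔮 : Ideal (𝓞 K)) (A : ℝ) {x : ℝ} (hx : 0 < x) : 0 ≤ errBound 𝔮 A x := by
  have : 0 ≤ ∑' m : ℕ, (m : ℝ) ^ (-(3 / 2) : ℝ) := tsum_nonneg fun m => by positivity
  unfold errBound
  positivity

theorem norm_smoothSum_sub_le {C : Type*} [Fintype C] {𝔮 : Ideal (𝓞 K)} [Fintype (𝓞 K ⧸ 𝔮)]
    (h𝔮 : 𝔮 ≠ ⊥) {𝔞 : C → Ideal (𝓞 K)} (h : ClassReps 𝔞) (hc : ∀ c, IsCoprime 𝔮 (𝔞 c)) {x : ℝ}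
    (hx : 0 < x) {A : ℝ} (hA : 1 ≤ A) {Ψ : ℝ → ℝ} (hΨ : IsWeissWeight (nK K) A Ψ)
    {f : Ideal (𝓞 K) → ℂ} {e : C → ℂ}
    {g : (𝓞 K ⧸ 𝔮) → ({w : InfinitePlace K // IsReal w} → ℤˣ) → ℂ}
    (he : ∀ c, ‖e c‖ ≤ 1) (hg : ∀ r σ, ‖g r σ‖ ≤ 1)
    (hfg : ∀ c (α : 𝓞 K), α ≠ 0 → ∀ I, Ideal.span {α} = I * 𝔞 c →
      f I = e c * g (Ideal.Quotient.mk 𝔮 α) (signVec (α : K))) :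
    ‖smoothSum f Ψ x - ((regulator K / torsionOrder K * mainConst K 𝔮 : ℝ) : ℂ) *
      (∑ r, ∑ σ, g r σ) * ∑ c, e c‖ ≤ errBound 𝔮 A x := by
  have hZ : 0 ≤ ∑' m : ℕ, (m : ℝ) ^ (-(3 / 2) : ℝ) := tsum_nonneg fun m => by positivity
  have h1 := enorm_tsum_sub_main_le h𝔮 h hc hx hA hΨ he hg hfg
  rw [← ofReal_norm] at h1
  refine (ENNReal.ofReal_le_ofReal_iff (errBound_nonneg 𝔮 A hx)).mp (h1.trans ?_)
  set c₀ : ℝ := 4 ^ nK K * (x ^ (-(3 / 2) : ℝ) * (DK K * Ideal.absNorm 𝔮 : ℝ) ^ (3 / 2 : ℝ)) with hc₀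
  have hc₀' : 0 ≤ c₀ := by positivity
  have h2 : ∀ I : {I : Ideal (𝓞 K) // I ≠ ⊥}, ENNReal.ofReal (4 ^ nK K *
      (x * Ideal.absNorm I.1 / (DK K * Ideal.absNorm 𝔮)) ^ (-(3 / 2) : ℝ)) =
      ENNReal.ofReal c₀ * ENNReal.ofReal ((Ideal.absNorm I.1 : ℝ) ^ (-(3 / 2) : ℝ)) := by
    intro I
    rw [← ENNReal.ofReal_mul hc₀', Real.div_rpow (by positivity) (by positivity),
      Real.mul_rpow hx.le (Nat.cast_nonneg _),
      Real.rpow_neg (by positivity : (0 : ℝ) ≤ DK K * Ideal.absNorm 𝔮), div_inv_eq_mul, hc₀]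
    congr 1
    ring
  rw [tsum_congr h2, ENNReal.tsum_mul_left]
  refine (mul_le_mul_right (mul_le_mul_right (tsum_absNorm_rpow_le (by norm_num)) _) _).trans ?_
  rw [← ENNReal.ofReal_mul hc₀', ← ENNReal.ofReal_mul (by positivity)]
  refine ENNReal.ofReal_le_ofReal (le_of_eq ?_)
  rw [errBound, hc₀]
  have : (8 * 10 ^ 8 * (∑' m : ℕ, (m : ℝ) ^ (-(3 / 2) : ℝ)) * A ^ 4) =
      2 * (10 ^ 8 * A ^ 4) * 4 * ∑' m : ℕ, (m : ℝ) ^ (-(3 / 2) : ℝ) := by ring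
  rw [this]
  simp only [mul_pow]
  ring

theorem tendsto_errBound (𝔮 : Ideal (𝓞 K)) (A : ℝ) :
    Tendsto (errBound 𝔮 A) atTop (𝓝 0) := by
  have h := (tendsto_rpow_neg_atTop (y := 3 / 2) (by norm_num)).const_mul
    ((8 * 10 ^ 8 * (∑' m : ℕ, (m : ℝ) ^ (-(3 / 2) : ℝ)) * A ^ 4) ^ nK K *
      (DK K * Ideal.absNorm 𝔮 : ℝ) ^ (3 / 2 : ℝ))
  rw [mul_zero] at h
  refine h.congr fun x => ?_
  rw [errBound, mul_assoc]

theorem HeckeChar.norm_smoothSum_sub_le {𝔮 : Ideal (𝓞 K)} [Fintype (𝓞 K ⧸ 𝔮)] (χ : HeckeChar K 𝔮)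
    (h𝔮 : 𝔮 ≠ ⊥) {𝔞 : ClassGroup (𝓞 K) → Ideal (𝓞 K)} (h : ClassReps 𝔞)
    (hc : ∀ c, IsCoprime 𝔮 (𝔞 c)) {x : ℝ} (hx : 0 < x) {A : ℝ} (hA : 1 ≤ A) {Ψ : ℝ → ℝ}
    (hΨ : IsWeissWeight (nK K) A Ψ) :
    ‖smoothSum χ.toFun Ψ x - ((regulator K / torsionOrder K * mainConst K 𝔮 : ℝ) : ℂ) *
      (∑ r, ∑ σ, χ.signFun r σ) * ∑ c, (χ.toFun (𝔞 c))⁻¹‖ ≤ errBound 𝔮 A x :=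
  RTZ.norm_smoothSum_sub_le h𝔮 h hc hx hA hΨ
    (fun c => by rw [norm_inv, χ.norm_one' _ (hc c).symm, inv_one]) χ.norm_signFun_le
    fun c α hα I hI => by rw [χ.eq_inv_mul (hc c) hI, χ.signFun_mk h𝔮 hα]

theorem HeckeChar.main_eq_zero {𝔮 : Ideal (𝓞 K)} [Fintype (𝓞 K ⧸ 𝔮)] (χ : HeckeChar K 𝔮)
    (hχ : ¬ IsTrivialChar χ) (h𝔮 : 𝔮 ≠ ⊥) {𝔞 : ClassGroup (𝓞 K) → Ideal (𝓞 K)} (h : ClassReps 𝔞)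
    (hc : ∀ c, IsCoprime 𝔮 (𝔞 c)) {A : ℝ} (hA : 1 ≤ A) {Ψ : ℝ → ℝ}
    (hΨ : IsWeissWeight (nK K) A Ψ) :
    ((regulator K / torsionOrder K * mainConst K 𝔮 : ℝ) : ℂ) *
      (∑ r, ∑ σ, χ.signFun r σ) * ∑ c, (χ.toFun (𝔞 c))⁻¹ = 0 := by
  unfold IsTrivialChar at hχ
  push Not at hχ
  obtain ⟨𝔟, hb, hb1⟩ := hχ
  have hb0 : 𝔟 ≠ ⊥ := by
    rintro rfl
    have h2 := χ.map_mul' ⊥ ⊥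
    rw [Ideal.bot_mul] at h2
    exact hb1 (mul_left_cancel₀ (χ.ne_zero hb) (by rw [← h2, mul_one]))
  have key : ∀ {𝔞 : ClassGroup (𝓞 K) → Ideal (𝓞 K)}, ClassReps 𝔞 → (∀ c, IsCoprime 𝔮 (𝔞 c)) →
      Tendsto (smoothSum χ.toFun Ψ) atTop (𝓝 (((regulator K / torsionOrder K * mainConst K 𝔮 : ℝ) :
        ℂ) * (∑ r, ∑ σ, χ.signFun r σ) * ∑ c, (χ.toFun (𝔞 c))⁻¹)) := by
    intro 𝔞 h hc
    rw [tendsto_iff_norm_sub_tendsto_zero]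
    refine squeeze_zero' (Eventually.of_forall fun _ => norm_nonneg _) ?_ (tendsto_errBound 𝔮 A)
    filter_upwards [eventually_gt_atTop 0] with x hx
    exact χ.norm_smoothSum_sub_le h𝔮 h hc hx hA hΨ
  have h3 := tendsto_nhds_unique (key h hc)
    (key (h.mul_left hb0) fun c => hb.symm.mul_right (hc c))
  simp only [χ.map_mul', mul_inv, ← Finset.mul_sum] at h3
  set M := ((regulator K / torsionOrder K * mainConst K 𝔮 : ℝ) : ℂ) *
      (∑ r, ∑ σ, χ.signFun r σ) with hM
  rw [mul_left_comm] at h3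
  have h4 : (1 - (χ.toFun 𝔟)⁻¹) * (M * ∑ c, (χ.toFun (𝔞 c))⁻¹) = 0 := by
    rw [sub_mul, one_mul, sub_eq_zero]
    exact h3
  refine (mul_eq_zero.mp h4).resolve_left fun h5 => hb1 ?_
  rw [sub_eq_zero] at h5
  exact inv_eq_one.mp h5.symm

theorem sum_sum_isUnit {R S : Type*} [CommRing R] [Fintype R] [Fintype S] :
    ∑ r : R, ∑ _σ : S, (if IsUnit r then (1 : ℂ) else 0) =
      Fintype.card S * (Nat.card Rˣ : ℂ) := by
  simp only [Finset.sum_const, nsmul_eq_mul, ← Finset.mul_sum, Finset.card_univ]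
  congr 1
  have e : Rˣ ≃ {r : R // IsUnit r} := Equiv.ofBijective (fun u => ⟨u, u.isUnit⟩)
    ⟨fun u v h => Units.ext (congrArg Subtype.val h), fun r => ⟨r.2.unit, Subtype.ext rfl⟩⟩
  rw [Finset.sum_boole, Nat.card_congr e, Nat.card_eq_fintype_card, Fintype.card_subtype]

theorem main_trivial_eq (𝔮 : Ideal (𝓞 K)) :
    regulator K / torsionOrder K * mainConst K 𝔮 * (2 ^ nrRealPlaces K) * classNumber K =
      (Ideal.absNorm 𝔮 : ℝ)⁻¹ * dedekindZeta_residue K := by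
  rw [dedekindZeta_residue_def, mainConst, mul_inv, mul_inv, inv_pow, inv_inv, mul_pow]
  field_simp

/-- The smoothed sum is asymptotic to its main term. -/
theorem HeckeChar.norm_smoothSum_sub_delta_le {𝔮 : Ideal (𝓞 K)} (χ : HeckeChar K 𝔮)
    (h𝔮 : 𝔮 ≠ ⊥) {x : ℝ} (hx : 0 < x) {A : ℝ} (hA : 1 ≤ A) {Ψ : ℝ → ℝ}
    (hΨ : IsWeissWeight (nK K) A Ψ) {κ : ℝ} (hκ : IsResidue K κ) :
    ‖smoothSum χ.toFun Ψ x - (delta χ : ℂ) *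
      ((Nat.card ((𝓞 K ⧸ 𝔮)ˣ) : ℂ) / (Ideal.absNorm 𝔮 : ℂ)) * (κ : ℂ)‖ ≤ errBound 𝔮 A x := by
  have : Finite (𝓞 K ⧸ 𝔮) := Ring.HasFiniteQuotients.finiteQuotient h𝔮
  have := Fintype.ofFinite (𝓞 K ⧸ 𝔮)
  obtain ⟨𝔞, h, hc⟩ := exists_classReps h𝔮
  by_cases hχ : IsTrivialChar χ
  · have h1 := RTZ.norm_smoothSum_sub_le h𝔮 h hc hx hA hΨ (f := χ.toFun) (e := fun _ => 1)
      (g := fun r _ => if IsUnit r then 1 else 0) (fun c => by rw [norm_one])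
      (fun r σ => by split_ifs <;> simp) fun c α hα I hI => by
        rw [χ.eq_inv_mul (hc c) hI, hχ _ (hc c).symm, inv_one]
        congr 1
        by_cases hu : IsCoprime (Ideal.span {α}) 𝔮
        · rw [if_pos ((isUnit_mk_iff α).mpr hu), hχ _ hu]
        · rw [if_neg fun h => hu ((isUnit_mk_iff α).mp h), χ.eq_zero' _ hu]
    convert h1 using 3
    rw [delta, if_pos hχ, sum_sum_isUnit, hκ.eq_dedekindZeta_residue, Finset.sum_const,
      Finset.card_univ, nsmul_one, Fintype.card_fun, Fintype.card_units_int]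
    have h2 := congrArg (fun r : ℝ => (r : ℂ)) (main_trivial_eq 𝔮)
    simp only [classNumber, nrRealPlaces] at h2
    push_cast at h2 ⊢
    linear_combination (-(Nat.card ((𝓞 K ⧸ 𝔮)ˣ) : ℂ)) * h2
  · have h1 := χ.norm_smoothSum_sub_le h𝔮 h hc hx hA hΨ
    rw [χ.main_eq_zero hχ h𝔮 h hc hA hΨ] at h1
    rwa [delta, if_neg hχ, Complex.ofReal_zero, zero_mul, zero_mul]

end MainTerm

section FinalBound

open scoped Real

theorem tsum_rpow_absNorm_le {s : ℝ} (hs : 1 < s) :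
    ∑' I : {I : Ideal (𝓞 K) // I ≠ ⊥}, (Ideal.absNorm I.1 : ℝ) ^ (-s) ≤
      (∑' m : ℕ, (m : ℝ) ^ (-s)) ^ nK K := by
  have hZ : 0 ≤ ∑' m : ℕ, (m : ℝ) ^ (-s) := tsum_nonneg fun m => by positivity
  rw [← ENNReal.ofReal_le_ofReal_iff (pow_nonneg hZ _),
    ENNReal.ofReal_tsum_of_nonneg (fun _ => by positivity) (summable_absNorm_rpow hs)]
  exact tsum_absNorm_rpow_le hs

theorem one_le_tsum_rpow {s : ℝ} (hs : 1 < s) : 1 ≤ ∑' m : ℕ, (m : ℝ) ^ (-s) := by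
  have h := (Real.summable_nat_rpow.mpr (neg_lt_neg hs)).le_tsum 1 fun _ _ => by positivity
  rwa [Nat.cast_one, Real.one_rpow] at h

/-- The trivial bound for a smoothed sum. -/
theorem norm_smoothSum_le {f : Ideal (𝓞 K) → ℂ} (hf : ∀ I, ‖f I‖ ≤ 1) {A : ℝ} (hA : 1 ≤ A)
    {Ψ : ℝ → ℝ} (hΨ : IsWeissWeight (nK K) A Ψ) {x : ℝ} (hx : 0 < x) {d : ℝ} (hd : 0 < d) :
    ‖smoothSum f Ψ x‖ ≤
      A / 2 * (x * Real.exp (2 * nK K)) ^ d * (∑' m : ℕ, (m : ℝ) ^ (-(1 + d))) ^ nK K := by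
  set X := x * Real.exp (2 * nK K) with hX
  have hX0 : 0 < X := by positivity
  have hs := (summable_absNorm_rpow (K := K) (s := 1 + d) (by linarith)).mul_left (A / 2 * X ^ d)
  refine (tsum_of_norm_bounded hs.hasSum fun I => ?_).trans ?_
  · have hN := absNorm_pos I.2
    by_cases hu : x / (Ideal.absNorm I.1 : ℝ) ∈
        Set.Icc (Real.exp (-(2 * (nK K : ℝ)) / A)) (Real.exp ((2 * (nK K : ℝ)) / A))
    · have h1 : (Ideal.absNorm I.1 : ℝ) ≤ X := by
        have h2 : Real.exp (-(2 * nK K)) ≤ x / (Ideal.absNorm I.1 : ℝ) := by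
          refine le_trans (Real.exp_le_exp.mpr ?_) hu.1
          rw [neg_div, neg_le_neg_iff]
          exact div_le_self (by positivity) hA
        rw [le_div_iff₀ hN, Real.exp_neg, inv_mul_le_iff₀ (Real.exp_pos _)] at h2
        rwa [hX, mul_comm]
      have h3 : (Ideal.absNorm I.1 : ℝ)⁻¹ ≤ X ^ d * (Ideal.absNorm I.1 : ℝ) ^ (-(1 + d)) := by
        rw [neg_add, Real.rpow_add hN, Real.rpow_neg_one, Real.rpow_neg hN.le, mul_left_comm]
        refine le_mul_of_one_le_right (by positivity) ?_
        rw [← div_eq_mul_inv, one_le_div (by positivity)]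
        exact Real.rpow_le_rpow hN.le h1 hd.le
      rw [norm_mul, norm_div, Complex.norm_natCast, Complex.norm_real, Real.norm_of_nonneg
        (hΨ.2.1 _).1]
      calc ‖f I.1‖ / (Ideal.absNorm I.1 : ℝ) * Ψ (x / (Ideal.absNorm I.1 : ℝ))
          ≤ (Ideal.absNorm I.1 : ℝ)⁻¹ * (A / 2) := by
            refine mul_le_mul ?_ (hΨ.2.1 _).2 (hΨ.2.1 _).1 (by positivity)
            rw [← one_div]
            exact div_le_div_of_nonneg_right (hf _) hN.le
        _ ≤ X ^ d * (Ideal.absNorm I.1 : ℝ) ^ (-(1 + d)) * (A / 2) :=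
            mul_le_mul_of_nonneg_right h3 (by linarith)
        _ = A / 2 * X ^ d * (Ideal.absNorm I.1 : ℝ) ^ (-(1 + d)) := by ring
    · rw [hΨ.2.2.1 _ hu, Complex.ofReal_zero, mul_zero, norm_zero]
      have : 0 ≤ A := by linarith
      positivity
  · rw [tsum_mul_left]
    refine mul_le_mul_of_nonneg_left (tsum_rpow_absNorm_le (by linarith)) ?_
    have : 0 ≤ A := by linarith
    positivity

/-- The constant in the error term. -/
def errCst : ℝ := 32 * 10 ^ 8 * ∑' m : ℕ, (m : ℝ) ^ (-(3 / 2) : ℝ)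

/-- The constant in the trivial bound. -/
def trivCst : ℝ := Real.exp 2 * ∑' m : ℕ, (m : ℝ) ^ (-(1 + 1 / 16) : ℝ)

theorem one_le_errCst : 1 ≤ errCst := by
  have := one_le_tsum_rpow (s := 3 / 2) (by norm_num)
  rw [errCst]
  linarith

/-- A polynomial bound for all the parameters. -/
def paramProd (K : Type*) [Field K] [NumberField K] (Q T : ℝ) : ℝ :=
  (nK K : ℝ) ^ nK K * DK K * Q * T ^ nK K

theorem one_le_DK : (1 : ℝ) ≤ DK K := by
  exact_mod_cast Nat.one_le_iff_ne_zero.mpr (Int.natAbs_ne_zero.mpr (discr_ne_zero K))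

theorem one_le_nK : (1 : ℝ) ≤ nK K := by exact_mod_cast nK_pos (K := K)

theorem one_le_paramProd {Q T : ℝ} (hQ : 1 ≤ Q) (hT : 1 ≤ T) : 1 ≤ paramProd K Q T := by
  unfold paramProd
  exact one_le_mul_of_one_le_of_one_le (one_le_mul_of_one_le_of_one_le
    (one_le_mul_of_one_le_of_one_le (one_le_pow₀ one_le_nK) one_le_DK) hQ) (one_le_pow₀ hT)

theorem errBound_le {𝔮 : Ideal (𝓞 K)} {Q T : ℝ} (hQ : 1 ≤ Q) (hT : 1 ≤ T)
    (h : (Ideal.absNorm 𝔮 : ℝ) ≤ Q ^ 2) {x : ℝ} (hx : 0 < x) :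
    errBound 𝔮 (T * √(2 * nK K)) x ≤
      errCst ^ nK K * (paramProd K Q T ^ 4 * x ^ (-(3 / 2) : ℝ)) := by
  have hD := one_le_DK (K := K)
  have hn := one_le_nK (K := K)
  have hZ := one_le_tsum_rpow (s := 3 / 2) (by norm_num)
  have h1 : (DK K * Ideal.absNorm 𝔮 : ℝ) ^ (3 / 2 : ℝ) ≤ (DK K * Q) ^ 4 := by
    calc (DK K * Ideal.absNorm 𝔮 : ℝ) ^ (3 / 2 : ℝ)
        ≤ ((DK K * Q) ^ 2 : ℝ) ^ (3 / 2 : ℝ) := by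
          refine Real.rpow_le_rpow (by positivity) ?_ (by norm_num)
          rw [mul_pow]
          refine mul_le_mul ?_ h (by positivity) (by positivity)
          exact le_self_pow₀ hD two_ne_zero
      _ ≤ ((DK K * Q) ^ 2 : ℝ) ^ (2 : ℝ) :=
          Real.rpow_le_rpow_of_exponent_le (one_le_pow₀ (one_le_mul_of_one_le_of_one_le hD hQ))
            (by norm_num)
      _ = (DK K * Q) ^ 4 := by rw [Real.rpow_two, ← pow_mul]
  have h2 : (T * √(2 * nK K)) ^ 4 ≤ 4 * ((nK K : ℝ) * T) ^ 4 := by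
    have : (T * √(2 * nK K)) ^ 4 = 4 * ((nK K : ℝ) ^ 2 * T ^ 4) := by
      have h3 : √(2 * (nK K : ℝ)) ^ 4 = (2 * nK K) ^ 2 := by
        rw [show (4 : ℕ) = 2 * 2 from rfl, pow_mul, Real.sq_sqrt (by positivity)]
      rw [mul_pow, h3]
      ring
    rw [this, mul_pow]
    gcongr
    norm_num
  rw [errBound]
  set Z := ∑' m : ℕ, (m : ℝ) ^ (-(3 / 2) : ℝ) with hZd
  have hZ0 : 0 ≤ Z := by linarith
  calc (8 * 10 ^ 8 * Z * (T * √(2 * nK K)) ^ 4) ^ nK K *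
        ((DK K * Ideal.absNorm 𝔮 : ℝ) ^ (3 / 2 : ℝ) * x ^ (-(3 / 2) : ℝ))
      ≤ (8 * 10 ^ 8 * Z * (4 * ((nK K : ℝ) * T) ^ 4)) ^ nK K *
        ((DK K * Q) ^ 4 * x ^ (-(3 / 2) : ℝ)) := by gcongr
    _ = errCst ^ nK K * (paramProd K Q T ^ 4 * x ^ (-(3 / 2) : ℝ)) := by
        have h4 : 8 * 10 ^ 8 * Z * (4 * ((nK K : ℝ) * T) ^ 4) =
            errCst * ((nK K : ℝ) * T) ^ 4 := by rw [errCst]; ring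
        rw [h4, mul_pow errCst, paramProd, ← pow_mul, mul_comm 4, pow_mul, mul_pow (nK K : ℝ)]
        ring

theorem trivial_bound_le {f : Ideal (𝓞 K) → ℂ} (hf : ∀ I, ‖f I‖ ≤ 1) {T : ℝ} (hT : 1 ≤ T)
    {Ψ : ℝ → ℝ} (hΨ : IsWeissWeight (nK K) (T * √(2 * nK K)) Ψ) {x P : ℝ} (hx : 0 < x)
    (hP : 0 ≤ P) (hxP : x ≤ P ^ 4) :
    ‖smoothSum f Ψ x‖ ≤ trivCst ^ nK K * (T * P ^ (1 / 4 : ℝ)) := by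
  have hn := one_le_nK (K := K)
  have hs : 1 ≤ √(2 * (nK K : ℝ)) := Real.one_le_sqrt.mpr (by linarith)
  have hZ := one_le_tsum_rpow (s := 1 + 1 / 16) (by norm_num)
  refine (norm_smoothSum_le hf (one_le_mul_of_one_le_of_one_le hT hs) hΨ hx
    (d := 1 / 16) (by norm_num)).trans ?_
  rw [trivCst]
  set Z := ∑' m : ℕ, (m : ℝ) ^ (-(1 + 1 / 16) : ℝ) with hZd
  have h1 : x ^ (1 / 16 : ℝ) ≤ P ^ (1 / 4 : ℝ) := by
    refine (Real.rpow_le_rpow hx.le hxP (by norm_num)).trans (le_of_eq ?_)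
    rw [← Real.rpow_natCast, ← Real.rpow_mul hP]
    norm_num
  have h2 : √(2 * (nK K : ℝ)) / 2 ≤ Real.exp (nK K) := by
    have h3 : √(2 * (nK K : ℝ)) ≤ 2 * nK K :=
      Real.sqrt_le_iff.mpr ⟨by positivity, by nlinarith⟩
    have h4 := Real.add_one_le_exp (nK K : ℝ)
    linarith
  have h5 : Real.exp (2 * nK K) ^ (1 / 16 : ℝ) ≤ Real.exp (nK K) := by
    rw [← Real.exp_mul]
    refine Real.exp_le_exp.mpr ?_
    linarith
  have h6 : Real.exp 2 ^ nK K = Real.exp (nK K) * Real.exp (nK K) := by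
    rw [← Real.exp_nat_mul, ← Real.exp_add]
    congr 1
    ring
  rw [Real.mul_rpow hx.le (Real.exp_pos _).le, mul_pow, h6]
  calc T * √(2 * (nK K : ℝ)) / 2 * (x ^ (1 / 16 : ℝ) * Real.exp (2 * nK K) ^ (1 / 16 : ℝ)) *
        Z ^ nK K
      = T * (√(2 * (nK K : ℝ)) / 2) * (x ^ (1 / 16 : ℝ) *
        Real.exp (2 * nK K) ^ (1 / 16 : ℝ)) * Z ^ nK K := by ring
    _ ≤ T * Real.exp (nK K) * (P ^ (1 / 4 : ℝ) * Real.exp (nK K)) * Z ^ nK K := by gcongr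
    _ = Real.exp (nK K) * Real.exp (nK K) * Z ^ nK K * (T * P ^ (1 / 4 : ℝ)) := by ring

theorem mul_paramProd_le {Q T ε : ℝ} (hQ : 1 ≤ Q) (hT : 1 ≤ T) (hε : 0 < ε) :
    T * paramProd K Q T ^ (1 / 4 : ℝ) ≤
      ((nK K : ℝ) ^ ((nK K : ℝ) / 4) * (DK K : ℝ) ^ ((1 : ℝ) / 2) * Q ^ ((1 : ℝ) / 2) *
        T ^ ((nK K : ℝ) / 2 + 1)) ^ (1 + ε) := by
  have hD := one_le_DK (K := K)
  have hn := one_le_nK (K := K)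
  have hT0 : 0 < T := by linarith
  have h1 : T * paramProd K Q T ^ (1 / 4 : ℝ) = (nK K : ℝ) ^ ((nK K : ℝ) / 4) *
      (DK K : ℝ) ^ ((1 : ℝ) / 4) * Q ^ ((1 : ℝ) / 4) * T ^ ((nK K : ℝ) / 4 + 1) := by
    rw [paramProd, Real.mul_rpow (by positivity) (by positivity), Real.mul_rpow (by positivity)
      (by positivity), Real.mul_rpow (by positivity) (by positivity), ← Real.rpow_natCast,
      ← Real.rpow_natCast, ← Real.rpow_mul (by positivity), ← Real.rpow_mul hT0.le,
      Real.rpow_add hT0, Real.rpow_one, mul_one_div]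
    ring
  rw [h1]
  have h2 : 1 ≤ (nK K : ℝ) ^ ((nK K : ℝ) / 4) * (DK K : ℝ) ^ ((1 : ℝ) / 2) * Q ^ ((1 : ℝ) / 2) *
      T ^ ((nK K : ℝ) / 2 + 1) :=
    one_le_mul_of_one_le_of_one_le (one_le_mul_of_one_le_of_one_le (one_le_mul_of_one_le_of_one_le
      (Real.one_le_rpow hn (by positivity)) (Real.one_le_rpow hD (by norm_num)))
      (Real.one_le_rpow hQ (by norm_num))) (Real.one_le_rpow hT (by positivity))
  refine le_trans ?_ (Real.self_le_rpow_of_one_le h2 (by linarith))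
  gcongr <;> norm_num

end FinalBound

section Conclusion

open scoped Real

theorem norm_sub_le_of_bounds {S : ℝ → ℂ} {M : ℂ} {a b x P U : ℝ} (hP : 1 ≤ P) (hU : 1 ≤ U)
    (ha : 0 ≤ a) (hx : 0 < x)
    (h1 : ∀ y, 0 < y → ‖S y - M‖ ≤ a * (P ^ 4 * y ^ (-(3 / 2) : ℝ)))
    (h2 : ∀ y, 0 < y → y ≤ P ^ 4 → ‖S y‖ ≤ b * U) :
    ‖S x - M‖ ≤ (a + 2 * b) * U := by
  have hP0 : 0 < P := by linarith
  have h3 : ∀ y, P ^ 4 ≤ y → ‖S y - M‖ ≤ a * U := by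
    intro y hy
    have hP4 : 0 < P ^ 4 := by positivity
    refine (h1 y (hP4.trans_le hy)).trans (mul_le_mul_of_nonneg_left (le_trans ?_ hU) ha)
    calc P ^ 4 * y ^ (-(3 / 2) : ℝ) ≤ P ^ 4 * (P ^ 4) ^ (-1 : ℝ) := by
          refine mul_le_mul_of_nonneg_left ?_ hP4.le
          refine (Real.rpow_le_rpow_of_nonpos hP4 hy (by norm_num)).trans ?_
          exact Real.rpow_le_rpow_of_exponent_le (one_le_pow₀ hP) (by norm_num)
      _ = 1 := by rw [Real.rpow_neg_one, mul_inv_cancel₀ hP4.ne']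
  have hP4 : 0 < P ^ 4 := by positivity
  have hb : 0 ≤ b * U := (norm_nonneg _).trans (h2 (P ^ 4) hP4 le_rfl)
  rcases le_total (P ^ 4) x with h | h
  · linarith [h3 x h]
  · have e : S x - M = S x - S (P ^ 4) + (S (P ^ 4) - M) := by ring
    rw [e]
    linarith [norm_add_le (S x - S (P ^ 4)) (S (P ^ 4) - M), norm_sub_le (S x) (S (P ^ 4)),
      h3 _ le_rfl, h2 x hx h, h2 _ hP4 le_rfl]

theorem trivCst_pos : 0 < trivCst :=
  mul_pos (Real.exp_pos 2) (one_pos.trans_le (one_le_tsum_rpow (s := 1 + 1 / 16) (by norm_num)))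

theorem pow_errCst_add_le {n : ℕ} (hn : n ≠ 0) :
    errCst ^ n + 2 * trivCst ^ n ≤ Real.exp (Real.log (errCst + 2 * trivCst) * n) := by
  have h1 := one_le_errCst
  have h2 := trivCst_pos
  rw [mul_comm (Real.log _), Real.exp_nat_mul, Real.exp_log (by linarith)]
  refine le_trans ?_ (pow_add_pow_le (by linarith) (by linarith) hn)
  rw [mul_pow]
  gcongr
  exact le_self_pow₀ one_le_two hn

end Conclusion

/-- **Smoothed character sum** (Lemma 3.4). For a primitive congruence class group
`H (mod 𝔮)`, `0 < ε < 1/2`, `T ≥ 1`, a character `χ` with `χ(H) = 1`, and all `x > 0`: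
`|Σ_𝔫 (χ(𝔫)/N𝔫) Ψ(x/N𝔫) - δ(χ) (φ(𝔮)/N𝔮) κ_K|
   ≤ e^{O_ε(n_K)} {n_K^{n_K/4} D_K^{1/2} Q^{1/2} T^{n_K/2+1}}^{1+ε}`. -/
theorem smoothed_character_sum :
    ∀ ε : ℝ, 0 < ε → ε < 1 / 2 →
    ∃ C : ℝ, 0 < C ∧
      ∀ (K : Type) [Field K] [NumberField K] (𝔮 : Ideal (𝓞 K))
        (H : CongClassGroup K 𝔮) (χ : HeckeChar K 𝔮) (T x κ : ℝ) (Ψ : ℝ → ℝ),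
        IsPrimitiveCCG H → CharTrivOn χ H → 1 ≤ T → 0 < x →
        IsResidue K κ →
        IsWeissWeight (nK K) (T * Real.sqrt (2 * (nK K : ℝ))) Ψ →
        ‖(∑' 𝔫 : {I : Ideal (𝓞 K) // I ≠ ⊥},
            χ.toFun 𝔫.1 / (Ideal.absNorm 𝔫.1 : ℂ) *
              (Ψ (x / (Ideal.absNorm 𝔫.1 : ℝ)) : ℂ)) -
          (delta χ : ℂ) * ((Nat.card ((𝓞 K ⧸ 𝔮)ˣ) : ℂ) / (Ideal.absNorm 𝔮 : ℂ)) *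
            (κ : ℂ)‖ ≤
          Real.exp (C * (nK K : ℝ)) *
            ((nK K : ℝ) ^ ((nK K : ℝ) / 4) * (DK K : ℝ) ^ ((1 : ℝ) / 2) *
              (QH H : ℝ) ^ ((1 : ℝ) / 2) * T ^ ((nK K : ℝ) / 2 + 1)) ^ (1 + ε) := by
  intro ε hε _
  refine ⟨Real.log (errCst + 2 * trivCst), Real.log_pos ?_, ?_⟩
  · linarith [one_le_errCst, trivCst_pos]
  intro K _ _ 𝔮 H χ T x κ Ψ hH _ hT hx hκ hΨ
  have hq := hH.ne_bot
  have hQ : (1 : ℝ) ≤ QH H := by exact_mod_cast one_le_QH hq H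
  have hN : (Ideal.absNorm 𝔮 : ℝ) ≤ (QH H : ℝ) ^ 2 := by exact_mod_cast absNorm_le_QH_sq hH
  have hP := one_le_paramProd (K := K) hQ hT
  have hA : 1 ≤ T * Real.sqrt (2 * (nK K : ℝ)) := one_le_mul_of_one_le_of_one_le hT
    (Real.one_le_sqrt.mpr (by linarith [one_le_nK (K := K)]))
  refine (norm_sub_le_of_bounds (S := smoothSum χ.toFun Ψ) (a := errCst ^ nK K)
    (b := trivCst ^ nK K) hP (one_le_mul_of_one_le_of_one_le hT (Real.one_le_rpow hP (by norm_num)))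
    (pow_nonneg (by linarith [one_le_errCst]) _) hx
    (fun y hy => (χ.norm_smoothSum_sub_delta_le hq hy hA hΨ hκ).trans (errBound_le hQ hT hN hy))
    fun y hy hyP => trivial_bound_le χ.norm_le_one hT hΨ hy (by linarith) hyP).trans ?_
  exact mul_le_mul (pow_errCst_add_le (nK_pos (K := K)).ne') (mul_paramProd_le hQ hT hε)
    (by positivity) (Real.exp_pos _).le

end RTZ
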